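/- Let n ≥ 2 and fix a smooth function φ₀ on ℝ^n, compactly supported in the closed unit ball, with ∫φ₀ = 1. There is a constant C > 0, depending only on n and φ₀, with the following property: for every locally integrable f : ℝ^n → ℝ with ‖f‖_{H^{log}} < ∞ there exist sequences (u_k)_{k≥0} and (v_k)_{k≥0} of locally integrable functions on ℝ^n such that ‖u_k‖_{H¹} < ∞ and ‖v_k‖_{BMO⁺} < ∞ for every k, each pointwise product u_k v_k belongs to L¹(ℝ^n), the partial sums Σ_{k≤N} ∫_{ℝ^n} u_k v_k ψ dx converge to ∫_{ℝ^n} f ψ dx as N → ∞ for every ψ ∈ C_c^∞(ℝ^n) (i.e. f = Σ_k u_k v_k in the sense of distributions), and Σ_k ‖u_k‖_{H¹} ‖v_k‖_{BMO⁺} ≤ C ‖f‖_{H^{log}}. -/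

import Mathlib

open MeasureTheory Metric Real Filter
open scoped ENNReal Topology BigOperators

noncomputable section

/-- `ℝⁿ` with the Euclidean structure. -/
abbrev Eucl (n : ℕ) := EuclideanSpace ℝ (Fin n)

/-- The dilated function `φ_t(x) = t^{-n} φ(x/t)`. -/
def dil (n : ℕ) (φ : Eucl n → ℝ) (t : ℝ) (x : Eucl n) : ℝ :=
  (t ^ n)⁻¹ * φ (t⁻¹ • x)

/-- The maximal function `f⁺(x) = sup_{t>0} |(f * φ_t)(x)|`, with values in `ℝ≥0∞`. -/
def maxFun (n : ℕ) (φ : Eucl n → ℝ) (f : Eucl n → ℝ) (x : Eucl n) : ℝ≥0∞ :=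
  ⨆ (t : ℝ) (_ : 0 < t), ENNReal.ofReal |∫ y, f y * dil n φ t (x - y)|

/-- `‖f‖_{H¹} = ∫ f⁺`. -/
def H1Norm (n : ℕ) (φ : Eucl n → ℝ) (f : Eucl n → ℝ) : ℝ≥0∞ :=
  ∫⁻ x, maxFun n φ f x

/-- The growth function `θ(x,t) = t / (log(e+|x|) + log(e+t))`, extended to `t ∈ ℝ≥0∞`. -/
def thetaE (n : ℕ) (x : Eucl n) (t : ℝ≥0∞) : ℝ≥0∞ :=
  t / ENNReal.ofReal (Real.log (Real.exp 1 + ‖x‖) + Real.log (Real.exp 1 + t.toReal))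

/-- The Luxemburg (quasi-)norm associated to `θ`. -/
def luxNorm (n : ℕ) (g : Eucl n → ℝ≥0∞) : ℝ≥0∞ :=
  sInf {lam : ℝ≥0∞ | lam ≠ 0 ∧ ∫⁻ x, thetaE n x (g x / lam) ≤ 1}

/-- `‖f‖_{H^{log}} = ‖f⁺‖_{L^θ}`. -/
def HlogNorm (n : ℕ) (φ : Eucl n → ℝ) (f : Eucl n → ℝ) : ℝ≥0∞ :=
  luxNorm n (maxFun n φ f)

/-- Mean of `g` over a set `B`. -/
def setAvg (n : ℕ) (g : Eucl n → ℝ) (B : Set (Eucl n)) : ℝ :=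
  (∫ x in B, g x) / (volume B).toReal

/-- The open unit cube `(0,1)ⁿ`. -/
def unitCube (n : ℕ) : Set (Eucl n) := {x | ∀ i, x i ∈ Set.Ioo (0 : ℝ) 1}

/-- `‖g‖_{BMO⁺} = ∫_{(0,1)ⁿ} |g| + sup_B |B|⁻¹ ∫_B |g - g_B|`. -/
def BMOplus (n : ℕ) (g : Eucl n → ℝ) : ℝ≥0∞ :=
  (∫⁻ x in unitCube n, ENNReal.ofReal |g x|) +
    ⨆ (x₀ : Eucl n) (r : ℝ) (_ : 0 < r),
      (∫⁻ x in ball x₀ r, ENNReal.ofReal |g x - setAvg n g (ball x₀ r)|) / volume (ball x₀ r)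

section

/-- Quantitative properties of the kernel `φ₀` which are used below. -/
structure IsKer (n : ℕ) (φ : Eucl n → ℝ) (M : ℝ) : Prop where
  cont : Continuous φ
  supp : ∀ x, 1 < ‖x‖ → φ x = 0
  bound : ∀ x, |φ x| ≤ M
  lip : ∀ x y, |φ x - φ y| ≤ M * ‖x - y‖
  int : ∫ x, φ x = 1
  one_le : 1 ≤ M

theorem exists_isKer (n : ℕ) (φ : Eucl n → ℝ) (hs : ContDiff ℝ (⊤ : ℕ∞) φ)
    (hsupp : Function.support φ ⊆ Metric.closedBall 0 1) (hint : ∫ x, φ x = 1) :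
    ∃ M, IsKer n φ M := by
  have hc : HasCompactSupport φ :=
    HasCompactSupport.intro (isCompact_closedBall 0 1) fun x hx => by
      by_contra h
      exact hx (hsupp h)
  obtain ⟨C, hC⟩ := hs.continuous.bounded_above_of_compact_support hc
  obtain ⟨D, hD⟩ := ContDiff.lipschitzWith_of_hasCompactSupport hc hs (by simp)
  refine ⟨max 1 (max C D), hs.continuous, fun x hx => ?_, fun x => ?_, fun x y => ?_, hint,
    le_max_left _ _⟩
  · by_contra h
    have := hsupp h
    simp at this
    linarith
  · exact (hC x).trans ((le_max_left _ _).trans (le_max_right _ _))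
  · have := hD.dist_le_mul x y
    rw [Real.dist_eq, dist_eq_norm] at this
    refine this.trans ?_
    gcongr
    exact (le_max_right _ _).trans (le_max_right _ _)

section Dilation

variable {n : ℕ} {φ : Eucl n → ℝ} {M : ℝ}

theorem IsKer.nonneg (h : IsKer n φ M) : 0 ≤ M := zero_le_one.trans h.one_le

theorem IsKer.dil_cont (h : IsKer n φ M) (t : ℝ) : Continuous (dil n φ t) := by
  unfold dil
  exact continuous_const.mul (h.cont.comp (continuous_const_smul _))

theorem IsKer.dil_bound (h : IsKer n φ M) {t : ℝ} (ht : 0 < t) (x : Eucl n) :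
    |dil n φ t x| ≤ M * (t ^ n)⁻¹ := by
  unfold dil
  rw [abs_mul, abs_of_pos (by positivity), mul_comm]
  gcongr
  exact h.bound _

theorem IsKer.dil_lip (h : IsKer n φ M) {t : ℝ} (ht : 0 < t) (x y : Eucl n) :
    |dil n φ t x - dil n φ t y| ≤ M * (t ^ (n + 1))⁻¹ * ‖x - y‖ := by
  unfold dil
  rw [← mul_sub, abs_mul, abs_of_pos (by positivity : 0 < (t ^ n)⁻¹)]
  calc (t ^ n)⁻¹ * |φ (t⁻¹ • x) - φ (t⁻¹ • y)|
      ≤ (t ^ n)⁻¹ * (M * ‖t⁻¹ • x - t⁻¹ • y‖) := by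
        gcongr
        exact h.lip _ _
    _ = M * (t ^ (n + 1))⁻¹ * ‖x - y‖ := by
        rw [← smul_sub, norm_smul, norm_inv, Real.norm_eq_abs, abs_of_pos ht, pow_succ, mul_inv]
        ring

theorem IsKer.dil_eq_zero (h : IsKer n φ M) {t : ℝ} (ht : 0 < t) {x : Eucl n} (hx : t < ‖x‖) :
    dil n φ t x = 0 := by
  unfold dil
  rw [h.supp, mul_zero]
  rw [norm_smul, norm_inv, Real.norm_eq_abs, abs_of_pos ht]
  rwa [← div_eq_inv_mul, one_lt_div ht]

theorem IsKer.dil_hcs (h : IsKer n φ M) {t : ℝ} (ht : 0 < t) :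
    HasCompactSupport (dil n φ t) :=
  HasCompactSupport.intro (isCompact_closedBall 0 t) fun x hx => h.dil_eq_zero ht (by simpa using hx)

theorem IsKer.dil_integrable (h : IsKer n φ M) {t : ℝ} (ht : 0 < t) :
    Integrable (dil n φ t) volume :=
  (h.dil_cont t).integrable_of_hasCompactSupport (h.dil_hcs ht)

theorem IsKer.integral_dil (h : IsKer n φ M) {t : ℝ} (ht : 0 < t) : ∫ x, dil n φ t x = 1 := by
  unfold dil
  rw [integral_const_mul, Measure.integral_comp_inv_smul, h.int]
  simp only [finrank_euclideanSpace, Fintype.card_fin, smul_eq_mul, mul_one]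
  rw [abs_of_pos (by positivity), inv_mul_cancel₀ (by positivity)]

theorem IsKer.integral_abs_dil (_h : IsKer n φ M) {t : ℝ} (ht : 0 < t) :
    ∫ x, |dil n φ t x| = ∫ x, |φ x| := by
  unfold dil
  simp_rw [abs_mul]
  rw [integral_const_mul, Measure.integral_comp_inv_smul volume (fun x => |φ x|)]
  simp only [finrank_euclideanSpace, Fintype.card_fin, smul_eq_mul]
  rw [abs_of_pos (by positivity : (0:ℝ) < (t^n)⁻¹), abs_of_pos (by positivity), ← mul_assoc,
    inv_mul_cancel₀ (by positivity), one_mul]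

theorem IsKer.one_le_integral_abs (h : IsKer n φ M) : 1 ≤ ∫ x, |φ x| := by
  rw [← h.int]
  exact (le_abs_self _).trans (abs_integral_le_integral_abs)

/-- Volume of the unit ball. -/
def ubv (n : ℕ) : ℝ := volume.real (ball (0 : Eucl n) 1)

theorem ubv_pos (n : ℕ) : 0 < ubv n := by
  unfold ubv
  exact ENNReal.toReal_pos (measure_ball_pos _ _ one_pos).ne' measure_ball_lt_top.ne

theorem volume_real_ball (x : Eucl n) {r : ℝ} (hr : 0 < r) :
    volume.real (ball x r) = r ^ n * ubv n := by
  unfold ubv Measure.real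
  rw [Measure.addHaar_ball_of_pos _ _ hr, ENNReal.toReal_mul, ENNReal.toReal_ofReal (by positivity)]
  simp

theorem volume_ball_eq (x : Eucl n) {r : ℝ} (hr : 0 < r) :
    volume (ball x r) = ENNReal.ofReal (r ^ n * ubv n) := by
  rw [← volume_real_ball x hr, ofReal_measureReal measure_ball_lt_top.ne]

theorem le_maxFun {f : Eucl n → ℝ} {t : ℝ} (ht : 0 < t) (x : Eucl n) :
    ENNReal.ofReal |∫ y, f y * dil n φ t (x - y)| ≤ maxFun n φ f x := by
  unfold maxFun
  exact le_iSup₂_of_le t ht le_rfl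

theorem integrable_bdd_supp {u : Eucl n → ℝ} {x₀ : Eucl n} {r c : ℝ} (hm : Measurable u)
    (hb : ∀ x, |u x| ≤ c) (hs : ∀ x, r ≤ ‖x - x₀‖ → u x = 0) : Integrable u volume := by
  have : Integrable ((ball x₀ r).indicator fun _ => c) volume :=
    (integrable_indicator_iff measurableSet_ball).2 (integrableOn_const measure_ball_lt_top.ne)
  refine this.mono' hm.aestronglyMeasurable (Eventually.of_forall fun x => ?_)
  by_cases hx : x ∈ ball x₀ r
  · simpa [Set.indicator_of_mem hx] using hb x
  · rw [Set.indicator_of_notMem hx, hs x (by simpa [dist_eq_norm] using hx)]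
    simp

theorem abs_integral_le_of_supp {F : Eucl n → ℝ} {x₀ : Eucl n} {r c : ℝ} (hr : 0 < r)
    (hb : ∀ x, |F x| ≤ c) (hs : ∀ x, r ≤ ‖x - x₀‖ → F x = 0) :
    |∫ x, F x| ≤ c * (r ^ n * ubv n) := by
  have h1 : ∫ x, F x = ∫ x in ball x₀ r, F x := by
    rw [setIntegral_eq_integral_of_forall_compl_eq_zero]
    intro x hx
    exact hs x (by simpa [dist_eq_norm] using hx)
  rw [h1, ← volume_real_ball x₀ hr, ← Real.norm_eq_abs]
  exact norm_setIntegral_le_of_norm_le_const measure_ball_lt_top fun x _ => hb x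

end Dilation

end

section

/-- A bounded function of mean zero supported in a ball. -/
structure IsHAtom (n : ℕ) (x₀ : Eucl n) (r c : ℝ) (u : Eucl n → ℝ) : Prop where
  meas : Measurable u
  bound : ∀ x, |u x| ≤ c
  supp : ∀ x, r ≤ ‖x - x₀‖ → u x = 0
  mean : ∫ x, u x = 0

theorem IsHAtom.integrable {n : ℕ} {x₀ : Eucl n} {r c : ℝ} {u : Eucl n → ℝ}
    (h : IsHAtom n x₀ r c u) : Integrable u volume :=
  integrable_bdd_supp h.meas h.bound h.supp

theorem IsHAtom.nonneg {n : ℕ} {x₀ : Eucl n} {r c : ℝ} {u : Eucl n → ℝ}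
    (h : IsHAtom n x₀ r c u) : 0 ≤ c := (abs_nonneg _).trans (h.bound 0)

theorem IsHAtom.conv_le_near {n : ℕ} {φ : Eucl n → ℝ} {M : ℝ} (hφ : IsKer n φ M)
    {x₀ : Eucl n} {r c : ℝ} {u : Eucl n → ℝ} (h : IsHAtom n x₀ r c u) {t : ℝ} (ht : 0 < t)
    (x : Eucl n) : |∫ y, u y * dil n φ t (x - y)| ≤ c * ∫ y, |φ y| := by
  have h1 : Integrable (fun y => |dil n φ t (x - y)|) volume :=
    ((hφ.dil_integrable ht).comp_sub_left x).abs
  calc |∫ y, u y * dil n φ t (x - y)| ≤ ∫ y, |u y * dil n φ t (x - y)| :=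
        abs_integral_le_integral_abs
    _ ≤ ∫ y, c * |dil n φ t (x - y)| := by
        refine integral_mono_of_nonneg (Eventually.of_forall fun _ => abs_nonneg _)
          (h1.const_mul c) (Eventually.of_forall fun y => ?_)
        simp only [abs_mul]
        exact mul_le_mul_of_nonneg_right (h.bound y) (abs_nonneg _)
    _ = c * ∫ y, |φ y| := by
        rw [integral_const_mul, integral_sub_left_eq_self (fun y => |dil n φ t y|) volume x,
          hφ.integral_abs_dil ht]

theorem IsHAtom.conv_le_far {n : ℕ} {φ : Eucl n → ℝ} {M : ℝ} (hφ : IsKer n φ M)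
    {x₀ : Eucl n} {r c : ℝ} (hr : 0 < r) {u : Eucl n → ℝ} (h : IsHAtom n x₀ r c u) {t : ℝ}
    (ht : 0 < t) {x : Eucl n} (hx : 2 * r ≤ ‖x - x₀‖) :
    |∫ y, u y * dil n φ t (x - y)| ≤
      c * M * ubv n * r ^ (n + 1) * ((‖x - x₀‖ / 2) ^ (n + 1))⁻¹ := by
  have hM := hφ.nonneg
  have hu := (ubv_pos n).le
  have hc := h.nonneg
  by_cases htd : t < ‖x - x₀‖ / 2
  · have : ∀ y, u y * dil n φ t (x - y) = 0 := by
      intro y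
      by_cases hy : r ≤ ‖y - x₀‖
      · rw [h.supp y hy, zero_mul]
      · rw [hφ.dil_eq_zero ht, mul_zero]
        have := norm_sub_le_norm_sub_add_norm_sub x y x₀
        push Not at hy
        linarith
    simp only [this, integral_zero, abs_zero]
    positivity
  · push Not at htd
    have hd : 0 < ‖x - x₀‖ / 2 := by linarith
    have hint1 : Integrable (fun y => u y * dil n φ t (x - y)) volume := by
      refine h.integrable.mul_bdd (c := M * (t ^ n)⁻¹) ?_ ?_
      · exact ((hφ.dil_cont t).comp (continuous_const.sub continuous_id)).aestronglyMeasurable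
      · exact Eventually.of_forall fun y => hφ.dil_bound ht _
    have e : ∫ y, u y * dil n φ t (x - y)
        = ∫ y, u y * (dil n φ t (x - y) - dil n φ t (x - x₀)) := by
      simp_rw [mul_sub]
      rw [integral_sub hint1 (h.integrable.mul_const _), integral_mul_const, h.mean]
      simp
    rw [e]
    have := abs_integral_le_of_supp (F := fun y => u y * (dil n φ t (x - y) - dil n φ t (x - x₀)))
      (x₀ := x₀) (r := r) (c := c * (M * (t ^ (n + 1))⁻¹ * r)) hr (fun y => ?_) (fun y hy => ?_)
    · refine this.trans ?_
      have : (t ^ (n + 1))⁻¹ ≤ ((‖x - x₀‖ / 2) ^ (n + 1))⁻¹ := by gcongr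
      calc c * (M * (t ^ (n + 1))⁻¹ * r) * (r ^ n * ubv n)
          = c * M * ubv n * r ^ (n + 1) * (t ^ (n + 1))⁻¹ := by ring
        _ ≤ _ := by gcongr
    · rw [abs_mul]
      by_cases hy : r ≤ ‖y - x₀‖
      · rw [h.supp y hy]
        simp
        positivity
      · gcongr
        · exact h.bound y
        · refine (hφ.dil_lip ht _ _).trans ?_
          gcongr
          rw [sub_sub_sub_cancel_left, norm_sub_rev]
          exact (not_le.1 hy).le
    · simp [h.supp y hy]

theorem IsHAtom.maxFun_le {n : ℕ} {φ : Eucl n → ℝ} {M : ℝ} (hφ : IsKer n φ M)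
    {x₀ : Eucl n} {r c : ℝ} (hr : 0 < r) {u : Eucl n → ℝ} (h : IsHAtom n x₀ r c u) (x : Eucl n) :
    maxFun n φ u x ≤ ∑' j : ℕ, (ball x₀ (2 ^ (j + 2) * r)).indicator
      (fun _ => ENNReal.ofReal (c * ((∫ y, |φ y|) + M * ubv n) * ((1 / 2) ^ (j * (n + 1))))) x := by
  have hM := hφ.nonneg
  have hu := (ubv_pos n).le
  have hc := h.nonneg
  have hI := hφ.one_le_integral_abs
  unfold maxFun
  refine iSup₂_le fun t ht => ?_
  by_cases hx : ‖x - x₀‖ < 2 * r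
  · refine le_trans ?_ (ENNReal.le_tsum 0)
    rw [Set.indicator_of_mem (by rw [mem_ball, dist_eq_norm]; norm_num; linarith)]
    refine ENNReal.ofReal_le_ofReal ((h.conv_le_near hφ ht x).trans ?_)
    simp only [zero_mul, pow_zero, mul_one]
    gcongr
    have : 0 ≤ M * ubv n := by positivity
    linarith
  · push Not at hx
    obtain ⟨j, hj1, hj2⟩ : ∃ j : ℕ, 2 ^ j ≤ ‖x - x₀‖ / (2 * r) ∧ ‖x - x₀‖ / (2 * r) < 2 ^ (j + 1) :=
      exists_nat_pow_near (by rw [le_div_iff₀ (by positivity)]; linarith) one_lt_two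
    rw [le_div_iff₀ (by positivity)] at hj1
    rw [div_lt_iff₀ (by positivity)] at hj2
    refine le_trans ?_ (ENNReal.le_tsum j)
    rw [Set.indicator_of_mem (by rw [mem_ball, dist_eq_norm]; refine hj2.trans_eq ?_; ring)]
    refine ENNReal.ofReal_le_ofReal ((h.conv_le_far hφ hr ht hx).trans ?_)
    have h2 : ((‖x - x₀‖ / 2) ^ (n + 1))⁻¹ ≤ ((2 ^ j * r) ^ (n + 1))⁻¹ := by
      gcongr
      linarith
    calc c * M * ubv n * r ^ (n + 1) * ((‖x - x₀‖ / 2) ^ (n + 1))⁻¹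
        ≤ c * M * ubv n * r ^ (n + 1) * ((2 ^ j * r) ^ (n + 1))⁻¹ := by gcongr
      _ = c * (M * ubv n) * ((1 / 2) ^ (j * (n + 1))) := by
          rw [mul_pow, mul_inv, one_div, inv_pow, pow_mul]
          field_simp
      _ ≤ _ := by
          gcongr
          linarith

/-- An atom has controlled `H¹` norm. -/
theorem IsHAtom.H1Norm_le {n : ℕ} {φ : Eucl n → ℝ} {M : ℝ} (hφ : IsKer n φ M)
    {x₀ : Eucl n} {r c : ℝ} (hr : 0 < r) {u : Eucl n → ℝ} (h : IsHAtom n x₀ r c u) :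
    H1Norm n φ u ≤
      ENNReal.ofReal (2 * 4 ^ n * ubv n * ((∫ y, |φ y|) + M * ubv n) * (c * r ^ n)) := by
  have hM := hφ.nonneg
  have hu := (ubv_pos n).le
  have hc := h.nonneg
  have hI := hφ.one_le_integral_abs
  unfold H1Norm
  refine (lintegral_mono (h.maxFun_le hφ hr)).trans ?_
  rw [lintegral_tsum fun j => (measurable_const.indicator measurableSet_ball).aemeasurable]
  have e : ∀ j : ℕ, ∫⁻ x, (ball x₀ (2 ^ (j + 2) * r)).indicator
      (fun _ => ENNReal.ofReal (c * ((∫ y, |φ y|) + M * ubv n) * ((1 / 2) ^ (j * (n + 1))))) x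
      = ENNReal.ofReal (4 ^ n * ubv n * ((∫ y, |φ y|) + M * ubv n) * (c * r ^ n) * (1 / 2) ^ j) := by
    intro j
    rw [lintegral_indicator measurableSet_ball, setLIntegral_const, volume_ball_eq _ (by positivity),
      ← ENNReal.ofReal_mul (by positivity)]
    congr 1
    have : (2:ℝ) ^ (j + 2) = 2 ^ j * 4 := by rw [pow_add]; norm_num
    have h2 : ((1:ℝ) / 2) ^ (j * (n + 1)) * (2 ^ j) ^ n = (1 / 2) ^ j := by
      rw [mul_add, pow_add, mul_one, pow_mul, mul_right_comm, ← mul_pow, ← mul_pow]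
      norm_num
    rw [this, mul_pow, mul_pow, ← h2]
    ring
  simp_rw [e]
  rw [← ENNReal.ofReal_tsum_of_nonneg (fun j => by positivity)
    (summable_geometric_two.mul_left _), tsum_mul_left, tsum_geometric_two]
  refine ENNReal.ofReal_le_ofReal (le_of_eq ?_)
  ring

end

section

/-- On every ball `v` is within mean distance `M` of some constant. -/
def OscLE (n : ℕ) (v : Eucl n → ℝ) (M : ℝ) : Prop :=
  ∀ (x₀ : Eucl n) (r : ℝ), 0 < r →
    ∃ c : ℝ, ∫⁻ x in ball x₀ r, ENNReal.ofReal |v x - c| ≤ ENNReal.ofReal M * volume (ball x₀ r)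

theorem OscLE.add {n : ℕ} {v w : Eucl n → ℝ} {M N : ℝ} (hv : OscLE n v M) (hw : OscLE n w N)
    (hvm : Measurable v) (hM : 0 ≤ M) (hN : 0 ≤ N) :
    OscLE n (fun x => v x + w x) (M + N) := by
  intro x₀ r hr
  obtain ⟨c, hc⟩ := hv x₀ r hr
  obtain ⟨d, hd⟩ := hw x₀ r hr
  refine ⟨c + d, ?_⟩
  calc ∫⁻ x in ball x₀ r, ENNReal.ofReal |v x + w x - (c + d)|
      ≤ ∫⁻ x in ball x₀ r, (ENNReal.ofReal |v x - c| + ENNReal.ofReal |w x - d|) := by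
        refine lintegral_mono fun x => ?_
        rw [← ENNReal.ofReal_add (abs_nonneg _) (abs_nonneg _)]
        refine ENNReal.ofReal_le_ofReal ?_
        rw [add_sub_add_comm]
        exact abs_add_le _ _
    _ = _ := lintegral_add_left (by fun_prop) _
    _ ≤ _ := by
        rw [ENNReal.ofReal_add hM hN, add_mul]
        exact add_le_add hc hd

theorem oscLE_const {n : ℕ} (a : ℝ) : OscLE n (fun _ => a) 0 := by
  intro x₀ r _
  exact ⟨a, by simp⟩

theorem OscLE.BMOplus_le {n : ℕ} {v : Eucl n → ℝ} {M : ℝ} (h : OscLE n v M) (hM : 0 ≤ M)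
    (hv : LocallyIntegrable v volume) :
    BMOplus n v ≤ (∫⁻ x in unitCube n, ENNReal.ofReal |v x|) + ENNReal.ofReal (2 * M) := by
  unfold BMOplus
  gcongr
  refine iSup_le fun x₀ => iSup_le fun r => iSup_le fun hr => ?_
  obtain ⟨c, hc⟩ := h x₀ r hr
  have hpos : 0 < volume.real (ball x₀ r) := by
    rw [volume_real_ball x₀ hr]; have := ubv_pos n; positivity
  have hfin : volume (ball x₀ r) ≠ ⊤ := measure_ball_lt_top.ne
  refine ENNReal.div_le_of_le_mul ?_
  have hvi : IntegrableOn v (ball x₀ r) volume :=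
    (hv.integrableOn_isCompact (isCompact_closedBall x₀ r)).mono_set ball_subset_closedBall
  have hci : IntegrableOn (fun _ : Eucl n => c) (ball x₀ r) volume := integrableOn_const hfin
  have e : c - setAvg n v (ball x₀ r) = - ((∫ x in ball x₀ r, (v x - c)) / volume.real (ball x₀ r)) := by
    rw [integral_sub hvi hci, setIntegral_const]
    unfold setAvg
    change c - _ / volume.real (ball x₀ r) = _
    field_simp
    simp only [smul_eq_mul]
    ring
  have h2 : ENNReal.ofReal |c - setAvg n v (ball x₀ r)| * volume (ball x₀ r)
      ≤ ENNReal.ofReal M * volume (ball x₀ r) := by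
    refine le_trans ?_ hc
    rw [e, abs_neg, abs_div, abs_of_pos hpos, ← ofReal_measureReal hfin,
      ← ENNReal.ofReal_mul (by positivity), div_mul_cancel₀ _ hpos.ne', ← Real.enorm_eq_ofReal_abs]
    refine (enorm_integral_le_lintegral_enorm _).trans (le_of_eq ?_)
    simp_rw [Real.enorm_eq_ofReal_abs]
  calc ∫⁻ x in ball x₀ r, ENNReal.ofReal |v x - setAvg n v (ball x₀ r)|
      ≤ ∫⁻ x in ball x₀ r,
        (ENNReal.ofReal |v x - c| + ENNReal.ofReal |c - setAvg n v (ball x₀ r)|) := by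
        refine lintegral_mono fun x => ?_
        rw [← ENNReal.ofReal_add (abs_nonneg _) (abs_nonneg _)]
        exact ENNReal.ofReal_le_ofReal (abs_sub_le _ _ _)
    _ = (∫⁻ x in ball x₀ r, ENNReal.ofReal |v x - c|)
        + ENNReal.ofReal |c - setAvg n v (ball x₀ r)| * volume (ball x₀ r) := by
        rw [lintegral_add_right _ measurable_const, setLIntegral_const]
    _ ≤ ENNReal.ofReal M * volume (ball x₀ r) + ENNReal.ofReal M * volume (ball x₀ r) :=
        add_le_add hc h2
    _ = ENNReal.ofReal (2 * M) * volume (ball x₀ r) := by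
        rw [two_mul, ENNReal.ofReal_add hM hM, add_mul]

/-- A dyadic majorant of `log (d / ‖x - a‖)`. -/
def logMaj (n : ℕ) (d : ℝ) (a x : Eucl n) : ℝ≥0∞ :=
  ∑' k : ℕ, (ball a (2 * d * (1 / 2) ^ k)).indicator (fun _ => (1 : ℝ≥0∞)) x

theorem logMaj_self {n : ℕ} {d : ℝ} (hd : 0 < d) (a : Eucl n) : logMaj n d a a = ⊤ := by
  unfold logMaj
  rw [← ENNReal.tsum_const_eq_top_of_ne_zero (α := ℕ) one_ne_zero]
  congr 1
  ext k
  rw [Set.indicator_of_mem (mem_ball_self (by positivity))]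

theorem log_le_logMaj {n : ℕ} {d : ℝ} (hd : 0 < d) {a x : Eucl n} (hx : x ≠ a) :
    ENNReal.ofReal (log (d / ‖x - a‖)) ≤ logMaj n d a x := by
  have hpos : 0 < ‖x - a‖ := norm_pos_iff.2 (sub_ne_zero.2 hx)
  by_cases h1 : d / ‖x - a‖ < 1
  · rw [ENNReal.ofReal_of_nonpos (log_nonpos (by positivity) h1.le)]
    exact zero_le
  · obtain ⟨K, hK1, hK2⟩ := exists_nat_pow_near (not_lt.1 h1) one_lt_two
    rw [le_div_iff₀ hpos] at hK1
    refine le_trans ?_ (ENNReal.sum_le_tsum (Finset.range (K + 1)))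
    have : ∀ k ∈ Finset.range (K + 1), (ball a (2 * d * (1 / 2) ^ k)).indicator
        (fun _ => (1 : ℝ≥0∞)) x = 1 := by
      intro k hk
      rw [Set.indicator_of_mem]
      rw [mem_ball, dist_eq_norm, one_div, inv_pow, ← div_eq_mul_inv, lt_div_iff₀ (by positivity)]
      have : (2:ℝ) ^ k ≤ 2 ^ K :=
        pow_le_pow_right₀ one_le_two (Nat.lt_succ_iff.1 (Finset.mem_range.1 hk))
      nlinarith
    rw [Finset.sum_congr rfl this, Finset.sum_const, Finset.card_range, nsmul_eq_mul, mul_one,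
      ← ENNReal.ofReal_natCast]
    refine ENNReal.ofReal_le_ofReal ?_
    have h3 := log_le_log (by positivity) hK2.le
    rw [log_pow] at h3
    have h4 : log 2 ≤ 1 := by linarith [log_two_lt_d9]
    have h5 : (0:ℝ) ≤ ((K + 1 : ℕ) : ℝ) := by positivity
    nlinarith

theorem measurable_logMaj (n : ℕ) (d : ℝ) (a : Eucl n) : Measurable (logMaj n d a) := by
  unfold logMaj
  exact Measurable.tsum fun k => measurable_const.indicator measurableSet_ball

theorem lintegral_logMaj_le {n : ℕ} (hn : 1 ≤ n) {d : ℝ} (hd : 0 < d) (a : Eucl n) :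
    ∫⁻ x, logMaj n d a x ≤ ENNReal.ofReal (2 * (2 * d) ^ n * ubv n) := by
  have hu := (ubv_pos n).le
  unfold logMaj
  rw [lintegral_tsum fun k => (measurable_const.indicator measurableSet_ball).aemeasurable]
  have e : ∀ k : ℕ, ∫⁻ x, (ball a (2 * d * (1 / 2) ^ k)).indicator (fun _ => (1 : ℝ≥0∞)) x
      ≤ ENNReal.ofReal ((2 * d) ^ n * ubv n * (1 / 2) ^ k) := by
    intro k
    rw [lintegral_indicator measurableSet_ball, setLIntegral_const, one_mul,
      volume_ball_eq _ (by positivity)]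
    refine ENNReal.ofReal_le_ofReal ?_
    rw [mul_pow, ← pow_mul]
    have : ((1:ℝ) / 2) ^ (k * n) ≤ (1 / 2) ^ k :=
      pow_le_pow_of_le_one (by norm_num) (by norm_num) (Nat.le_mul_of_pos_right _ hn)
    calc (2 * d) ^ n * (1 / 2) ^ (k * n) * ubv n ≤ (2 * d) ^ n * (1 / 2) ^ k * ubv n := by gcongr
      _ = _ := by ring
  refine (ENNReal.tsum_le_tsum e).trans ?_
  rw [← ENNReal.ofReal_tsum_of_nonneg (fun j => by positivity)
    (summable_geometric_two.mul_left _), tsum_mul_left, tsum_geometric_two]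
  exact ENNReal.ofReal_le_ofReal (le_of_eq (by ring))

theorem oscLE_of_log {n : ℕ} (hn : 1 ≤ n) {v : Eucl n → ℝ} (a : Eucl n)
    (h : ∀ d : ℝ, 0 < d → ∃ c, ∀ x, x ≠ a → |v x - c| ≤ 2 * |log ‖x - a‖ - log d|) :
    OscLE n v (4 * 6 ^ n) := by
  intro x₀ r hr
  by_cases hx : 2 * r ≤ ‖x₀ - a‖
  · obtain ⟨c, hc⟩ := h ‖x₀ - a‖ (by linarith)
    refine ⟨c, ?_⟩
    calc ∫⁻ x in ball x₀ r, ENNReal.ofReal |v x - c|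
        ≤ ∫⁻ x in ball x₀ r, ENNReal.ofReal (4 * 6 ^ n) := by
          refine setLIntegral_mono measurable_const fun x hx' => ENNReal.ofReal_le_ofReal ?_
          rw [mem_ball, dist_eq_norm] at hx'
          have h1 : ‖x₀ - a‖ ≤ ‖x - x₀‖ + ‖x - a‖ := by
            rw [norm_sub_rev x x₀]; exact norm_sub_le_norm_sub_add_norm_sub _ _ _
          have h2 : ‖x - a‖ ≤ ‖x - x₀‖ + ‖x₀ - a‖ := norm_sub_le_norm_sub_add_norm_sub _ _ _
          have hxa : x ≠ a := by
            rintro rfl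
            simp at h1
            linarith
          refine (hc x hxa).trans ?_
          have h6 : (1:ℝ) ≤ 6 ^ n := one_le_pow₀ (by norm_num)
          have hl2 : log 2 ≤ 1 := by linarith [log_two_lt_d9]
          have : |log ‖x - a‖ - log ‖x₀ - a‖| ≤ log 2 := by
            rw [abs_le]
            constructor
            · have := log_le_log (x := ‖x₀ - a‖) (y := 2 * ‖x - a‖) (by linarith) (by linarith)
              rw [log_mul (by norm_num) (by linarith)] at this
              linarith
            · have := log_le_log (x := ‖x - a‖) (y := 2 * ‖x₀ - a‖) (by linarith) (by linarith)
              rw [log_mul (by norm_num) (by linarith)] at this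
              linarith
          linarith
      _ = _ := setLIntegral_const _ _
  · push Not at hx
    obtain ⟨c, hc⟩ := h (3 * r) (by linarith)
    refine ⟨c, ?_⟩
    calc ∫⁻ x in ball x₀ r, ENNReal.ofReal |v x - c|
        ≤ ∫⁻ x in ball x₀ r, 2 * logMaj n (3 * r) a x := by
          refine setLIntegral_mono ((measurable_logMaj _ _ _).const_mul _) fun x hx' => ?_
          by_cases hxa : x = a
          · rw [hxa, logMaj_self (by linarith)]
            simp
          · rw [mem_ball, dist_eq_norm] at hx'
            have h2 : ‖x - a‖ ≤ ‖x - x₀‖ + ‖x₀ - a‖ := norm_sub_le_norm_sub_add_norm_sub _ _ _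
            have hpos : 0 < ‖x - a‖ := norm_pos_iff.2 (sub_ne_zero.2 hxa)
            calc ENNReal.ofReal |v x - c|
                ≤ ENNReal.ofReal (2 * log (3 * r / ‖x - a‖)) := by
                  refine ENNReal.ofReal_le_ofReal ((hc x hxa).trans (le_of_eq ?_))
                  rw [abs_sub_comm, log_div (by linarith) hpos.ne', abs_of_nonneg]
                  have := log_le_log hpos (by linarith : ‖x - a‖ ≤ 3 * r)
                  linarith
              _ ≤ 2 * logMaj n (3 * r) a x := by
                  rw [ENNReal.ofReal_mul (by norm_num)]
                  simp only [ENNReal.ofReal_ofNat]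
                  gcongr
                  exact log_le_logMaj (by linarith) hxa
      _ ≤ ∫⁻ x, 2 * logMaj n (3 * r) a x := setLIntegral_le_lintegral _ _
      _ = 2 * ∫⁻ x, logMaj n (3 * r) a x := lintegral_const_mul _ (measurable_logMaj _ _ _)
      _ ≤ 2 * ENNReal.ofReal (2 * (2 * (3 * r)) ^ n * ubv n) := by
          gcongr
          exact lintegral_logMaj_le hn (by linarith) a
      _ = _ := by
          have hu := (ubv_pos n).le
          rw [volume_ball_eq _ hr, ← ENNReal.ofReal_mul (by positivity), ← ENNReal.ofReal_ofNat,
            ← ENNReal.ofReal_mul (by norm_num)]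
          congr 1
          rw [show 2 * (3 * r) = 6 * r by ring, mul_pow]
          ring

/-- The truncated logarithm of the modulus. -/
def logIn (n : ℕ) (β : ℝ) (x : Eucl n) : ℝ := max 0 (min (2 * log ‖x‖) β)

/-- The truncated logarithmic peak at `a`. -/
def logPeak (n : ℕ) (a : Eucl n) (r : ℝ) (x : Eucl n) : ℝ := max 0 (-log (max ‖x - a‖ r))

/-- The `BMO` function used to factor atoms. -/
def logFun (n : ℕ) (β : ℝ) (a : Eucl n) (r : ℝ) (x : Eucl n) : ℝ :=
  logIn n β x + (logPeak n a r x + 1)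

theorem measurable_logIn (n : ℕ) (β : ℝ) : Measurable (logIn n β) := by
  unfold logIn
  exact measurable_const.max
    (((Real.measurable_log.comp measurable_norm).const_mul 2).min measurable_const)

theorem measurable_logPeak (n : ℕ) (a : Eucl n) (r : ℝ) : Measurable (logPeak n a r) := by
  unfold logPeak
  exact measurable_const.max (Real.measurable_log.comp
    ((measurable_id.sub_const a).norm.max measurable_const)).neg

theorem measurable_logFun (n : ℕ) (β : ℝ) (a : Eucl n) (r : ℝ) : Measurable (logFun n β a r) :=
  (measurable_logIn n β).add ((measurable_logPeak n a r).add_const 1)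

theorem oscLE_logFun {n : ℕ} (hn : 1 ≤ n) (β : ℝ) (a : Eucl n) {r : ℝ} (hr : 0 < r) :
    OscLE n (logFun n β a r) (4 * 6 ^ n + (4 * 6 ^ n + 0)) := by
  have h1 : OscLE n (logIn n β) (4 * 6 ^ n) := by
    refine oscLE_of_log hn 0 fun d _ => ⟨max 0 (min (2 * log d) β), fun x _ => ?_⟩
    unfold logIn
    refine (abs_max_sub_max_le_max _ _ _ _).trans ?_
    rw [sub_self, abs_zero, max_eq_right (abs_nonneg _), sub_zero]
    refine (abs_min_sub_min_le_max _ _ _ _).trans ?_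
    rw [sub_self, abs_zero, max_eq_left (abs_nonneg _), ← mul_sub, abs_mul, abs_two]
  have h2 : OscLE n (logPeak n a r) (4 * 6 ^ n) := by
    refine oscLE_of_log hn a fun d hd => ⟨max 0 (-log (max d r)), fun x hx => ?_⟩
    have hpos : 0 < ‖x - a‖ := norm_pos_iff.2 (sub_ne_zero.2 hx)
    have hlm : ∀ s : ℝ, 0 < s → log (max s r) = max (log s) (log r) := by
      intro s hs
      rcases le_total s r with h | h
      · rw [max_eq_right h, max_eq_right (log_le_log hs h)]
      · rw [max_eq_left h, max_eq_left (log_le_log hr h)]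
    unfold logPeak
    refine (abs_max_sub_max_le_max _ _ _ _).trans ?_
    rw [sub_self, abs_zero, max_eq_right (abs_nonneg _), neg_sub_neg, abs_sub_comm, hlm _ hpos,
      hlm _ hd]
    refine (abs_max_sub_max_le_max _ _ _ _).trans ?_
    rw [sub_self, abs_zero, max_eq_left (abs_nonneg _)]
    linarith [abs_nonneg (log ‖x - a‖ - log d)]
  exact h1.add (h2.add (oscLE_const 1) (measurable_logPeak n a r) (by positivity) le_rfl)
    (measurable_logIn n β) (by positivity) (by positivity)

theorem logPeak_le {n : ℕ} (a : Eucl n) {r : ℝ} (hr : 0 < r) (x : Eucl n) :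
    logPeak n a r x ≤ max 0 (-log r) := by
  unfold logPeak
  gcongr
  exact le_max_right _ _

theorem logIn_le {n : ℕ} {β : ℝ} (hβ : 0 ≤ β) (x : Eucl n) : logIn n β x ≤ β :=
  max_le hβ (min_le_right _ _)

theorem one_le_logFun {n : ℕ} (β : ℝ) (a : Eucl n) (r : ℝ) (x : Eucl n) :
    1 ≤ logFun n β a r x := by
  unfold logFun
  have h1 : 0 ≤ logIn n β x := le_max_left _ _
  have h2 : 0 ≤ logPeak n a r x := le_max_left _ _
  linarith

theorem locallyIntegrable_logFun {n : ℕ} {β : ℝ} (hβ : 0 ≤ β) (a : Eucl n) {r : ℝ} (hr : 0 < r) :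
    LocallyIntegrable (logFun n β a r) volume := by
  refine (locallyIntegrable_const (β + (max 0 (-log r) + 1))).mono
    (measurable_logFun n β a r).aestronglyMeasurable (Eventually.of_forall fun x => ?_)
  rw [Real.norm_eq_abs, Real.norm_eq_abs, abs_of_nonneg (zero_le_one.trans (one_le_logFun β a r x))]
  refine le_trans ?_ (le_abs_self _)
  unfold logFun
  gcongr
  · exact logIn_le hβ x
  · exact logPeak_le a hr x

theorem norm_le_of_mem_unitCube {n : ℕ} {x : Eucl n} (hx : x ∈ unitCube n) : ‖x‖ < n + 1 := by
  rw [EuclideanSpace.norm_eq]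
  rw [Real.sqrt_lt' (by positivity)]
  have : ∑ i, ‖x i‖ ^ 2 ≤ ∑ _i : Fin n, (1:ℝ) := by
    refine Finset.sum_le_sum fun i _ => ?_
    have := hx i
    rw [Real.norm_eq_abs, sq_abs]
    nlinarith [this.1, this.2]
  have h2 : ∑ i, ‖x i‖ ^ 2 ≤ (n : ℝ) := this.trans (by simp)
  nlinarith [(Nat.cast_nonneg n : (0:ℝ) ≤ n)]

theorem exists_BMOplus_logFun_le {n : ℕ} (hn : 1 ≤ n) :
    ∃ C : ℝ, 0 < C ∧ ∀ (β : ℝ) (a : Eucl n) (r : ℝ), 0 ≤ β → 0 < r →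
      BMOplus n (logFun n β a r) ≤ ENNReal.ofReal C := by
  have hu := ubv_pos n
  have hlog : 0 ≤ log (n + 1 : ℝ) := log_nonneg (by linarith [(Nat.cast_nonneg n : (0:ℝ) ≤ n)])
  set A : ℝ := (1 + 2 * log (n + 1)) * ((n + 1) ^ n * ubv n) with hA
  set B : ℝ := 2 * (2 * 1) ^ n * ubv n with hB
  have hB0 : 0 < B := by positivity
  have hA0 : 0 ≤ A := by positivity
  refine ⟨A + B + 2 * (4 * 6 ^ n + (4 * 6 ^ n + 0)), by positivity, fun β a r hβ hr => ?_⟩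
  refine ((oscLE_logFun hn β a hr).BMOplus_le (by positivity)
    (locallyIntegrable_logFun hβ a hr)).trans ?_
  rw [ENNReal.ofReal_add (by positivity) (by positivity)]
  gcongr
  rw [ENNReal.ofReal_add hA0 hB0.le]
  have hsub : unitCube n ⊆ ball (0 : Eucl n) (n + 1) := fun x hx => by
    rw [mem_ball_zero_iff]; exact norm_le_of_mem_unitCube hx
  calc ∫⁻ x in unitCube n, ENNReal.ofReal |logFun n β a r x|
      ≤ ∫⁻ x in ball (0 : Eucl n) (n + 1), ENNReal.ofReal |logFun n β a r x| :=
        lintegral_mono_set hsub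
    _ ≤ ∫⁻ x in ball (0 : Eucl n) (n + 1),
        (ENNReal.ofReal (1 + 2 * log (n + 1)) + logMaj n 1 a x) := by
        refine setLIntegral_mono (measurable_const.add (measurable_logMaj _ _ _)) fun x hx => ?_
        rw [mem_ball_zero_iff] at hx
        by_cases hxa : x = a
        · rw [hxa, logMaj_self one_pos]
          simp
        have hpos : 0 < ‖x - a‖ := norm_pos_iff.2 (sub_ne_zero.2 hxa)
        have h1 : logIn n β x ≤ 2 * log (n + 1) := by
          unfold logIn
          refine max_le (by positivity) ((min_le_left _ _).trans ?_)
          rcases eq_or_ne x 0 with rfl | h0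
          · simpa using hlog
          · have := log_le_log (norm_pos_iff.2 h0) hx.le
            linarith
        have h2 : ENNReal.ofReal (logPeak n a r x) ≤ logMaj n 1 a x := by
          refine le_trans ?_ (log_le_logMaj one_pos hxa)
          unfold logPeak
          rw [ENNReal.ofReal_max, ENNReal.ofReal_zero, max_eq_right zero_le]
          refine ENNReal.ofReal_le_ofReal ?_
          rw [one_div, log_inv]
          exact neg_le_neg (log_le_log hpos (le_max_left _ _))
        rw [abs_of_nonneg (zero_le_one.trans (one_le_logFun β a r x))]
        calc ENNReal.ofReal (logFun n β a r x)
            ≤ ENNReal.ofReal ((1 + 2 * log (n + 1)) + logPeak n a r x) := by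
              refine ENNReal.ofReal_le_ofReal ?_
              unfold logFun
              linarith
          _ ≤ _ := ENNReal.ofReal_add_le.trans (by gcongr)
    _ = ENNReal.ofReal (1 + 2 * log (n + 1)) * volume (ball (0 : Eucl n) (n + 1))
        + ∫⁻ x in ball (0 : Eucl n) (n + 1), logMaj n 1 a x := by
        rw [lintegral_add_left measurable_const, setLIntegral_const]
    _ ≤ _ := by
        rw [volume_ball_eq _ (by positivity), ← ENNReal.ofReal_mul (by positivity)]
        gcongr
        exact (setLIntegral_le_lintegral _ _).trans (lintegral_logMaj_le hn one_pos a)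

end

section

/-- Quantitative test functions. -/
structure IsTest (n : ℕ) (R : ℝ) (ψ : Eucl n → ℝ) : Prop where
  pos : 0 < R
  bound : ∀ x, |ψ x| ≤ R
  lip : ∀ x y, |ψ x - ψ y| ≤ R * ‖x - y‖
  supp : ∀ x, R ≤ ‖x‖ → ψ x = 0

theorem exists_isTest {n : ℕ} {ψ : Eucl n → ℝ} (hs : ContDiff ℝ (⊤ : ℕ∞) ψ)
    (hc : HasCompactSupport ψ) : ∃ R, IsTest n R ψ := by
  have h1 : ContDiff ℝ 1 ψ := hs.of_le (by exact_mod_cast le_top)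
  obtain ⟨C, hC⟩ := h1.lipschitzWith_of_hasCompactSupport hc one_ne_zero
  obtain ⟨B, hB⟩ := hc.exists_bound_of_continuous hs.continuous
  obtain ⟨S, hS⟩ := hc.isCompact.isBounded.subset_ball (0 : Eucl n)
  have hB0 : 0 ≤ B := (norm_nonneg _).trans (hB 0)
  have hC0 : (0 : ℝ) ≤ C := C.2
  have hle : |S| ≥ S := le_abs_self S
  refine ⟨1 + |S| + B + C, by positivity, fun x => ?_, fun x y => ?_, fun x hx => ?_⟩
  · have := hB x
    rw [Real.norm_eq_abs] at this
    linarith [abs_nonneg S]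
  · have := hC.dist_le_mul x y
    rw [dist_eq_norm, dist_eq_norm, Real.norm_eq_abs] at this
    refine this.trans ?_
    gcongr
    linarith [abs_nonneg S]
  · by_contra hne
    have := hS (subset_tsupport _ hne)
    rw [mem_ball_zero_iff] at this
    linarith

theorem IsTest.continuous {n : ℕ} {R : ℝ} {ψ : Eucl n → ℝ} (h : IsTest n R ψ) : Continuous ψ := by
  have : LipschitzWith ⟨R, h.pos.le⟩ ψ := LipschitzWith.of_dist_le_mul fun x y => by
    rw [dist_eq_norm, dist_eq_norm]
    exact h.lip x y
  exact this.continuous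

/-- The logarithmic weight of a ball. -/
def lamBall (n : ℕ) (x₀ : Eucl n) (r : ℝ) : ℝ := 1 + log (1 + ‖x₀‖ + r) + max 0 (-log r)

theorem one_le_lamBall {n : ℕ} (x₀ : Eucl n) {r : ℝ} (hr : 0 < r) : 1 ≤ lamBall n x₀ r := by
  unfold lamBall
  have : 0 ≤ log (1 + ‖x₀‖ + r) := log_nonneg (by linarith [norm_nonneg x₀])
  linarith [le_max_left 0 (-log r)]

/-- Constant in the pairing of atoms with test functions. -/
def testConst (n : ℕ) (R : ℝ) : ℝ := ubv n * R * (R + 5) * (1 + R ^ n)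

theorem IsHAtom.abs_integral_mul_le {n : ℕ} (hn : 1 ≤ n) {x₀ : Eucl n} {r c : ℝ} (hr : 0 < r)
    {a : Eucl n → ℝ} (h : IsHAtom n x₀ r c a) {R : ℝ} {ψ : Eucl n → ℝ} (hψ : IsTest n R ψ) :
    |∫ x, a x * ψ x| ≤ testConst n R * (c * r ^ n / lamBall n x₀ r) := by
  have hu := ubv_pos n
  have hc := h.nonneg
  have hR := hψ.pos
  have hL := one_le_lamBall x₀ hr
  have hL0 : 0 < lamBall n x₀ r := by linarith
  by_cases hx : ∀ x, ‖x - x₀‖ < r → R ≤ ‖x‖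
  · have : ∀ x, a x * ψ x = 0 := by
      intro x
      by_cases h1 : ‖x - x₀‖ < r
      · rw [hψ.supp x (hx x h1), mul_zero]
      · rw [h.supp x (not_lt.1 h1), zero_mul]
    simp only [this, integral_zero, abs_zero]
    unfold testConst
    positivity
  push Not at hx
  obtain ⟨y, hy1, hy2⟩ := hx
  have hx0 : ‖x₀‖ < R + r := by
    have := norm_sub_norm_le x₀ y
    rw [norm_sub_rev] at this
    linarith
  have hlog : log (1 + ‖x₀‖ + r) ≤ ‖x₀‖ + r := by
    have := log_le_sub_one_of_pos (show 0 < 1 + ‖x₀‖ + r by positivity)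
    linarith
  rw [← mul_div_assoc, le_div_iff₀ hL0]
  rcases le_total r 1 with hr1 | hr1
  · have e : ∫ x, a x * ψ x = ∫ x, a x * (ψ x - ψ x₀) := by
      have hi : Integrable (fun x => a x * ψ x) volume := by
        refine integrable_bdd_supp (c := c * R) (r := r) (x₀ := x₀)
          (h.meas.mul hψ.continuous.measurable) (fun x => ?_) (fun x hx => ?_)
        · rw [abs_mul]; exact mul_le_mul (h.bound x) (hψ.bound x) (abs_nonneg _) hc
        · rw [h.supp x hx, zero_mul]
      simp_rw [mul_sub]
      rw [integral_sub hi (h.integrable.mul_const _), integral_mul_const, h.mean, zero_mul, sub_zero]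
    have b : |∫ x, a x * ψ x| ≤ (c * (R * r)) * (r ^ n * ubv n) := by
      rw [e]
      refine abs_integral_le_of_supp (x₀ := x₀) hr (fun x => ?_) (fun x hx => ?_)
      · rw [abs_mul]
        by_cases h1 : ‖x - x₀‖ < r
        · refine mul_le_mul (h.bound x) ((hψ.lip x x₀).trans ?_) (abs_nonneg _) hc
          gcongr
        · rw [h.supp x (not_lt.1 h1), abs_zero, zero_mul]
          positivity
      · rw [h.supp x hx, zero_mul]
    have hrl : r * lamBall n x₀ r ≤ R + 5 := by
      have h1 : r * max 0 (-log r) ≤ 1 := by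
        rw [mul_max_of_nonneg _ _ hr.le]
        refine max_le (by simp) ?_
        have := one_sub_inv_le_log_of_pos hr
        have h2 : r * (1 - r⁻¹) ≤ r * log r := by gcongr
        rw [mul_sub, mul_inv_cancel₀ hr.ne'] at h2
        nlinarith
      have h2 : r * (1 + log (1 + ‖x₀‖ + r)) ≤ 1 * (R + 3) := by
        refine mul_le_mul hr1 (by linarith) ?_ zero_le_one
        have : 0 ≤ log (1 + ‖x₀‖ + r) := log_nonneg (by linarith [norm_nonneg x₀])
        linarith
      unfold lamBall
      nlinarith
    calc |∫ x, a x * ψ x| * lamBall n x₀ r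
        ≤ (c * (R * r)) * (r ^ n * ubv n) * lamBall n x₀ r := by gcongr
      _ = (c * R * r ^ n * ubv n) * (r * lamBall n x₀ r) := by ring
      _ ≤ (c * R * r ^ n * ubv n) * (R + 5) := by gcongr
      _ = (ubv n * R * (R + 5) * (c * r ^ n)) * 1 := by ring
      _ ≤ (ubv n * R * (R + 5) * (c * r ^ n)) * (1 + R ^ n) := by
          gcongr
          linarith [pow_pos hR n]
      _ = testConst n R * (c * r ^ n) := by unfold testConst; ring
  · have b : |∫ x, a x * ψ x| ≤ (c * R) * (R ^ n * ubv n) := by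
      refine abs_integral_le_of_supp (x₀ := 0) hR (fun x => ?_) (fun x hx => ?_)
      · rw [abs_mul]; exact mul_le_mul (h.bound x) (hψ.bound x) (abs_nonneg _) hc
      · rw [sub_zero] at hx
        rw [hψ.supp x hx, mul_zero]
    have hrl : lamBall n x₀ r ≤ (R + 5) * r ^ n := by
      have h1 : max 0 (-log r) = 0 := max_eq_left (by linarith [log_nonneg hr1])
      have h2 : r ≤ r ^ n := le_self_pow₀ hr1 (by omega)
      unfold lamBall
      rw [h1]
      have : 1 + R + 2 * r ≤ (R + 5) * r := by nlinarith
      have : (R + 5) * r ≤ (R + 5) * r ^ n := by gcongr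
      linarith
    calc |∫ x, a x * ψ x| * lamBall n x₀ r
        ≤ (c * R) * (R ^ n * ubv n) * ((R + 5) * r ^ n) := by gcongr
      _ = (ubv n * R * (R + 5) * (c * r ^ n)) * R ^ n := by ring
      _ ≤ (ubv n * R * (R + 5) * (c * r ^ n)) * (1 + R ^ n) := by
          gcongr
          linarith
      _ = testConst n R * (c * r ^ n) := by unfold testConst; ring

/-- A function which is a product of an `H¹` and a `BMO` function with controlled cost `κ`. -/
structure IsBlock (n : ℕ) (φ : Eucl n → ℝ) (κ : ℝ) (F : Eucl n → ℝ) : Prop where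
  fac : ∃ u v : Eucl n → ℝ, LocallyIntegrable u volume ∧ LocallyIntegrable v volume ∧
    H1Norm n φ u < ⊤ ∧ BMOplus n v < ⊤ ∧ (∀ x, u x * v x = F x) ∧
    H1Norm n φ u * BMOplus n v ≤ ENNReal.ofReal κ
  int : Integrable F volume
  test : ∀ R ψ, IsTest n R ψ → |∫ x, F x * ψ x| ≤ testConst n R * κ

theorem testConst_nonneg (n : ℕ) {R : ℝ} (hR : 0 < R) : 0 ≤ testConst n R := by
  have := (ubv_pos n).le
  unfold testConst
  positivity

theorem exists_isBlock_of_atom {n : ℕ} (hn : 1 ≤ n) {φ : Eucl n → ℝ} {M : ℝ} (hφ : IsKer n φ M) :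
    ∃ C : ℝ, 1 ≤ C ∧ ∀ (x₀ : Eucl n) (r c : ℝ) (A : Eucl n → ℝ), 0 < r → IsHAtom n x₀ r c A →
      ∀ (β : ℝ) (a : Eucl n) (s L : ℝ), 0 ≤ β → 0 < s → 0 < L →
        (∀ x, A x ≠ 0 → logFun n β a s x = L) →
        ∀ κ, C * (c * r ^ n / L) ≤ κ → c * r ^ n / lamBall n x₀ r ≤ κ → IsBlock n φ κ A := by
  obtain ⟨CB, hCB, hB⟩ := exists_BMOplus_logFun_le hn
  have hu := (ubv_pos n).le
  have hM := hφ.nonneg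
  have hI : 0 ≤ ∫ y, |φ y| := zero_le_one.trans hφ.one_le_integral_abs
  set CH : ℝ := 2 * 4 ^ n * ubv n * ((∫ y, |φ y|) + M * ubv n) with hCH
  have hCH0 : 0 ≤ CH := by positivity
  refine ⟨max 1 (CH * CB), le_max_left _ _, ?_⟩
  intro x₀ r c A hr hA β a s L hβ hs hL hv κ hκ hκ2
  have hc := hA.nonneg
  have hAL : IsHAtom n x₀ r (c / L) (fun x => A x / L) :=
    { meas := hA.meas.div_const L
      bound := fun x => by
        rw [abs_div, abs_of_pos hL]
        exact div_le_div_of_nonneg_right (hA.bound x) hL.le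
      supp := fun x hx => by rw [hA.supp x hx, zero_div]
      mean := by rw [integral_div, hA.mean, zero_div] }
  have h1 := hAL.H1Norm_le hφ hr
  have h2 := hB β a s hβ hs
  refine ⟨⟨fun x => A x / L, logFun n β a s, hAL.integrable.locallyIntegrable,
    locallyIntegrable_logFun hβ a hs, h1.trans_lt ENNReal.ofReal_lt_top,
    h2.trans_lt ENNReal.ofReal_lt_top, fun x => ?_, ?_⟩, hA.integrable, fun R ψ hψ => ?_⟩
  · by_cases hx : A x = 0
    · simp only [hx, zero_div, zero_mul]
    · rw [hv x hx, div_mul_cancel₀ _ hL.ne']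
  · refine (mul_le_mul' h1 h2).trans ?_
    rw [← ENNReal.ofReal_mul (by positivity)]
    refine ENNReal.ofReal_le_ofReal (le_trans ?_ hκ)
    calc CH * (c / L * r ^ n) * CB = (CH * CB) * (c * r ^ n / L) := by ring
      _ ≤ max 1 (CH * CB) * (c * r ^ n / L) := by gcongr; exact le_max_right _ _
  · refine (hA.abs_integral_mul_le hn hr hψ).trans ?_
    have := testConst_nonneg n hψ.pos
    gcongr

theorem isHAtom_zero {n : ℕ} (x₀ : Eucl n) (r : ℝ) {c : ℝ} (hc : 0 ≤ c) :
    IsHAtom n x₀ r c (fun _ => 0) :=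
  ⟨measurable_const, fun _ => by simpa using hc, fun _ _ => rfl, by simp⟩

/-- Normalized indicator of a ball. -/
def ballAvg (n : ℕ) (x₀ : Eucl n) (r : ℝ) : Eucl n → ℝ :=
  (ball x₀ r).indicator fun _ => (r ^ n * ubv n)⁻¹

theorem measurable_ballAvg (n : ℕ) (x₀ : Eucl n) (r : ℝ) : Measurable (ballAvg n x₀ r) :=
  measurable_const.indicator measurableSet_ball

theorem ballAvg_nonneg {n : ℕ} (x₀ : Eucl n) {r : ℝ} (hr : 0 < r) (x : Eucl n) :
    0 ≤ ballAvg n x₀ r x := by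
  have := ubv_pos n
  exact Set.indicator_nonneg (fun _ _ => by positivity) x

theorem ballAvg_le {n : ℕ} (x₀ : Eucl n) {r : ℝ} (hr : 0 < r) (x : Eucl n) :
    ballAvg n x₀ r x ≤ (r ^ n * ubv n)⁻¹ := by
  have := ubv_pos n
  exact Set.indicator_le_self' (fun _ _ => by positivity) x

theorem ballAvg_eq_zero {n : ℕ} {x₀ : Eucl n} {r : ℝ} {x : Eucl n} (hx : r ≤ ‖x - x₀‖) :
    ballAvg n x₀ r x = 0 :=
  Set.indicator_of_notMem (by simpa [dist_eq_norm] using hx) _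

theorem integral_ballAvg {n : ℕ} (x₀ : Eucl n) {r : ℝ} (hr : 0 < r) :
    ∫ x, ballAvg n x₀ r x = 1 := by
  have := ubv_pos n
  unfold ballAvg
  rw [integral_indicator_const _ measurableSet_ball, volume_real_ball _ hr, smul_eq_mul,
    mul_inv_cancel₀ (by positivity)]

theorem integrable_ballAvg {n : ℕ} (x₀ : Eucl n) {r : ℝ} (hr : 0 < r) :
    Integrable (ballAvg n x₀ r) volume :=
  integrable_bdd_supp (x₀ := x₀) (r := r) (measurable_ballAvg n x₀ r)
    (fun x => by rw [abs_of_nonneg (ballAvg_nonneg x₀ hr x)]; exact ballAvg_le x₀ hr x)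
    (fun _ hx => ballAvg_eq_zero hx)

theorem logPeak_of_one_le {n : ℕ} (a x : Eucl n) {s : ℝ} (hs : 1 ≤ s) : logPeak n a s x = 0 := by
  unfold logPeak
  exact max_eq_left (by linarith [log_nonneg (hs.trans (le_max_right ‖x - a‖ s))])

theorem logIn_zero {n : ℕ} (x : Eucl n) : logIn n 0 x = 0 := max_eq_left (min_le_right _ _)

theorem logPeak_of_lt {n : ℕ} {a x : Eucl n} {s : ℝ} (h : ‖x - a‖ < s) :
    logPeak n a s x = max 0 (-log s) := by
  unfold logPeak
  rw [max_eq_right h.le]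

theorem logIn_of_le {n : ℕ} {D : ℝ} (hD : 1 ≤ D) {x : Eucl n} (hx : √D ≤ ‖x‖) :
    logIn n (log D) x = log D := by
  unfold logIn
  have h1 : log D ≤ 2 * log ‖x‖ := by
    have : log (√D) ≤ log ‖x‖ := log_le_log (by positivity) hx
    rw [log_sqrt (by linarith)] at this
    linarith
  rw [min_eq_right h1, max_eq_right (log_nonneg hD)]

theorem IsHAtom.split {n : ℕ} (hn : 2 ≤ n) {x₀ : Eucl n} {r c D : ℝ}
    (hr : 0 < r) {A : Eucl n → ℝ} (hA : IsHAtom n x₀ r c A) (hD : D = 1 + ‖x₀‖ + r) (hD16 : 16 < D)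
    (hex : ∃ x, A x ≠ 0 ∧ ‖x‖ < √D) :
    D ≤ 4 * r ∧ ∃ F₁ F₂ : Eucl n → ℝ, (∀ x, A x = F₁ x + F₂ x) ∧ IsHAtom n x₀ (8 * r) (2 * c) F₁ ∧
      IsHAtom n 0 (4 * √D) (2 * c) F₂ ∧ (∀ x, F₁ x ≠ 0 → √D ≤ ‖x‖) := by
  have hc := hA.nonneg
  set S := √D with hS
  have hSS : S * S = D := Real.mul_self_sqrt (by linarith)
  have hS4 : 4 < S := by
    rw [hS, Real.lt_sqrt (by norm_num)]
    linarith
  have hS0 : 0 < S := by linarith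
  obtain ⟨x, hx, hxS⟩ := hex
  have hxr : ‖x - x₀‖ < r := by
    by_contra h
    exact hx (hA.supp x (not_lt.1 h))
  have hx0 : ‖x₀‖ < r + S := by
    have := norm_sub_norm_le x₀ x
    rw [norm_sub_rev] at this
    linarith
  have hDr : D ≤ 4 * r := by nlinarith
  refine ⟨hDr, ?_⟩
  have hSr : S ≤ r := by nlinarith
  set P : Eucl n := EuclideanSpace.single (⟨0, by omega⟩ : Fin n) (2 * S) with hP
  have hPn : ‖P‖ = 2 * S := by
    rw [hP, PiLp.norm_single, Real.norm_eq_abs, abs_of_pos (by linarith)]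
  set g : Eucl n → ℝ := (ball (0 : Eucl n) S).indicator A with hg
  set b := ballAvg n P S with hb
  have hgm : Measurable g := hA.meas.indicator measurableSet_ball
  have hgb : ∀ x, |g x| ≤ c := fun x => by
    rw [hg]
    by_cases h : x ∈ ball (0 : Eucl n) S
    · rw [Set.indicator_of_mem h]; exact hA.bound x
    · rw [Set.indicator_of_notMem h, abs_zero]; exact hc
  have hg0 : ∀ x, S ≤ ‖x‖ → g x = 0 := fun x hx =>
    Set.indicator_of_notMem (by simpa using hx) _
  have hgA : ∀ x, ‖x‖ < S → g x = A x := fun x hx =>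
    Set.indicator_of_mem (by simpa using hx) _
  have hgi : Integrable g volume := integrable_bdd_supp (x₀ := 0) hgm hgb (fun x hx => hg0 x (by simpa using hx))
  have hI : |∫ x, g x| ≤ c * (S ^ n * ubv n) :=
    abs_integral_le_of_supp (x₀ := 0) hS0 hgb (fun x hx => hg0 x (by simpa using hx))
  have hu := ubv_pos n
  have hIb : ∀ x, |(∫ y, g y) * b x| ≤ c := fun x => by
    rw [abs_mul, abs_of_nonneg (ballAvg_nonneg P hS0 x)]
    calc |∫ y, g y| * b x ≤ (c * (S ^ n * ubv n)) * (S ^ n * ubv n)⁻¹ :=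
          mul_le_mul hI (ballAvg_le P hS0 x) (ballAvg_nonneg P hS0 x) (by positivity)
      _ = c := by field_simp
  have hbm : Measurable fun x => (∫ y, g y) * b x := (measurable_ballAvg n P S).const_mul _
  have hbi : Integrable (fun x => (∫ y, g y) * b x) volume := (integrable_ballAvg P hS0).const_mul _
  have hbI : ∫ x, (∫ y, g y) * b x = ∫ y, g y := by
    rw [integral_const_mul, integral_ballAvg P hS0, mul_one]
  have hbP : ∀ x, S ≤ ‖x - P‖ → (∫ y, g y) * b x = 0 := fun x hx => by
    rw [hb, ballAvg_eq_zero hx, mul_zero]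
  refine ⟨fun x => A x - g x + (∫ y, g y) * b x, fun x => g x - (∫ y, g y) * b x,
    fun x => by ring, ?_, ?_, fun x hx => ?_⟩
  · refine ⟨(hA.meas.sub hgm).add hbm, fun x => ?_, fun x hx => ?_, ?_⟩
    · have h1 : |A x - g x| ≤ c := by
        by_cases h : ‖x‖ < S
        · rw [hgA x h, sub_self, abs_zero]; exact hc
        · rw [hg0 x (not_lt.1 h), sub_zero]; exact hA.bound x
      linarith [abs_add_le (A x - g x) ((∫ y, g y) * b x), hIb x]
    · have h1 : A x = 0 := hA.supp x (by linarith)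
      have h2 : g x = 0 := by
        by_cases h : ‖x‖ < S
        · rw [hgA x h, h1]
        · exact hg0 x (not_lt.1 h)
      rw [h1, h2, hbP x]
      · simp
      · have e : x - x₀ = (x - P) + (P - x₀) := by abel
        have := norm_add_le (x - P) (P - x₀)
        rw [← e] at this
        have := norm_sub_le P x₀
        nlinarith
    · rw [integral_add (f := fun x => A x - g x) (hA.integrable.sub hgi) hbi, integral_sub hA.integrable hgi, hA.mean, hbI]
      ring
  · refine ⟨hgm.sub hbm, fun x => ?_, fun x hx => ?_, ?_⟩
    · linarith [abs_sub (g x) ((∫ y, g y) * b x), hIb x, hgb x]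
    · rw [sub_zero] at hx
      rw [hg0 x (by linarith), hbP x, sub_zero]
      linarith [norm_sub_norm_le x P]
    · rw [integral_sub hgi hbi, hbI, sub_self]
  · by_contra h
    push Not at h
    apply hx
    beta_reduce
    rw [hgA x h, hbP x]
    · simp
    · have := norm_sub_norm_le P x
      rw [norm_sub_rev] at this
      linarith

theorem exists_blocks_of_atom {n : ℕ} (hn : 2 ≤ n) {φ : Eucl n → ℝ} {M : ℝ} (hφ : IsKer n φ M) :
    ∃ C : ℝ, 0 < C ∧ ∀ (x₀ : Eucl n) (r c : ℝ) (A : Eucl n → ℝ), 0 < r → IsHAtom n x₀ r c A →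
      ∃ F : Bool → Eucl n → ℝ, (∀ x, A x = F true x + F false x) ∧
        ∀ b, IsBlock n φ (C * (c * r ^ n / lamBall n x₀ r)) (F b) := by
  obtain ⟨C, hC, hblk⟩ := exists_isBlock_of_atom (by omega : 1 ≤ n) hφ
  refine ⟨C * 10 * 16 ^ n, by positivity, ?_⟩
  intro x₀ r c A hr hA
  have hc := hA.nonneg
  set D := 1 + ‖x₀‖ + r with hD
  have hx0 := norm_nonneg x₀
  have hD1 : 1 ≤ D := by linarith
  have hlogD := log_nonneg hD1
  set Λ := lamBall n x₀ r with hΛ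
  have hΛ1 : 1 ≤ Λ := one_le_lamBall x₀ hr
  have hΛ0 : 0 < Λ := by linarith
  have hΛe : Λ = 1 + log D + max 0 (-log r) := rfl
  have hp0 := le_max_left 0 (-log r)
  have h16 : (1 : ℝ) ≤ 16 ^ n := one_le_pow₀ (by norm_num)
  have hq : 0 ≤ c * r ^ n / Λ := by positivity
  have hk1 : c * r ^ n / Λ ≤ C * 10 * 16 ^ n * (c * r ^ n / Λ) :=
    le_mul_of_one_le_left hq (by nlinarith)
  have triv : ∀ (β : ℝ) (L : ℝ), 0 ≤ β → Λ ≤ 4 * L →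
      (∀ x, A x ≠ 0 → logFun n β x₀ r x = L) → ∃ F : Bool → Eucl n → ℝ,
        (∀ x, A x = F true x + F false x) ∧
          ∀ b, IsBlock n φ (C * 10 * 16 ^ n * (c * r ^ n / Λ)) (F b) := by
    intro β L hβ hL h
    have hL0 : 0 < L := by linarith
    have hk2 : C * (c * r ^ n / L) ≤ C * 10 * 16 ^ n * (c * r ^ n / Λ) := by
      have : c * r ^ n / L ≤ 4 * (c * r ^ n / Λ) := by
        rw [← mul_div_assoc, div_le_div_iff₀ hL0 hΛ0]
        have : 0 ≤ c * r ^ n := by positivity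
        nlinarith
      calc C * (c * r ^ n / L) ≤ C * (4 * (c * r ^ n / Λ)) := by gcongr
        _ = C * 4 * 1 * (c * r ^ n / Λ) := by ring
        _ ≤ _ := by gcongr; norm_num
    refine ⟨fun b => if b then A else fun _ => 0, fun x => by simp, fun b => ?_⟩
    cases b
    · exact hblk x₀ r c _ hr (isHAtom_zero x₀ r hc) β x₀ r L hβ hr hL0 (fun x hx => absurd rfl hx)
        _ hk2 hk1
    · exact hblk x₀ r c _ hr hA β x₀ r L hβ hr hL0 h _ hk2 hk1
  have hlt : ∀ x, A x ≠ 0 → ‖x - x₀‖ < r := fun x hx => by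
    by_contra h
    exact hx (hA.supp x (not_lt.1 h))
  by_cases hi : ∀ x, A x ≠ 0 → √D ≤ ‖x‖
  · refine triv (log D) Λ hlogD (by linarith) fun x hx => ?_
    unfold logFun
    rw [logIn_of_le hD1 (hi x hx), logPeak_of_lt (hlt x hx), hΛe]
    ring
  by_cases h16D : D ≤ 16
  · refine triv 0 (max 0 (-log r) + 1) le_rfl ?_ fun x hx => ?_
    · have : log D ≤ 3 := by
        have h1 := log_le_log (by linarith) h16D
        have h2 : log 16 = 4 * log 2 := by
          rw [show (16 : ℝ) = 2 ^ 4 by norm_num, log_pow]; norm_num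
        linarith [log_two_lt_d9]
      rw [hΛe]
      linarith
    · unfold logFun
      rw [logIn_zero, logPeak_of_lt (hlt x hx), zero_add]
  push Not at hi h16D
  obtain ⟨hDr, F₁, F₂, hA12, hF1, hF2, hF1s⟩ := hA.split hn hr hD h16D hi
  have hr1 : 1 ≤ r := by linarith
  have hp : max 0 (-log r) = 0 := max_eq_left (by linarith [log_nonneg hr1])
  refine ⟨fun b => if b then F₁ else F₂, fun x => by simp [hA12 x], fun b => ?_⟩
  cases b
  · have hS0 : 0 < √D := by positivity
    have key : (4 * √D) ^ n * Λ ≤ 16 ^ n * r ^ n := by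
      have hΛD : Λ ≤ √D ^ n := by
        have h1 : Λ ≤ D := by
          rw [hΛe, hp]
          linarith [log_le_sub_one_of_pos (show 0 < D by linarith)]
        have h2 : D = √D ^ 2 := (Real.sq_sqrt (by linarith)).symm
        have h3 : √D ^ 2 ≤ √D ^ n := pow_le_pow_right₀ (by rw [Real.one_le_sqrt]; exact hD1) hn
        linarith
      calc (4 * √D) ^ n * Λ ≤ (4 * √D) ^ n * √D ^ n := by gcongr
        _ = (4 * D) ^ n := by
            rw [← mul_pow, mul_assoc, Real.mul_self_sqrt (by linarith)]
        _ ≤ (4 * (4 * r)) ^ n := by gcongr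
        _ = 16 ^ n * r ^ n := by rw [← mul_assoc, mul_pow]; norm_num
    have key2 : 2 * c * (4 * √D) ^ n ≤ 2 * 16 ^ n * (c * r ^ n / Λ) := by
      rw [← mul_div_assoc, le_div_iff₀ hΛ0]
      nlinarith
    refine hblk 0 (4 * √D) (2 * c) _ (by positivity) hF2 0 0 1 1 le_rfl one_pos one_pos
      (fun x _ => ?_) _ ?_ ?_
    · unfold logFun
      rw [logIn_zero, logPeak_of_one_le _ _ le_rfl]
      ring
    · rw [div_one]
      calc C * (2 * c * (4 * √D) ^ n) ≤ C * (2 * 16 ^ n * (c * r ^ n / Λ)) := by gcongr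
        _ = C * 2 * 16 ^ n * (c * r ^ n / Λ) := by ring
        _ ≤ _ := by gcongr; norm_num
    · have h1 := one_le_lamBall (0 : Eucl n) (show 0 < 4 * √D by positivity)
      calc 2 * c * (4 * √D) ^ n / lamBall n 0 (4 * √D) ≤ 2 * c * (4 * √D) ^ n :=
            div_le_self (by positivity) h1
        _ ≤ 2 * 16 ^ n * (c * r ^ n / Λ) := key2
        _ = 1 * 2 * 16 ^ n * (c * r ^ n / Λ) := by ring
        _ ≤ _ := by gcongr; norm_num
  · have hL0 : 0 < log D + 1 := by linarith
    have e1 : 2 * c * (8 * r) ^ n ≤ 2 * 16 ^ n * (c * r ^ n) := by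
      rw [mul_pow]
      have : (8 : ℝ) ^ n ≤ 16 ^ n := by gcongr; norm_num
      have h2 : 0 ≤ c * r ^ n := by positivity
      nlinarith
    refine hblk x₀ (8 * r) (2 * c) _ (by positivity) hF1 (log D) 0 1 (log D + 1) hlogD one_pos hL0
      (fun x hx => ?_) _ ?_ ?_
    · unfold logFun
      rw [logIn_of_le hD1 (hF1s x hx), logPeak_of_one_le _ _ le_rfl]
      ring
    · have : Λ = log D + 1 := by rw [hΛe, hp]; ring
      rw [← this]
      calc C * (2 * c * (8 * r) ^ n / Λ) ≤ C * (2 * 16 ^ n * (c * r ^ n) / Λ) := by gcongr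
        _ = C * 2 * 16 ^ n * (c * r ^ n / Λ) := by ring
        _ ≤ _ := by gcongr; norm_num
    · have hle : Λ ≤ lamBall n x₀ (8 * r) := by
        rw [hΛe, hp]
        unfold lamBall
        have : log D ≤ log (1 + ‖x₀‖ + 8 * r) := log_le_log (by linarith) (by linarith)
        linarith [le_max_left 0 (-log (8 * r))]
      calc 2 * c * (8 * r) ^ n / lamBall n x₀ (8 * r) ≤ 2 * 16 ^ n * (c * r ^ n) / Λ := by gcongr
        _ = 1 * 2 * 16 ^ n * (c * r ^ n / Λ) := by ring
        _ ≤ _ := by gcongr; norm_num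

end

section

/-- A bounded Lipschitz function supported in a closed ball. -/
structure IsBump (n : ℕ) (x₀ : Eucl n) (r B L : ℝ) (Θ : Eucl n → ℝ) : Prop where
  bound : ∀ x, |Θ x| ≤ B
  lip : ∀ x y, |Θ x - Θ y| ≤ L * ‖x - y‖
  supp : ∀ x, r < ‖x - x₀‖ → Θ x = 0

variable {n : ℕ} {φ f : Eucl n → ℝ} {M : ℝ}

theorem IsBump.mono {x₀ : Eucl n} {r r' B B' L L' : ℝ} {Θ : Eucl n → ℝ}
    (h : IsBump n x₀ r B L Θ) (hr : r ≤ r') (hB : B ≤ B') (hL : L ≤ L') :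
    IsBump n x₀ r' B' L' Θ where
  bound x := (h.bound x).trans hB
  lip x y := (h.lip x y).trans (by gcongr)
  supp x hx := h.supp x (hr.trans_lt hx)

theorem continuous_of_lip {L : ℝ} {Θ : Eucl n → ℝ}
    (h : ∀ x y, |Θ x - Θ y| ≤ L * ‖x - y‖) : Continuous Θ := by
  have : LipschitzWith ⟨max L 0, le_max_right _ _⟩ Θ := LipschitzWith.of_dist_le_mul fun x y => by
    rw [dist_eq_norm, dist_eq_norm]
    refine (h x y).trans ?_
    gcongr
    exact le_max_left _ _
  exact this.continuous

theorem IsBump.continuous {x₀ : Eucl n} {r B L : ℝ} {Θ : Eucl n → ℝ}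
    (h : IsBump n x₀ r B L Θ) : Continuous Θ := continuous_of_lip h.lip

theorem IsBump.nonneg {x₀ : Eucl n} {r B L : ℝ} {Θ : Eucl n → ℝ}
    (h : IsBump n x₀ r B L Θ) : 0 ≤ B := (abs_nonneg _).trans (h.bound 0)

theorem IsBump.hcs {x₀ : Eucl n} {r B L : ℝ} {Θ : Eucl n → ℝ}
    (h : IsBump n x₀ r B L Θ) : HasCompactSupport Θ :=
  HasCompactSupport.intro (isCompact_closedBall x₀ r) fun x hx =>
    h.supp x (by simpa [dist_eq_norm] using hx)

/-- The convolution `f * φ_t`. -/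
def cv (n : ℕ) (φ f : Eucl n → ℝ) (t : ℝ) (x : Eucl n) : ℝ := ∫ y, f y * dil n φ t (x - y)

/-- The adjoint of `f ↦ f * φ_t`. -/
def cvAdj (n : ℕ) (φ Θ : Eucl n → ℝ) (t : ℝ) (y : Eucl n) : ℝ := ∫ z, dil n φ t z * Θ (y + z)

theorem continuous_cv (hφ : IsKer n φ M) (hf : LocallyIntegrable f volume) {t : ℝ} (ht : 0 < t) :
    Continuous (cv n φ f t) :=
  (hφ.dil_hcs ht).continuous_convolution_right (ContinuousLinearMap.mul ℝ ℝ) hf (hφ.dil_cont t)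

theorem integrable_mul_bump (hf : LocallyIntegrable f volume) {x₀ : Eucl n} {r B L : ℝ}
    {Θ : Eucl n → ℝ} (h : IsBump n x₀ r B L Θ) : Integrable (fun x => f x * Θ x) volume := by
  have := hf.integrable_smul_right_of_hasCompactSupport h.continuous h.hcs
  simpa using this

theorem abs_integral_bump_le (hf : LocallyIntegrable f volume) {x₀ : Eucl n} {r R B L : ℝ}
    {Θ : Eucl n → ℝ} (h : IsBump n x₀ r B L Θ) (hrR : r < R) :
    |∫ x, f x * Θ x| ≤ B * ∫ x in ball x₀ R, |f x| := by
  have hi : IntegrableOn f (ball x₀ R) volume :=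
    (hf.integrableOn_isCompact (isCompact_closedBall x₀ R)).mono_set ball_subset_closedBall
  have e : ∫ x, f x * Θ x = ∫ x in ball x₀ R, f x * Θ x := by
    rw [setIntegral_eq_integral_of_forall_compl_eq_zero]
    intro x hx
    rw [h.supp x, mul_zero]
    have : R ≤ ‖x - x₀‖ := by simpa [dist_eq_norm] using hx
    linarith
  rw [e, ← integral_const_mul]
  refine abs_integral_le_integral_abs.trans (integral_mono_of_nonneg
    (Eventually.of_forall fun x => abs_nonneg _) (hi.abs.const_mul B)
    (Eventually.of_forall fun x => ?_))
  beta_reduce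
  rw [abs_mul, mul_comm]
  exact mul_le_mul_of_nonneg_right (h.bound x) (abs_nonneg _)

theorem integrable_dil_mul (hφ : IsKer n φ M) {t : ℝ} (ht : 0 < t) {L : ℝ} {Θ : Eucl n → ℝ}
    (h : ∀ x y, |Θ x - Θ y| ≤ L * ‖x - y‖) (y : Eucl n) :
    Integrable (fun z => dil n φ t z * Θ (y + z)) volume :=
  ((hφ.dil_cont t).mul ((continuous_of_lip h).comp (continuous_const.add continuous_id))
    ).integrable_of_hasCompactSupport ((hφ.dil_hcs ht).mul_right)

theorem integral_mul_cvAdj (hφ : IsKer n φ M) (hf : LocallyIntegrable f volume) {t : ℝ}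
    (ht : 0 < t) {x₀ : Eucl n} {r B L : ℝ} {Θ : Eucl n → ℝ} (h : IsBump n x₀ r B L Θ) :
    ∫ y, f y * cvAdj n φ Θ t y = ∫ x, cv n φ f t x * Θ x := by
  have e1 : ∀ y, f y * cvAdj n φ Θ t y = ∫ x, f y * (dil n φ t (x - y) * Θ x) := fun y => by
    unfold cvAdj
    rw [integral_const_mul, ← integral_sub_right_eq_self _ y]
    simp
  have e2 : ∀ x, cv n φ f t x * Θ x = ∫ y, f y * (dil n φ t (x - y) * Θ x) := fun x => by
    unfold cv
    rw [← integral_mul_const]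
    simp_rw [mul_assoc]
  simp_rw [e1, e2]
  apply integral_integral_swap
  have hi : Integrable ((closedBall x₀ (r + t)).indicator f) volume :=
    (integrable_indicator_iff measurableSet_closedBall).2
      (hf.integrableOn_isCompact (isCompact_closedBall _ _))
  have hΘi : Integrable Θ volume := h.continuous.integrable_of_hasCompactSupport h.hcs
  have hp := (hi.mul_prod hΘi).norm.const_mul (M * (t ^ n)⁻¹)
  refine hp.mono' ?_ (Eventually.of_forall fun ⟨y, x⟩ => ?_)
  · refine (hf.aestronglyMeasurable.comp_fst).mul ?_
    exact Continuous.aestronglyMeasurable (((hφ.dil_cont t).comp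
      (continuous_snd.sub continuous_fst)).mul (h.continuous.comp continuous_snd))
  · simp only [Function.uncurry_apply_pair, Real.norm_eq_abs, abs_mul]
    by_cases hy : y ∈ closedBall x₀ (r + t)
    · rw [Set.indicator_of_mem hy]
      have := hφ.dil_bound ht (x - y)
      calc |f y| * (|dil n φ t (x - y)| * |Θ x|)
          ≤ |f y| * (M * (t ^ n)⁻¹ * |Θ x|) := by gcongr
        _ = _ := by ring
    · have hy' : r + t < ‖y - x₀‖ := by simpa [dist_eq_norm] using hy
      have : dil n φ t (x - y) * Θ x = 0 := by
        by_cases hx : r < ‖x - x₀‖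
        · rw [h.supp x hx, mul_zero]
        · rw [hφ.dil_eq_zero ht, zero_mul]
          have e : y - x₀ = (x - x₀) - (x - y) := by abel
          have := norm_sub_le (x - x₀) (x - y)
          rw [← e] at this
          linarith
      rw [← abs_mul (dil n φ t (x - y)), this]
      have := hφ.nonneg
      simp only [abs_zero, mul_zero]
      positivity

theorem IsBump.sub_cvAdj (hφ : IsKer n φ M) {t : ℝ} (ht : 0 < t) {x₀ : Eucl n} {r B L : ℝ}
    {Θ : Eucl n → ℝ} (h : IsBump n x₀ r B L Θ) (hL : 0 ≤ L) :
    IsBump n x₀ (r + t) (L * t * ∫ x, |φ x|) (L * (1 + ∫ x, |φ x|))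
      (fun y => Θ y - cvAdj n φ Θ t y) := by
  have key : ∀ (g : Eucl n → ℝ) (b : ℝ), (∀ z, ‖z‖ ≤ t → |g z| ≤ b) → 0 ≤ b →
      |∫ z, dil n φ t z * g z| ≤ b * ∫ x, |φ x| := by
    intro g b hg hb
    rw [← hφ.integral_abs_dil ht, ← integral_const_mul]
    refine abs_integral_le_integral_abs.trans (integral_mono_of_nonneg
      (Eventually.of_forall fun x => abs_nonneg _) ((hφ.dil_integrable ht).abs.const_mul b)
      (Eventually.of_forall fun z => ?_))
    beta_reduce
    rw [abs_mul, mul_comm]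
    by_cases hz : ‖z‖ ≤ t
    · exact mul_le_mul_of_nonneg_right (hg z hz) (abs_nonneg _)
    · rw [hφ.dil_eq_zero ht (not_le.1 hz)]; simp
  have hdi := hφ.dil_integrable ht
  have hI := hφ.integral_dil ht
  refine ⟨fun y => ?_, fun x y => ?_, fun y hy => ?_⟩
  · have e : Θ y - cvAdj n φ Θ t y = ∫ z, dil n φ t z * (Θ y - Θ (y + z)) := by
      unfold cvAdj
      simp_rw [mul_sub]
      rw [integral_sub (hdi.mul_const _) (integrable_dil_mul hφ ht h.lip y), integral_mul_const,
        hI, one_mul]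
    rw [e]
    refine key _ _ (fun z hz => (h.lip _ _).trans ?_) (by positivity)
    rw [sub_add_cancel_left, norm_neg]
    gcongr
  · have e : cvAdj n φ Θ t x - cvAdj n φ Θ t y = ∫ z, dil n φ t z * (Θ (x + z) - Θ (y + z)) := by
      unfold cvAdj
      simp_rw [mul_sub]
      rw [integral_sub (integrable_dil_mul hφ ht h.lip x) (integrable_dil_mul hφ ht h.lip y)]
    have h1 : |cvAdj n φ Θ t x - cvAdj n φ Θ t y| ≤ L * ‖x - y‖ * ∫ x, |φ x| := by
      rw [e]
      refine key _ _ (fun z _ => (h.lip _ _).trans ?_) (by positivity)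
      rw [add_sub_add_right_eq_sub]
    calc |Θ x - cvAdj n φ Θ t x - (Θ y - cvAdj n φ Θ t y)|
        = |(Θ x - Θ y) - (cvAdj n φ Θ t x - cvAdj n φ Θ t y)| := by ring_nf
      _ ≤ |Θ x - Θ y| + |cvAdj n φ Θ t x - cvAdj n φ Θ t y| := abs_sub _ _
      _ ≤ L * ‖x - y‖ + L * ‖x - y‖ * ∫ x, |φ x| := add_le_add (h.lip x y) h1
      _ = _ := by ring
  · have h1 : Θ y = 0 := h.supp y (by linarith)
    have h2 : ∀ z, dil n φ t z * Θ (y + z) = 0 := fun z => by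
      by_cases hz : t < ‖z‖
      · rw [hφ.dil_eq_zero ht hz, zero_mul]
      · rw [h.supp, mul_zero]
        have e : y - x₀ = (y + z - x₀) - z := by abel
        have := norm_sub_le (y + z - x₀) z
        rw [← e] at this
        linarith
    unfold cvAdj
    rw [h1]
    simp [h2]

theorem ofReal_abs_integral_step (hφ : IsKer n φ M) (hf : LocallyIntegrable f volume) {t : ℝ}
    (ht : 0 < t) {x₀ : Eucl n} {r R B L : ℝ} {Θ : Eucl n → ℝ} (h : IsBump n x₀ r B L Θ)
    (hL : 0 ≤ L) (hrR : r < R) :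
    ENNReal.ofReal |∫ x, f x * Θ x| ≤
      ENNReal.ofReal B * (∫⁻ x in ball x₀ R, ENNReal.ofReal |cv n φ f t x|) +
        ENNReal.ofReal |∫ x, f x * (Θ x - cvAdj n φ Θ t x)| := by
  have hi := integrable_mul_bump hf h
  have hi' := integrable_mul_bump hf (h.sub_cvAdj hφ ht hL)
  have e : ∫ x, f x * Θ x = (∫ x, cv n φ f t x * Θ x) + ∫ x, f x * (Θ x - cvAdj n φ Θ t x) := by
    rw [← integral_mul_cvAdj hφ hf ht h, ← integral_add _ hi']
    · congr 1; ext x; ring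
    · have := hi.sub hi'
      refine this.congr (Eventually.of_forall fun x => ?_)
      simp only [Pi.sub_apply]
      ring
  rw [e]
  refine (ENNReal.ofReal_le_ofReal (abs_add_le _ _)).trans ?_
  rw [ENNReal.ofReal_add (abs_nonneg _) (abs_nonneg _)]
  gcongr
  have h1 : ENNReal.ofReal |∫ x, cv n φ f t x * Θ x| ≤
      ∫⁻ x, ENNReal.ofReal |cv n φ f t x * Θ x| := by
    have := enorm_integral_le_lintegral_enorm (μ := volume) (fun x => cv n φ f t x * Θ x)
    simpa only [Real.enorm_eq_ofReal_abs] using this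
  refine h1.trans ?_
  rw [← lintegral_const_mul' _ _ ENNReal.ofReal_ne_top, ← lintegral_indicator measurableSet_ball]
  refine lintegral_mono fun x => ?_
  by_cases hx : x ∈ ball x₀ R
  · rw [Set.indicator_of_mem hx, ← ENNReal.ofReal_mul h.nonneg, abs_mul, mul_comm]
    exact ENNReal.ofReal_le_ofReal (mul_le_mul_of_nonneg_right (h.bound x) (abs_nonneg _))
  · rw [h.supp x]
    · simp
    · have : R ≤ ‖x - x₀‖ := by simpa [dist_eq_norm] using hx
      linarith

/-- The scale ratio attached to the kernel. -/
def kap (n : ℕ) (φ : Eucl n → ℝ) : ℝ := 1 / (2 * (1 + ∫ x, |φ x|))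

theorem kap_pos (hφ : IsKer n φ M) : 0 < kap n φ := by
  have := hφ.one_le_integral_abs
  unfold kap
  positivity

theorem kap_le (hφ : IsKer n φ M) : kap n φ ≤ 1 / 4 := by
  have := hφ.one_le_integral_abs
  unfold kap
  exact one_div_le_one_div_of_le (by norm_num) (by linarith)

theorem kap_mul (hφ : IsKer n φ M) : kap n φ * (1 + ∫ x, |φ x|) = 1 / 2 := by
  have := hφ.one_le_integral_abs
  unfold kap
  field_simp

theorem exists_bump_iterate (hφ : IsKer n φ M) (hf : LocallyIntegrable f volume) {x₀ : Eucl n}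
    {r K : ℝ} (hr : 0 < r) (hK : 0 ≤ K) {Θ : Eucl n → ℝ} (h : IsBump n x₀ r (K * r) K Θ) (N : ℕ) :
    ∃ Ψ, IsBump n x₀ (r * (2 - (1 / 2) ^ N)) (K * r * (kap n φ / 2) ^ N)
        (K * (1 + ∫ x, |φ x|) ^ N) Ψ ∧
      ENNReal.ofReal |∫ x, f x * Θ x| ≤
        (∑ m ∈ Finset.range N, ENNReal.ofReal (K * r * (kap n φ / 2) ^ m) *
          ∫⁻ x in ball x₀ (2 * r), ENNReal.ofReal |cv n φ f (r * (kap n φ ^ 2) ^ (m + 1)) x|) +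
        ENNReal.ofReal |∫ x, f x * Ψ x| := by
  have hκ := kap_pos hφ
  have hκ4 := kap_le hφ
  have hκm := kap_mul hφ
  have hc := hφ.one_le_integral_abs
  set κ := kap n φ
  set c := ∫ x, |φ x|
  induction N with
  | zero => exact ⟨Θ, by norm_num; exact h, by simp⟩
  | succ N ih =>
    obtain ⟨Ψ, hΨ, hle⟩ := ih
    have ht : 0 < r * (κ ^ 2) ^ (N + 1) := by positivity
    have hL : 0 ≤ K * (1 + c) ^ N := by positivity
    refine ⟨fun y => Ψ y - cvAdj n φ Ψ (r * (κ ^ 2) ^ (N + 1)) y,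
      (hΨ.sub_cvAdj hφ ht hL).mono ?_ ?_ ?_, ?_⟩
    · have h1 : (κ ^ 2) ^ (N + 1) ≤ (1 / 2) ^ (N + 1) := by
        gcongr
        nlinarith
      have h2 : ((1 : ℝ) / 2) ^ N = 2 * (1 / 2) ^ (N + 1) := by rw [pow_succ]; ring
      nlinarith
    · have h1 : κ ^ 2 * (1 + c) = κ / 2 := by rw [pow_two, mul_assoc, hκm]; ring
      calc K * (1 + c) ^ N * (r * (κ ^ 2) ^ (N + 1)) * c
          ≤ K * (1 + c) ^ N * (r * (κ ^ 2) ^ (N + 1)) * (1 + c) := by gcongr; linarith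
        _ = K * r * (κ ^ 2 * (1 + c)) ^ (N + 1) := by rw [mul_pow]; ring
        _ = _ := by rw [h1]
    · rw [pow_succ]; linarith
    · refine hle.trans ?_
      rw [Finset.sum_range_succ, add_assoc]
      gcongr
      refine ofReal_abs_integral_step hφ hf ht hΨ hL ?_
      have : (0 : ℝ) < (1 / 2) ^ N := by positivity
      nlinarith

theorem ofReal_abs_integral_le_tsum (hφ : IsKer n φ M) (hf : LocallyIntegrable f volume)
    {x₀ : Eucl n} {r K : ℝ} (hr : 0 < r) (hK : 0 ≤ K) {Θ : Eucl n → ℝ}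
    (h : IsBump n x₀ r (K * r) K Θ) :
    ENNReal.ofReal |∫ x, f x * Θ x| ≤
      ∑' m : ℕ, ENNReal.ofReal (K * r * (kap n φ / 2) ^ m) *
          ∫⁻ x in ball x₀ (2 * r), ENNReal.ofReal |cv n φ f (r * (kap n φ ^ 2) ^ (m + 1)) x| := by
  have hκ := kap_pos hφ
  have hκ4 := kap_le hφ
  set I := ∫ x in ball x₀ (2 * r), |f x|
  have hlim : Tendsto (fun N : ℕ => (∑' m : ℕ, ENNReal.ofReal (K * r * (kap n φ / 2) ^ m) *
          ∫⁻ x in ball x₀ (2 * r), ENNReal.ofReal |cv n φ f (r * (kap n φ ^ 2) ^ (m + 1)) x|) +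
        ENNReal.ofReal (K * r * (kap n φ / 2) ^ N * I)) atTop
      (𝓝 ((∑' m : ℕ, ENNReal.ofReal (K * r * (kap n φ / 2) ^ m) *
          ∫⁻ x in ball x₀ (2 * r), ENNReal.ofReal |cv n φ f (r * (kap n φ ^ 2) ^ (m + 1)) x|) +
        ENNReal.ofReal (K * r * 0 * I))) := by
    refine tendsto_const_nhds.add ?_
    refine (ENNReal.continuous_ofReal.tendsto _).comp ?_
    exact ((tendsto_pow_atTop_nhds_zero_of_lt_one (by positivity) (by linarith)).const_mul
      (K * r)).mul_const I
  rw [mul_zero, zero_mul, ENNReal.ofReal_zero, add_zero] at hlim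
  refine ge_of_tendsto' hlim fun N => ?_
  obtain ⟨Ψ, hΨ, hle⟩ := exists_bump_iterate hφ hf hr hK h N
  refine hle.trans (add_le_add (ENNReal.sum_le_tsum _) (ENNReal.ofReal_le_ofReal ?_))
  refine abs_integral_bump_le hf hΨ ?_
  have : (0 : ℝ) < (1 / 2) ^ N := by positivity
  nlinarith

end

section

variable {n : ℕ} {φ f : Eucl n → ℝ} {M : ℝ}

/-- The exponent `1 / (2n + 1)`. -/
def pexp (n : ℕ) : ℝ := 1 / (2 * n + 1)

/-- The exponent `2n / (2n + 1)`. -/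
def qexp (n : ℕ) : ℝ := 1 - pexp n

theorem pexp_pos (n : ℕ) : 0 < pexp n := by unfold pexp; positivity

theorem qexp_pos {n : ℕ} (hn : 1 ≤ n) : 0 < qexp n := by
  have : (1 : ℝ) ≤ n := by exact_mod_cast hn
  unfold qexp pexp
  rw [sub_pos, div_lt_one (by positivity)]
  linarith

/-- The `q`-th power of the maximal function. -/
def maxPow (n : ℕ) (φ f : Eucl n → ℝ) (x : Eucl n) : ℝ≥0∞ := maxFun n φ f x ^ qexp n

/-- Weighted supremum of the convolutions of `f` over a truncated cone. -/
def coneSup (n : ℕ) (φ f : Eucl n → ℝ) (x₀ : Eucl n) (r : ℝ) : ℝ≥0∞ :=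
  ⨆ (y : Eucl n) (j : ℕ) (_ : ‖y - x₀‖ + 4 * (r * (kap n φ ^ 2) ^ j) ≤ 4 * r),
    ENNReal.ofReal (kap n φ ^ ((2 * n + 1) * j) * |cv n φ f (r * (kap n φ ^ 2) ^ j) y|)

theorem dil_bump (hφ : IsKer n φ M) {s : ℝ} (hs : 0 < s) (y : Eucl n) :
    IsBump n y s (M * (s ^ (n + 1))⁻¹ * s) (M * (s ^ (n + 1))⁻¹) (fun z => dil n φ s (y - z)) where
  bound z := by
    refine (hφ.dil_bound hs _).trans_eq ?_
    rw [pow_succ]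
    field_simp
  lip z w := by
    refine (hφ.dil_lip hs _ _).trans_eq ?_
    rw [sub_sub_sub_cancel_left, norm_sub_rev]
  supp z hz := hφ.dil_eq_zero hs (by rwa [norm_sub_rev])

theorem coneSup_lt_top (hφ : IsKer n φ M) (hf : LocallyIntegrable f volume) (x₀ : Eucl n) {r : ℝ}
    (hr : 0 < r) : coneSup n φ f x₀ r < ⊤ := by
  have hκ := kap_pos hφ
  have hκ4 := kap_le hφ
  have hM := hφ.nonneg
  set κ := kap n φ with hκd
  have hi : ∀ R, IntegrableOn f (ball x₀ R) volume := fun R =>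
    (hf.integrableOn_isCompact (isCompact_closedBall x₀ R)).mono_set ball_subset_closedBall
  refine lt_of_le_of_lt (b := ENNReal.ofReal (M * (r ^ n)⁻¹ * ∫ x in ball x₀ (8 * r), |f x|)) ?_
    ENNReal.ofReal_lt_top
  refine iSup_le fun y => iSup_le fun j => iSup_le fun hy => ENNReal.ofReal_le_ofReal ?_
  rw [← hκd] at hy ⊢
  have hs : 0 < r * (κ ^ 2) ^ j := by positivity
  set s := r * (κ ^ 2) ^ j with hsd
  have h1 := abs_integral_bump_le hf (dil_bump hφ hs y) (show s < 2 * s by linarith)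
  have h2 : ∫ x in ball y (2 * s), |f x| ≤ ∫ x in ball x₀ (8 * r), |f x| := by
    refine setIntegral_mono_set (hi _).abs (Eventually.of_forall fun _ => abs_nonneg _) ?_
    refine (ball_subset_ball' ?_).eventuallyLE
    rw [dist_eq_norm]
    linarith
  have h0 : 0 ≤ ∫ x in ball x₀ (8 * r), |f x| := integral_nonneg fun _ => abs_nonneg _
  have hκ1 : κ ^ j ≤ 1 := pow_le_one₀ hκ.le (by linarith)
  calc κ ^ ((2 * n + 1) * j) * |cv n φ f s y|
      ≤ κ ^ ((2 * n + 1) * j) * (M * (s ^ (n + 1))⁻¹ * s * ∫ x in ball x₀ (8 * r), |f x|) := by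
        refine mul_le_mul_of_nonneg_left (h1.trans ?_) (by positivity)
        exact mul_le_mul_of_nonneg_left h2 (by positivity)
    _ = κ ^ j * (M * (r ^ n)⁻¹ * ∫ x in ball x₀ (8 * r), |f x|) := by
        have e1 : (s ^ (n + 1))⁻¹ * s = (s ^ n)⁻¹ := by rw [pow_succ]; field_simp
        have e2 : s ^ n = r ^ n * κ ^ (2 * n * j) := by
          rw [hsd, mul_pow, ← pow_mul, ← pow_mul]; ring_nf
        rw [mul_assoc M, e1, e2, show (2 * n + 1) * j = 2 * n * j + j by ring, pow_add]
        field_simp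
    _ ≤ _ := mul_le_of_le_one_left (by positivity) hκ1

theorem abs_cv_le_coneSup (hφ : IsKer n φ M) {x₀ y : Eucl n} {r : ℝ}
    (hr : 0 < r) {k : ℕ} (hy : ‖y - x₀‖ + 4 * (r * (kap n φ ^ 2) ^ k) ≤ 4 * r) :
    ENNReal.ofReal |cv n φ f (r * (kap n φ ^ 2) ^ k) y| ≤
      ENNReal.ofReal ((kap n φ ^ k)⁻¹) * (coneSup n φ f x₀ r ^ pexp n * maxPow n φ f y) := by
  have hκ := kap_pos hφ
  set κ := kap n φ with hκd
  have hp := pexp_pos n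
  have hq : 0 ≤ qexp n := by
    unfold qexp pexp
    rw [sub_nonneg, div_le_one (by positivity)]
    linarith [(Nat.cast_nonneg n : (0:ℝ) ≤ n)]
  set a := ENNReal.ofReal |cv n φ f (r * (κ ^ 2) ^ k) y| with ha
  have h1 : a ≤ maxFun n φ f y := le_maxFun (by positivity) y
  have h2 : ENNReal.ofReal (κ ^ ((2 * n + 1) * k)) * a ≤ coneSup n φ f x₀ r := by
    rw [ha, ← ENNReal.ofReal_mul (by positivity)]
    exact le_iSup₂_of_le y k (le_iSup_of_le hy le_rfl)
  have h3 : ENNReal.ofReal (κ ^ k) * a ^ pexp n ≤ coneSup n φ f x₀ r ^ pexp n := by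
    refine le_trans (le_of_eq ?_) (ENNReal.rpow_le_rpow h2 hp.le)
    rw [ENNReal.mul_rpow_of_nonneg _ _ hp.le, ENNReal.ofReal_rpow_of_nonneg
      (by positivity : 0 ≤ κ ^ ((2 * n + 1) * k)) hp.le]
    congr 2
    symm
    rw [← Real.rpow_natCast, ← Real.rpow_natCast, ← Real.rpow_mul hκ.le]
    congr 1
    unfold pexp
    push_cast
    field_simp
  have h4 : a = a ^ pexp n * a ^ qexp n := by
    rw [← ENNReal.rpow_add_of_nonneg _ _ hp.le hq]
    unfold qexp
    simp
  have h5 : a ^ pexp n ≤ ENNReal.ofReal ((κ ^ k)⁻¹) * coneSup n φ f x₀ r ^ pexp n := by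
    calc a ^ pexp n = ENNReal.ofReal ((κ ^ k)⁻¹) * (ENNReal.ofReal (κ ^ k) * a ^ pexp n) := by
          rw [← mul_assoc, ← ENNReal.ofReal_mul (by positivity), inv_mul_cancel₀ (by positivity)]
          simp
      _ ≤ _ := by gcongr
  rw [← mul_assoc]
  calc a = a ^ pexp n * a ^ qexp n := h4
    _ ≤ _ := mul_le_mul' h5 (ENNReal.rpow_le_rpow h1 hq)

theorem ofReal_abs_integral_le_coneSup (hφ : IsKer n φ M) (hf : LocallyIntegrable f volume)
    {x₀ y : Eucl n} {r K : ℝ} (hr : 0 < r) (hK : 0 ≤ K) {j : ℕ}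
    (hy : ‖y - x₀‖ + 4 * (r * (kap n φ ^ 2) ^ j) ≤ 4 * r) {Θ : Eucl n → ℝ}
    (h : IsBump n y (r * (kap n φ ^ 2) ^ j) (K * (r * (kap n φ ^ 2) ^ j)) K Θ) :
    ENNReal.ofReal |∫ x, f x * Θ x| ≤
      ENNReal.ofReal (2 * (K * (r * (kap n φ ^ 2) ^ j)) * (kap n φ ^ (j + 1))⁻¹) *
        (coneSup n φ f x₀ r ^ pexp n * ∫⁻ x in ball x₀ (4 * r), maxPow n φ f x) := by
  have hκ := kap_pos hφ
  have hκ4 := kap_le hφ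
  set κ := kap n φ with hκd
  set s := r * (κ ^ 2) ^ j with hs
  have hs0 : 0 < s := by positivity
  set H := ∫⁻ x in ball x₀ (4 * r), maxPow n φ f x with hH
  set Q := coneSup n φ f x₀ r with hQ
  have hQt : Q ^ pexp n ≠ ⊤ :=
    ENNReal.rpow_ne_top_of_nonneg (pexp_pos n).le (coneSup_lt_top hφ hf x₀ hr).ne
  have term : ∀ m : ℕ, ENNReal.ofReal (K * s * (κ / 2) ^ m) *
      ∫⁻ x in ball y (2 * s), ENNReal.ofReal |cv n φ f (s * (κ ^ 2) ^ (m + 1)) x| ≤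
      ENNReal.ofReal (K * s * (κ ^ (j + 1))⁻¹ * (1 / 2) ^ m) * (Q ^ pexp n * H) := by
    intro m
    have e : s * (κ ^ 2) ^ (m + 1) = r * (κ ^ 2) ^ (j + m + 1) := by rw [hs]; ring
    have h1 : ∫⁻ x in ball y (2 * s), ENNReal.ofReal |cv n φ f (s * (κ ^ 2) ^ (m + 1)) x| ≤
        ENNReal.ofReal ((κ ^ (j + m + 1))⁻¹) * (Q ^ pexp n * H) := by
      calc _ ≤ ∫⁻ x in ball y (2 * s),
            ENNReal.ofReal ((κ ^ (j + m + 1))⁻¹) * (Q ^ pexp n * maxPow n φ f x) := by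
            refine setLIntegral_mono' measurableSet_ball fun x hx => ?_
            rw [e]
            refine abs_cv_le_coneSup hφ hr ?_
            rw [← hκd, ← e]
            have h2 : ‖x - y‖ < 2 * s := by simpa [dist_eq_norm] using hx
            have h3 : ‖x - x₀‖ ≤ ‖x - y‖ + ‖y - x₀‖ := norm_sub_le_norm_sub_add_norm_sub _ _ _
            have h4 : (κ ^ 2) ^ (m + 1) ≤ 1 / 4 := by
              have h5 : κ ^ 2 ≤ 1 / 4 := by nlinarith
              calc (κ ^ 2) ^ (m + 1) ≤ κ ^ 2 :=
                    pow_le_of_le_one (by positivity) (by linarith) (by omega)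
                _ ≤ 1 / 4 := h5
            nlinarith
        _ = ENNReal.ofReal ((κ ^ (j + m + 1))⁻¹) *
              (Q ^ pexp n * ∫⁻ x in ball y (2 * s), maxPow n φ f x) := by
            rw [lintegral_const_mul' _ _ ENNReal.ofReal_ne_top, lintegral_const_mul' _ _ hQt]
        _ ≤ _ := by
            gcongr
            refine lintegral_mono_set (ball_subset_ball' ?_)
            rw [dist_eq_norm]
            linarith
    calc _ ≤ ENNReal.ofReal (K * s * (κ / 2) ^ m) *
          (ENNReal.ofReal ((κ ^ (j + m + 1))⁻¹) * (Q ^ pexp n * H)) := by gcongr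
      _ = _ := by
          rw [← mul_assoc, ← ENNReal.ofReal_mul (by positivity)]
          congr 2
          rw [show j + m + 1 = (j + 1) + m by ring, pow_add, div_pow, one_div, inv_pow]
          field_simp
  refine (ofReal_abs_integral_le_tsum hφ hf hs0 hK h).trans ((ENNReal.tsum_le_tsum term).trans ?_)
  rw [ENNReal.tsum_mul_right]
  gcongr
  rw [← ENNReal.ofReal_tsum_of_nonneg (fun m => by positivity)
    (summable_geometric_two.mul_left _), tsum_mul_left, tsum_geometric_two]
  apply le_of_eq
  congr 1
  ring

theorem coneSup_le (hφ : IsKer n φ M) (hf : LocallyIntegrable f volume)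
    {x₀ : Eucl n} {r : ℝ} (hr : 0 < r) :
    coneSup n φ f x₀ r ≤ ENNReal.ofReal (2 * M * (kap n φ)⁻¹ * (r ^ n)⁻¹) *
        (coneSup n φ f x₀ r ^ pexp n * ∫⁻ x in ball x₀ (4 * r), maxPow n φ f x) := by
  have hκ := kap_pos hφ
  have hM := hφ.nonneg
  conv_lhs => unfold coneSup
  refine iSup_le fun y => iSup_le fun j => iSup_le fun hy => ?_
  set κ := kap n φ with hκd
  have hs : 0 < r * (κ ^ 2) ^ j := by positivity
  have h1 := ofReal_abs_integral_le_coneSup hφ hf hr (by positivity) hy (dil_bump hφ hs y)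
  rw [ENNReal.ofReal_mul (by positivity)]
  refine (mul_le_mul_right h1 _).trans ?_
  rw [← mul_assoc, ← ENNReal.ofReal_mul (by positivity)]
  refine mul_le_mul_left (ENNReal.ofReal_le_ofReal (le_of_eq ?_)) _
  rw [← hκd]
  set s := r * (κ ^ 2) ^ j with hsd
  have e1 : (s ^ (n + 1))⁻¹ * s = (s ^ n)⁻¹ := by rw [pow_succ]; field_simp
  have e2 : s ^ n = r ^ n * κ ^ (2 * n * j) := by
    rw [hsd, mul_pow, ← pow_mul, ← pow_mul]; ring_nf
  rw [mul_assoc M, e1, e2, show (2 * n + 1) * j = 2 * n * j + j by ring, pow_add, pow_succ]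
  field_simp

/-- Control of all test functions at scale `r` by the mean of `(f⁺)^q`. -/
theorem exists_abs_integral_bump_le (hn : 1 ≤ n) (hφ : IsKer n φ M) {B : ℝ} (hB : 0 < B) :
    ∃ C : ℝ, 0 < C ∧ ∀ f : Eucl n → ℝ, LocallyIntegrable f volume →
      ∀ (x₀ : Eucl n) (r K lam : ℝ) (Θ : Eucl n → ℝ), 0 < r → 0 ≤ K → 0 < lam →
        IsBump n x₀ r (K * r) K Θ →
        ∫⁻ x in ball x₀ (4 * r), maxPow n φ f x ≤ ENNReal.ofReal (B * r ^ n * lam ^ qexp n) →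
        |∫ x, f x * Θ x| ≤ C * (K * r ^ (n + 1) * lam) := by
  have hκ := kap_pos hφ
  have hM := hφ.nonneg
  have hM1 := hφ.one_le
  have hp := pexp_pos n
  have hq := qexp_pos hn
  have hpq : pexp n + qexp n = 1 := by unfold qexp; ring
  set C₁ : ℝ := 2 * M * (kap n φ)⁻¹ * B with hC₁
  have hC₁0 : 0 < C₁ := by positivity
  refine ⟨2 * (kap n φ)⁻¹ * B * (C₁ ^ (1 / qexp n)) ^ pexp n, by positivity, ?_⟩
  intro f hf x₀ r K lam Θ hr hK hlam hΘ hH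
  have hQt := coneSup_lt_top hφ hf x₀ hr
  have h1 := coneSup_le hφ hf (x₀ := x₀) hr
  have h2 := ofReal_abs_integral_le_coneSup (j := 0) (y := x₀) (x₀ := x₀) (r := r) (K := K)
    (Θ := Θ) hφ hf hr hK (by simp) (by simpa using hΘ)
  lift coneSup n φ f x₀ r to NNReal using hQt.ne with Q
  have hQ0 : (0 : ℝ) ≤ Q := Q.2
  have eQ : ((Q : ℝ≥0∞)) ^ pexp n = ENNReal.ofReal ((Q : ℝ) ^ pexp n) := by
    rw [← ENNReal.ofReal_coe_nnreal, ENNReal.ofReal_rpow_of_nonneg hQ0 hp.le]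
  have hQle : (Q : ℝ) ≤ C₁ ^ (1 / qexp n) * lam := by
    have h3 : (Q : ℝ) ≤ C₁ * lam ^ qexp n * (Q : ℝ) ^ pexp n := by
      have h4 : (Q : ℝ≥0∞) ≤ ENNReal.ofReal (2 * M * (kap n φ)⁻¹ * (r ^ n)⁻¹) *
          (ENNReal.ofReal ((Q : ℝ) ^ pexp n) * ENNReal.ofReal (B * r ^ n * lam ^ qexp n)) := by
        refine h1.trans ?_
        rw [eQ]
        gcongr
      rw [← ENNReal.ofReal_mul (by positivity), ← ENNReal.ofReal_mul (by positivity),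
        ← ENNReal.ofReal_coe_nnreal, ENNReal.ofReal_le_ofReal_iff (by positivity)] at h4
      refine h4.trans_eq ?_
      rw [hC₁]
      field_simp
    rcases hQ0.eq_or_lt with h0 | h0
    · rw [← h0]; positivity
    have h5 : (Q : ℝ) ^ qexp n ≤ C₁ * lam ^ qexp n := by
      have e : (Q : ℝ) = (Q : ℝ) ^ qexp n * (Q : ℝ) ^ pexp n := by
        rw [← Real.rpow_add h0, add_comm, hpq, Real.rpow_one]
      have hpos : 0 < (Q : ℝ) ^ pexp n := by positivity
      rw [e] at h3
      have e2 : ((Q : ℝ) ^ qexp n * (Q : ℝ) ^ pexp n) ^ pexp n = (Q : ℝ) ^ pexp n := by rw [← e]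
      rw [e2] at h3
      exact le_of_mul_le_mul_right h3 hpos
    have h6 := Real.rpow_le_rpow (by positivity) h5 (by positivity : 0 ≤ 1 / qexp n)
    rwa [← Real.rpow_mul hQ0, Real.mul_rpow hC₁0.le (by positivity), ← Real.rpow_mul hlam.le,
      mul_one_div_cancel hq.ne', Real.rpow_one, Real.rpow_one] at h6
  have h7 : (Q : ℝ) ^ pexp n * lam ^ qexp n ≤ (C₁ ^ (1 / qexp n)) ^ pexp n * lam := by
    calc (Q : ℝ) ^ pexp n * lam ^ qexp n
        ≤ (C₁ ^ (1 / qexp n) * lam) ^ pexp n * lam ^ qexp n := by gcongr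
      _ = (C₁ ^ (1 / qexp n)) ^ pexp n * (lam ^ pexp n * lam ^ qexp n) := by
          rw [Real.mul_rpow (by positivity) hlam.le]; ring
      _ = _ := by rw [← Real.rpow_add hlam, hpq, Real.rpow_one]
  have h8 : ENNReal.ofReal |∫ x, f x * Θ x| ≤
      ENNReal.ofReal (2 * (K * r) * (kap n φ)⁻¹) *
        (ENNReal.ofReal ((Q : ℝ) ^ pexp n) * ENNReal.ofReal (B * r ^ n * lam ^ qexp n)) := by
    refine h2.trans ?_
    rw [eQ]
    simp only [pow_zero, mul_one, zero_add, pow_one]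
    gcongr
  rw [← ENNReal.ofReal_mul (by positivity), ← ENNReal.ofReal_mul (by positivity),
    ENNReal.ofReal_le_ofReal_iff (by positivity)] at h8
  refine h8.trans ?_
  calc 2 * (K * r) * (kap n φ)⁻¹ * ((Q : ℝ) ^ pexp n * (B * r ^ n * lam ^ qexp n))
      = 2 * (kap n φ)⁻¹ * B * (K * r ^ (n + 1)) * ((Q : ℝ) ^ pexp n * lam ^ qexp n) := by ring
    _ ≤ 2 * (kap n φ)⁻¹ * B * (K * r ^ (n + 1)) * ((C₁ ^ (1 / qexp n)) ^ pexp n * lam) := by gcongr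
    _ = _ := by ring

end

section

variable {n : ℕ} {φ f : Eucl n → ℝ} {M : ℝ}

theorem measurable_maxFun (hφ : IsKer n φ M) (hf : LocallyIntegrable f volume) :
    Measurable (maxFun n φ f) := by
  refine LowerSemicontinuous.measurable ?_
  refine lowerSemicontinuous_iSup fun t => lowerSemicontinuous_iSup fun ht => ?_
  have := continuous_cv hφ hf ht
  exact (ENNReal.continuous_ofReal.comp this.abs).lowerSemicontinuous

theorem measurable_maxPow (hφ : IsKer n φ M) (hf : LocallyIntegrable f volume) :
    Measurable (maxPow n φ f) := (measurable_maxFun hφ hf).pow_const _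

/-- The weight `1 / (log (e + ‖x‖) + s)`. -/
def logWt (n : ℕ) (s : ℝ) (x : Eucl n) : ℝ≥0∞ :=
  ENNReal.ofReal (1 / (log (exp 1 + ‖x‖) + s))

theorem one_le_log_exp_add {t : ℝ} (ht : 0 ≤ t) : 1 ≤ log (exp 1 + t) := by
  rw [Real.le_log_iff_exp_le (by positivity)]; linarith

theorem log_exp_add_mono {s t : ℝ} (hs : 0 ≤ s) (h : s ≤ t) :
    log (exp 1 + s) ≤ log (exp 1 + t) := by
  apply Real.log_le_log (by positivity); linarith

theorem measurable_logWt (n : ℕ) (s : ℝ) : Measurable (logWt n s) := by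
  unfold logWt; fun_prop

theorem log_exp_add_le_two_mul_sqrt {R : ℝ} (hR : 0 ≤ R) :
    log (exp 1 + R) ≤ 2 * log (exp 1 + √R) := by
  have h := Real.sq_sqrt hR
  have h1 := Real.sqrt_nonneg R
  have he := Real.add_one_le_exp 1
  rw [← Real.log_rpow (by positivity)]
  apply Real.log_le_log (by positivity)
  norm_num
  nlinarith

theorem log_exp_add_le_three_mul {s t : ℝ} (ht : 0 ≤ t) (hs : 0 ≤ s) (h : s ≤ 3 * t) :
    log (exp 1 + s) ≤ 3 * log (exp 1 + t) := by
  have h1 : log (exp 1 + s) ≤ log 3 + log (exp 1 + t) := by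
    rw [← Real.log_mul (by norm_num) (by positivity)]
    apply Real.log_le_log (by positivity)
    have := exp_pos 1
    linarith
  have h2 : log 3 ≤ 2 := by
    have := Real.log_le_sub_one_of_pos (show (0:ℝ) < 3 by norm_num)
    linarith
  have := one_le_log_exp_add ht
  linarith

/-- The Muckenhoupt `A₁` constant of the logarithmic weights. -/
def aone (n : ℕ) : ℝ := 3 * 6 ^ n + 6 * 18 ^ n

theorem aone_pos (n : ℕ) : 0 < aone n := by unfold aone; positivity

theorem logWt_le_of_le {s R : ℝ} (hs : 1 ≤ s) (hR : 0 ≤ R) {z : Eucl n}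
    (h : log (exp 1 + R) ≤ 3 * log (exp 1 + ‖z‖)) :
    logWt n s z ≤ ENNReal.ofReal (3 * (1 / (log (exp 1 + R) + s))) := by
  have h1 := one_le_log_exp_add hR
  have h2 := one_le_log_exp_add (norm_nonneg z)
  refine ENNReal.ofReal_le_ofReal ?_
  rw [mul_one_div, div_le_div_iff₀ (by positivity) (by positivity)]
  linarith

theorem setLIntegral_logWt_le (hn : 1 ≤ n) {s : ℝ} (hs : 1 ≤ s) {x y : Eucl n} {r : ℝ} (hr : 0 < r)
    (hx : x ∈ ball y r) :
    ∫⁻ z in ball y (6 * r), logWt n s z ≤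
      ENNReal.ofReal (aone n) * volume (ball y r) * logWt n s x := by
  set R := ‖y‖ + 6 * r with hRd
  have hR : 0 < R := by positivity
  set L := log (exp 1 + R) with hL
  have hL1 : 1 ≤ L := one_le_log_exp_add hR.le
  have hu := ubv_pos n
  have hxn : ‖x‖ ≤ R := by
    have : ‖x - y‖ < r := by simpa [dist_eq_norm] using hx
    have h2 : ‖x‖ ≤ ‖x - y‖ + ‖y‖ := by simpa using norm_add_le (x - y) y
    linarith
  have hxL : log (exp 1 + ‖x‖) ≤ L := log_exp_add_mono (norm_nonneg _) hxn
  have hx1 := one_le_log_exp_add (norm_nonneg x)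
  have main : ∫⁻ z in ball y (6 * r), logWt n s z ≤
      ENNReal.ofReal (aone n * (r ^ n * ubv n) * (1 / (L + s))) := by
    by_cases hA : 12 * r ≤ ‖y‖ ∨ R ≤ 1
    · calc ∫⁻ z in ball y (6 * r), logWt n s z
          ≤ ∫⁻ z in ball y (6 * r), ENNReal.ofReal (3 * (1 / (L + s))) := by
            refine setLIntegral_mono' measurableSet_ball fun z hz => logWt_le_of_le hs hR.le ?_
            rcases hA with h | h
            · refine log_exp_add_le_three_mul (norm_nonneg _) hR.le ?_
              have h1 : ‖z - y‖ < 6 * r := by simpa [dist_eq_norm] using hz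
              have h2 : ‖y‖ ≤ ‖z - y‖ + ‖z‖ := by
                simpa [norm_sub_rev] using norm_add_le (y - z) z
              linarith
            · have h1 : log (exp 1 + R) ≤ log (exp 1 + 1) := log_exp_add_mono hR.le h
              have h2 : log (exp 1 + 1) ≤ 3 := by
                rw [Real.log_le_iff_le_exp (by positivity), show (3 : ℝ) = 1 + 1 + 1 by norm_num,
                  exp_add, exp_add]
                have := Real.add_one_le_exp 1
                nlinarith
              have := one_le_log_exp_add (norm_nonneg z)
              linarith
        _ = ENNReal.ofReal (3 * (1 / (L + s)) * ((6 * r) ^ n * ubv n)) := by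
            rw [setLIntegral_const, volume_ball_eq _ (by positivity),
              ← ENNReal.ofReal_mul (by positivity)]
        _ ≤ _ := by
            refine ENNReal.ofReal_le_ofReal ?_
            unfold aone
            rw [mul_pow]
            have : 0 ≤ 6 * 18 ^ n * (r ^ n * ubv n) * (1 / (L + s)) := by positivity
            linarith
    · push Not at hA
      obtain ⟨h12, h1R⟩ := hA
      have hS : 1 < √R := by rwa [Real.lt_sqrt (by norm_num), one_pow]
      set S := √R with hSd
      have hSS : S ^ 2 = R := Real.sq_sqrt hR.le
      have hLS : L ≤ 6 * S := by
        have h1 := log_exp_add_le_two_mul_sqrt hR.le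
        have h2 := Real.log_le_sub_one_of_pos (show 0 < exp 1 + S by positivity)
        have h3 := Real.exp_one_lt_d9
        rw [← hSd] at h1
        linarith
      calc ∫⁻ z in ball y (6 * r), logWt n s z
          ≤ ∫⁻ z in ball y (6 * r), (ENNReal.ofReal (3 * (1 / (L + s))) +
              (ball 0 S).indicator (fun _ => ENNReal.ofReal (L / (L + s))) z) := by
            refine setLIntegral_mono' measurableSet_ball fun z hz => ?_
            by_cases hz' : z ∈ ball (0 : Eucl n) S
            · rw [Set.indicator_of_mem hz']
              refine le_trans (ENNReal.ofReal_le_ofReal ?_) le_add_self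
              have := one_le_log_exp_add (norm_nonneg z)
              rw [div_le_div_iff₀ (by positivity) (by positivity)]
              nlinarith
            · rw [Set.indicator_of_notMem hz', add_zero]
              refine logWt_le_of_le hs hR.le ?_
              have h1 := log_exp_add_le_two_mul_sqrt hR.le
              have h2 : log (exp 1 + √R) ≤ log (exp 1 + ‖z‖) :=
                log_exp_add_mono (Real.sqrt_nonneg _) (by simpa using hz')
              have := one_le_log_exp_add (norm_nonneg z)
              linarith
        _ ≤ ENNReal.ofReal (3 * (1 / (L + s)) * ((6 * r) ^ n * ubv n)) +
              ENNReal.ofReal (L / (L + s) * (S ^ n * ubv n)) := by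
            rw [lintegral_add_left measurable_const, setLIntegral_const,
              volume_ball_eq _ (by positivity), ← ENNReal.ofReal_mul (by positivity)]
            gcongr
            refine (setLIntegral_le_lintegral _ _).trans ?_
            rw [lintegral_indicator measurableSet_ball, setLIntegral_const,
              volume_ball_eq _ (by positivity), ← ENNReal.ofReal_mul (by positivity)]
        _ ≤ _ := by
            rw [← ENNReal.ofReal_add (by positivity) (by positivity)]
            refine ENNReal.ofReal_le_ofReal ?_
            have h3 : L * S ^ n ≤ 6 * 18 ^ n * r ^ n := by
              calc L * S ^ n ≤ (6 * S ^ n) * S ^ n := by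
                    gcongr
                    refine hLS.trans ?_
                    gcongr
                    exact le_self_pow₀ hS.le (by omega)
                _ = 6 * R ^ n := by rw [← hSS]; ring
                _ ≤ 6 * (18 * r) ^ n := by gcongr; linarith
                _ = _ := by rw [mul_pow]; ring
            have h4 : L / (L + s) * (S ^ n * ubv n) = (L * S ^ n) * (ubv n * (1 / (L + s))) := by
              ring
            rw [h4]
            have h5 := mul_le_mul_of_nonneg_right h3 (show 0 ≤ ubv n * (1 / (L + s)) by positivity)
            refine (add_le_add_right h5 _).trans_eq ?_
            unfold aone
            ring
  refine main.trans ?_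
  unfold logWt
  have ha := aone_pos n
  rw [volume_ball_eq _ hr, ← ENNReal.ofReal_mul (by positivity), ← ENNReal.ofReal_mul (by positivity)]
  refine ENNReal.ofReal_le_ofReal ?_
  gcongr

/-- The union of the balls on which the mean of `h` exceeds `μ`. -/
def bigMean (n : ℕ) (h : Eucl n → ℝ≥0∞) (μ : ℝ≥0∞) : Set (Eucl n) :=
  {x | ∃ y r, 0 < r ∧ x ∈ ball y r ∧ μ * volume (ball y r) < ∫⁻ z in ball y r, h z}

theorem isOpen_bigMean (h : Eucl n → ℝ≥0∞) (μ : ℝ≥0∞) : IsOpen (bigMean n h μ) := by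
  rw [isOpen_iff_mem_nhds]
  rintro x ⟨y, r, hr, hx, hm⟩
  exact Filter.mem_of_superset (isOpen_ball.mem_nhds hx) fun z hz => ⟨y, r, hr, hz, hm⟩

theorem bigMean_anti (h : Eucl n → ℝ≥0∞) {μ ν : ℝ≥0∞} (hμ : μ ≤ ν) :
    bigMean n h ν ⊆ bigMean n h μ := by
  rintro x ⟨y, r, hr, hx, hm⟩
  exact ⟨y, r, hr, hx, lt_of_le_of_lt (by gcongr) hm⟩

theorem half_mul_le_of_mean_lt {h w : Eucl n → ℝ≥0∞} (hh : Measurable h) {A μ : ℝ≥0∞}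
    (hA : ∀ (y : Eucl n) (r : ℝ), 0 < r → ∀ x ∈ ball y r,
      ∫⁻ z in ball y (6 * r), w z ≤ A * volume (ball y r) * w x) (hμ : μ ≠ ⊤)
    {y : Eucl n} {r : ℝ} (hr : 0 < r) (hm : μ * volume (ball y r) < ∫⁻ z in ball y r, h z)
    (hAt : A ≠ ⊤) :
    μ / 2 * ∫⁻ z in ball y (6 * r), w z ≤
      A * ∫⁻ z in ball y r, {z | μ / 2 < h z}.indicator h z * w z := by
  set I := ∫⁻ z in ball y (6 * r), w z
  set V := volume (ball y r) with hV
  have hV0 : V ≠ 0 := (measure_ball_pos _ _ hr).ne'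
  have hVt : V ≠ ⊤ := measure_ball_lt_top.ne
  set h' := {z | μ / 2 < h z}.indicator h with hh'
  have hm' : Measurable h' := hh.indicator (measurableSet_lt measurable_const hh)
  have h1 : μ / 2 * V ≤ ∫⁻ z in ball y r, h' z := by
    have h2 : ∫⁻ z in ball y r, h z ≤ μ / 2 * V + ∫⁻ z in ball y r, h' z := by
      rw [← setLIntegral_const, ← lintegral_add_left measurable_const]
      refine lintegral_mono fun z => ?_
      by_cases hz : μ / 2 < h z
      · rw [hh', Set.indicator_of_mem (by exact hz)]; exact le_add_self
      · exact (not_lt.1 hz).trans le_self_add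
    have h3 : μ / 2 * V + μ / 2 * V ≤ μ / 2 * V + ∫⁻ z in ball y r, h' z := by
      rw [← add_mul, ENNReal.add_halves]
      exact hm.le.trans h2
    exact (ENNReal.add_le_add_iff_left
      (ENNReal.mul_ne_top (ENNReal.div_ne_top hμ (by norm_num)) hVt)).1 h3
  have h2 : I * ∫⁻ z in ball y r, h' z ≤ V * (A * ∫⁻ z in ball y r, h' z * w z) := by
    rw [← lintegral_const_mul _ hm', ← lintegral_const_mul' _ _ hAt,
      ← lintegral_const_mul' _ _ hVt]
    refine setLIntegral_mono' measurableSet_ball fun z hz => ?_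
    calc I * h' z ≤ A * V * w z * h' z := by gcongr; exact hA y r hr z hz
      _ = _ := by ring
  have h3 : V * (μ / 2 * I) ≤ V * (A * ∫⁻ z in ball y r, h' z * w z) := by
    refine le_trans ?_ h2
    calc V * (μ / 2 * I) = I * (μ / 2 * V) := by ring
      _ ≤ _ := by gcongr
  exact (ENNReal.mul_le_mul_iff_right hV0 hVt).1 h3

theorem half_mul_setLIntegral_bigMean_le {h w : Eucl n → ℝ≥0∞} (hn : 1 ≤ n) (hh : Measurable h)
    {A μ : ℝ≥0∞}
    (hA : ∀ (y : Eucl n) (r : ℝ), 0 < r → ∀ x ∈ ball y r,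
      ∫⁻ z in ball y (6 * r), w z ≤ A * volume (ball y r) * w x) (hμ : μ ≠ ⊤) (hAt : A ≠ ⊤) :
    μ / 2 * ∫⁻ z in bigMean n h μ, w z ≤ A * ∫⁻ z, {z | μ / 2 < h z}.indicator h z * w z := by
  set T : ℕ → Set (Eucl n × ℝ) := fun N =>
    {a | 0 < a.2 ∧ a.2 ≤ N ∧ μ * volume (ball a.1 a.2) < ∫⁻ z in ball a.1 a.2, h z} with hT
  set U : ℕ → Set (Eucl n) := fun N => ⋃ a ∈ T N, ball a.1 a.2 with hU
  have hUm : Monotone U := fun N N' hN => by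
    refine Set.biUnion_subset_biUnion_left fun a ha => ⟨ha.1, ha.2.1.trans ?_, ha.2.2⟩
    exact_mod_cast hN
  have hUn : bigMean n h μ = ⋃ N, U N := by
    ext x
    simp only [hU, hT, Set.mem_iUnion]
    constructor
    · rintro ⟨y, r, hr, hx, hm⟩
      obtain ⟨N, hN⟩ := exists_nat_ge r
      exact ⟨N, (y, r), ⟨hr, hN, hm⟩, hx⟩
    · rintro ⟨N, a, ha, hx⟩
      exact ⟨a.1, a.2, ha.1, hx, ha.2.2⟩
  rw [hUn, setLIntegral_iUnion_of_directed _ hUm.directed_le, ENNReal.mul_iSup]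
  refine iSup_le fun N => ?_
  obtain ⟨u, hut, hud, hcov⟩ := Vitali.exists_disjoint_subfamily_covering_enlargement_closedBall
    (T N) (fun a => a.1) (fun a => a.2) N (fun a ha => ha.2.1) 5 (by norm_num)
  have hNe : Nonempty (Fin n) := ⟨⟨0, by omega⟩⟩
  have huc : u.Countable := by
    refine hud.countable_of_nonempty_interior fun a ha => ?_
    exact ⟨a.1, ball_subset_interior_closedBall (mem_ball_self (hut ha).1)⟩
  have hsub : U N ⊆ ⋃ a ∈ u, ball a.1 (6 * a.2) := by
    refine Set.iUnion₂_subset fun a ha => ?_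
    obtain ⟨b, hb, hab⟩ := hcov a ha
    refine (ball_subset_closedBall.trans hab).trans ?_
    refine (closedBall_subset_ball ?_).trans (Set.subset_biUnion_of_mem (u := fun a : Eucl n × ℝ =>
      ball a.1 (6 * a.2)) hb)
    linarith [(hut hb).1]
  have := huc.to_subtype
  calc μ / 2 * ∫⁻ z in U N, w z
      ≤ μ / 2 * ∑' a : u, ∫⁻ z in ball a.1.1 (6 * a.1.2), w z := by
        gcongr
        refine (lintegral_mono_set hsub).trans ?_
        rw [Set.biUnion_eq_iUnion]
        exact lintegral_iUnion_le _ _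
    _ = ∑' a : u, μ / 2 * ∫⁻ z in ball a.1.1 (6 * a.1.2), w z := ENNReal.tsum_mul_left.symm
    _ ≤ ∑' a : u, A * ∫⁻ z in ball a.1.1 a.1.2, {z | μ / 2 < h z}.indicator h z * w z :=
        ENNReal.tsum_le_tsum fun a =>
          half_mul_le_of_mean_lt hh hA hμ (hut a.2).1 (hut a.2).2.2 hAt
    _ = A * ∫⁻ z in ⋃ a ∈ u, ball a.1 a.2, {z | μ / 2 < h z}.indicator h z * w z := by
        rw [ENNReal.tsum_mul_left, lintegral_biUnion huc (fun a _ => measurableSet_ball)]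
        exact hud.mono_on fun a _ => ball_subset_closedBall
    _ ≤ _ := by gcongr; exact Measure.restrict_le_self

end

section

variable {n : ℕ} {φ f : Eucl n → ℝ} {M : ℝ}

/-- The set where the uncentred means of `(f⁺)^q` exceed `lam ^ q`. -/
def bigSet (n : ℕ) (φ f : Eucl n → ℝ) (lam : ℝ) : Set (Eucl n) :=
  bigMean n (maxPow n φ f) (ENNReal.ofReal (lam ^ qexp n))

theorem half_le_qexp (hn : 1 ≤ n) : 1 / 2 ≤ qexp n := by
  have : (1 : ℝ) ≤ n := by exact_mod_cast hn
  unfold qexp pexp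
  rw [le_sub_iff_add_le, div_add_div _ _ (by norm_num) (by positivity), div_le_one (by positivity)]
  linarith

theorem tsum_int_le_geometric {F : ℤ → ℝ≥0∞} {k₀ : ℤ} {D b : ℝ} (hD : 0 ≤ D) (hb : 0 ≤ b) (hb1 : b < 1)
    (h0 : ∀ k, k₀ < k → F k = 0) (h1 : ∀ m : ℕ, F (k₀ - m) ≤ ENNReal.ofReal (D * b ^ m)) :
    ∑' k, F k ≤ ENNReal.ofReal (D / (1 - b)) := by
  have hinj : Function.Injective fun m : ℕ => k₀ - (m : ℤ) := fun a b h => by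
    simpa using h
  rw [← hinj.tsum_eq (f := F)]
  · refine (ENNReal.tsum_le_tsum h1).trans ?_
    rw [← ENNReal.ofReal_tsum_of_nonneg (fun m => by positivity)
      ((summable_geometric_of_lt_one hb hb1).mul_left D), tsum_mul_left,
      tsum_geometric_of_lt_one hb hb1, div_eq_mul_inv]
  · intro k hk
    have : k ≤ k₀ := not_lt.1 fun h => hk (h0 k h)
    refine ⟨(k₀ - k).toNat, ?_⟩
    simp only [Int.ofNat_toNat]
    omega

theorem rpow_div_log_le {p a s t : ℝ} (hp : 0 < p) (ha : 1 ≤ a) (hs : 0 < s)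
    (ht : 0 < t) (hst : s < 4 * t) :
    2 * s ^ p * t ^ (1 - p) / (a + log (exp 1 + s)) ≤
      2 * (1 + 2 / p) * 5 ^ (p / 2) * (s / t) ^ (p / 2) * (t / (a + log (exp 1 + t))) := by
  have h1 := one_le_log_exp_add hs.le
  have h2 := one_le_log_exp_add ht.le
  set y := t / s with hy
  have hy0 : 0 < y := by positivity
  have hy4 : 1 < 4 * y := by rw [hy, ← mul_div_assoc, one_lt_div hs]; exact hst
  have h3 : log (exp 1 + t) ≤ log (exp 1 + s) + log (1 + y) := by
    rw [← Real.log_mul (by positivity) (by positivity)]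
    apply Real.log_le_log (by positivity)
    have : s * y = t := by rw [hy]; field_simp
    have h4 : 0 < exp 1 * y := by positivity
    nlinarith
  have h4 : log (1 + y) ≤ (2 / p) * (5 * y) ^ (p / 2) := by
    refine (Real.log_le_rpow_div (by positivity) (show 0 < p / 2 by positivity)).trans ?_
    rw [div_le_iff₀ (by positivity)]
    have : (2 / p) * (5 * y) ^ (p / 2) * (p / 2) = (5 * y) ^ (p / 2) := by field_simp
    rw [this]
    apply Real.rpow_le_rpow (by positivity) (by linarith) (by positivity)
  have h5 : 1 ≤ (5 * y) ^ (p / 2) := Real.one_le_rpow (by linarith) (by positivity)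
  have h6 : 0 ≤ log (1 + y) := Real.log_nonneg (by linarith)
  have h7 : a + log (exp 1 + t) ≤ (a + log (exp 1 + s)) * ((1 + 2 / p) * (5 * y) ^ (p / 2)) := by
    calc a + log (exp 1 + t) ≤ (a + log (exp 1 + s)) * (1 + log (1 + y)) := by nlinarith
      _ ≤ _ := by gcongr; linarith
  have h8 : s ^ p * t ^ (1 - p) = t * ((s / t) ^ (p / 2) * (s / t) ^ (p / 2)) := by
    rw [← Real.rpow_add (by positivity), add_halves, Real.div_rpow hs.le ht.le, Real.rpow_sub ht,
      Real.rpow_one]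
    field_simp
  have h9 : (5 * y) ^ (p / 2) * (s / t) ^ (p / 2) = 5 ^ (p / 2) := by
    rw [← Real.mul_rpow (by positivity) (by positivity)]
    congr 1
    rw [hy]; field_simp
  rw [mul_div_assoc', div_le_div_iff₀ (by positivity) (by positivity), mul_assoc 2, h8]
  have hw : 0 ≤ 2 * (t * ((s / t) ^ (p / 2) * (s / t) ^ (p / 2))) := by positivity
  refine (mul_le_mul_of_nonneg_left h7 hw).trans_eq ?_
  rw [← h9]
  ring

/-- The constant in the modular inequality. -/
def modConst (n : ℕ) : ℝ :=
  2 * (1 + 2 / pexp n) * 5 ^ (pexp n / 2) * (4 ^ (pexp n / 2) / (1 - (1 / 2) ^ (pexp n / 2)))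

theorem half_rpow_lt_one (n : ℕ) : (1 / 2 : ℝ) ^ (pexp n / 2) < 1 :=
  Real.rpow_lt_one (by norm_num) (by norm_num) (by have := pexp_pos n; positivity)

theorem modConst_pos (n : ℕ) : 0 < modConst n := by
  have := pexp_pos n
  have := sub_pos.2 (half_rpow_lt_one n)
  unfold modConst
  positivity

theorem tsum_level_le_thetaE (hn : 1 ≤ n) (x : Eucl n) (g : ℝ≥0∞) :
    ∑' k : ℤ, ENNReal.ofReal (2 * ((2 : ℝ) ^ k) ^ pexp n) *
      ({h : ℝ≥0∞ | ENNReal.ofReal (((2 : ℝ) ^ k) ^ qexp n) / 2 < h}.indicator id (g ^ qexp n) *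
        logWt n (log (exp 1 + 2 ^ k)) x) ≤ ENNReal.ofReal (modConst n) * thetaE n x g := by
  have hp := pexp_pos n
  have hq := qexp_pos hn
  have hq2 := half_le_qexp hn
  have hC := modConst_pos n
  have hb := half_rpow_lt_one n
  have hx := one_le_log_exp_add (norm_nonneg x)
  induction g with
  | top =>
    have : thetaE n x ⊤ = ⊤ := ENNReal.top_div_of_ne_top ENNReal.ofReal_ne_top
    rw [this, ENNReal.mul_top (by simpa using hC)]
    exact le_top
  | coe t =>
    rcases eq_or_ne t 0 with rfl | ht0
    · simp [ENNReal.zero_rpow_of_pos hq]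
    have ht : (0 : ℝ) < t := by positivity
    set a := log (exp 1 + ‖x‖) with ha
    have h2t := one_le_log_exp_add ht.le
    have e1 : ((t : ℝ≥0∞)) ^ qexp n = ENNReal.ofReal ((t : ℝ) ^ qexp n) := by
      rw [← ENNReal.ofReal_coe_nnreal, ENNReal.ofReal_rpow_of_nonneg ht.le hq.le]
    have e2 : thetaE n x t = ENNReal.ofReal ((t : ℝ) / (a + log (exp 1 + t))) := by
      unfold thetaE
      rw [ENNReal.ofReal_div_of_pos (by positivity), ENNReal.ofReal_coe_nnreal, ENNReal.coe_toReal]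
    rw [e1, e2, ← ENNReal.ofReal_mul hC.le]
    obtain ⟨k₀, hk₀⟩ := exists_mem_Ico_zpow (show (0 : ℝ) < 4 * t by positivity) one_lt_two
    set T : ℝ := (t : ℝ) / (a + log (exp 1 + t)) with hT
    have hT0 : 0 < T := by positivity
    set E : ℝ := 2 * (1 + 2 / pexp n) * 5 ^ (pexp n / 2) with hE
    have hE0 : 0 < E := by positivity
    refine (tsum_int_le_geometric (k₀ := k₀) (D := E * 4 ^ (pexp n / 2) * T)
      (b := (1 / 2) ^ (pexp n / 2)) (by positivity) (by positivity) hb ?_ ?_).trans_eq ?_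
    · intro k hk
      rw [Set.indicator_of_notMem, zero_mul, mul_zero]
      rw [Set.mem_ofPred_eq, not_lt, ENNReal.le_div_iff_mul_le (by simp) (by simp),
        show (2 : ℝ≥0∞) = ENNReal.ofReal 2 by simp, ← ENNReal.ofReal_mul (by positivity)]
      refine ENNReal.ofReal_le_ofReal ?_
      have h4 : (4 : ℝ) * t ≤ 2 ^ k := hk₀.2.le.trans (zpow_le_zpow_right₀ one_le_two (by omega))
      refine le_trans ?_ (Real.rpow_le_rpow (by positivity) h4 hq.le)
      rw [Real.mul_rpow (by norm_num) ht.le, mul_comm]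
      gcongr
      calc (2 : ℝ) = 4 ^ (1 / 2 : ℝ) := by
            rw [show (4 : ℝ) = 2 ^ (2 : ℝ) by norm_num, ← Real.rpow_mul (by norm_num)]; norm_num
        _ ≤ _ := Real.rpow_le_rpow_of_exponent_le (by norm_num) hq2
    · intro m
      have hle : {h : ℝ≥0∞ | ENNReal.ofReal (((2 : ℝ) ^ (k₀ - m : ℤ)) ^ qexp n) / 2 < h}.indicator id
          (ENNReal.ofReal ((t : ℝ) ^ qexp n)) ≤ ENNReal.ofReal ((t : ℝ) ^ qexp n) :=
        Set.indicator_le_self' (fun _ _ => zero_le) _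
      have hbig : (2 : ℝ) ^ (k₀ - m : ℤ) ≤ 4 * t * (1 / 2) ^ m := by
        rw [zpow_sub₀ two_ne_zero, zpow_natCast, div_eq_mul_inv, one_div, inv_pow]
        gcongr
        exact hk₀.1
      rcases eq_or_lt_of_le (hbig.trans
        (mul_le_of_le_one_right (by positivity) (pow_le_one₀ (by norm_num) (by norm_num)))) with
        heq | hlt
      · rw [Set.indicator_of_notMem, zero_mul, mul_zero]
        · exact zero_le
        rw [Set.mem_ofPred_eq, not_lt, ENNReal.le_div_iff_mul_le (by simp) (by simp),
          show (2 : ℝ≥0∞) = ENNReal.ofReal 2 by simp, ← ENNReal.ofReal_mul (by positivity), heq]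
        refine ENNReal.ofReal_le_ofReal ?_
        rw [Real.mul_rpow (by norm_num) ht.le, mul_comm]
        gcongr
        calc (2 : ℝ) = 4 ^ (1 / 2 : ℝ) := by
              rw [show (4 : ℝ) = 2 ^ (2 : ℝ) by norm_num, ← Real.rpow_mul (by norm_num)]; norm_num
          _ ≤ _ := Real.rpow_le_rpow_of_exponent_le (by norm_num) hq2
      · set s : ℝ := 2 ^ (k₀ - m : ℤ) with hs
        have hs0 : 0 < s := by positivity
        refine (mul_le_mul_right (mul_le_mul_left hle _) _).trans ?_
        unfold logWt
        have h1s := one_le_log_exp_add hs0.le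
        rw [← ENNReal.ofReal_mul (by positivity), ← ENNReal.ofReal_mul (by positivity)]
        refine ENNReal.ofReal_le_ofReal ?_
        calc 2 * s ^ pexp n * ((t : ℝ) ^ qexp n * (1 / (a + log (exp 1 + s))))
            = 2 * s ^ pexp n * (t : ℝ) ^ (1 - pexp n) / (a + log (exp 1 + s)) := by
              unfold qexp; ring
          _ ≤ E * (s / t) ^ (pexp n / 2) * T := rpow_div_log_le hp hx hs0 ht hlt
          _ ≤ E * (4 * (1 / 2) ^ m) ^ (pexp n / 2) * T := by
              gcongr
              rw [div_le_iff₀ ht]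
              linarith
          _ = _ := by
              rw [Real.mul_rpow (by norm_num) (by positivity), ← Real.rpow_natCast,
                ← Real.rpow_natCast, ← Real.rpow_mul (by norm_num), ← Real.rpow_mul (by norm_num),
                mul_comm (m : ℝ)]
              ring
    · congr 1
      unfold modConst
      rw [← hE]
      ring

/-- The modular inequality for the level sets. -/
theorem exists_tsum_bigSet_le (hn : 1 ≤ n) (hφ : IsKer n φ M) :
    ∃ C : ℝ, 0 < C ∧ ∀ f : Eucl n → ℝ, LocallyIntegrable f volume →
      ∑' k : ℤ, ENNReal.ofReal (2 ^ k) *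
        ∫⁻ x in bigSet n φ f (2 ^ k), logWt n (log (exp 1 + 2 ^ k)) x ≤
      ENNReal.ofReal C * ∫⁻ x, thetaE n x (maxFun n φ f x) := by
  have hA := aone_pos n
  have hM := modConst_pos n
  refine ⟨aone n * modConst n, by positivity, fun f hf => ?_⟩
  have hm := measurable_maxPow hφ hf
  set I : ℤ → Eucl n → ℝ≥0∞ := fun k x =>
    {h : ℝ≥0∞ | ENNReal.ofReal (((2 : ℝ) ^ k) ^ qexp n) / 2 < h}.indicator id (maxPow n φ f x) *
        logWt n (log (exp 1 + 2 ^ k)) x with hI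
  have hIm : ∀ k, Measurable (I k) := fun k =>
    ((measurable_id.indicator measurableSet_Ioi).comp hm).mul (measurable_logWt _ _)
  have term : ∀ k : ℤ, ENNReal.ofReal (2 ^ k) *
        ∫⁻ x in bigSet n φ f (2 ^ k), logWt n (log (exp 1 + 2 ^ k)) x ≤
      ENNReal.ofReal (aone n) * ∫⁻ x, ENNReal.ofReal (2 * ((2 : ℝ) ^ k) ^ pexp n) * I k x := by
    intro k
    have h1 := half_mul_setLIntegral_bigMean_le (μ := ENNReal.ofReal (((2 : ℝ) ^ k) ^ qexp n))
      (A := ENNReal.ofReal (aone n)) (w := logWt n (log (exp 1 + 2 ^ k))) hn hm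
      (fun y r hr x hx => setLIntegral_logWt_le hn (one_le_log_exp_add (by positivity)) hr hx)
      ENNReal.ofReal_ne_top ENNReal.ofReal_ne_top
    have e : ENNReal.ofReal (2 ^ k) = ENNReal.ofReal (2 * ((2 : ℝ) ^ k) ^ pexp n) *
        (ENNReal.ofReal (((2 : ℝ) ^ k) ^ qexp n) / 2) := by
      rw [show (2 : ℝ≥0∞) = ENNReal.ofReal 2 by simp, ← ENNReal.ofReal_div_of_pos (by norm_num),
        ← ENNReal.ofReal_mul (by positivity)]
      congr 1
      have h2 : ((2 : ℝ) ^ k) ^ pexp n * ((2 : ℝ) ^ k) ^ qexp n = 2 ^ k := by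
        rw [← Real.rpow_add (by positivity)]; unfold qexp; simp
      linarith
    rw [e, mul_assoc]
    refine (mul_le_mul_right h1 _).trans_eq ?_
    rw [lintegral_const_mul _ (hIm k), mul_left_comm]
    rfl
  refine (ENNReal.tsum_le_tsum term).trans ?_
  rw [ENNReal.tsum_mul_left, ← lintegral_tsum (fun k => ((hIm k).const_mul _).aemeasurable),
    ENNReal.ofReal_mul hA.le, mul_assoc]
  rw [← lintegral_const_mul' (ENNReal.ofReal (modConst n)) _ ENNReal.ofReal_ne_top]
  exact mul_le_mul_right (lintegral_mono fun x => tsum_level_le_thetaE hn x _) _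

end

section

variable {n : ℕ} {Ω : Set (Eucl n)}

/-- Indices of dyadic lattice points. -/
abbrev WIdx (n : ℕ) := ℤ × (Fin n → ℤ)

/-- The scale of an index. -/
def side (i : WIdx n) : ℝ := 2 ^ i.1

/-- The lattice point of an index. -/
def cen (i : WIdx n) : Eucl n := WithLp.toLp 2 fun m => side i * i.2 m

theorem side_pos (i : WIdx n) : 0 < side i := by unfold side; positivity

/-- A piecewise linear cut-off between `1` and `2`. -/
def ramp (t : ℝ) : ℝ := max 0 (min 1 (t - 1))

theorem ramp_nonneg (t : ℝ) : 0 ≤ ramp t := le_max_left _ _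

theorem ramp_le_one (t : ℝ) : ramp t ≤ 1 := max_le zero_le_one (min_le_left _ _)

theorem ramp_mono {s t : ℝ} (h : s ≤ t) : ramp s ≤ ramp t := by
  unfold ramp; gcongr

theorem ramp_of_le {t : ℝ} (h : t ≤ 1) : ramp t = 0 :=
  max_eq_left ((min_le_right _ _).trans (by linarith))

theorem ramp_of_ge {t : ℝ} (h : 2 ≤ t) : ramp t = 1 := by
  unfold ramp
  rw [min_eq_left (by linarith), max_eq_right zero_le_one]

theorem abs_ramp_sub_le (s t : ℝ) : |ramp s - ramp t| ≤ |s - t| := by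
  unfold ramp
  refine (abs_max_sub_max_le_max _ _ _ _).trans ?_
  rw [sub_self, abs_zero]
  refine max_le (abs_nonneg _) ((abs_min_sub_min_le_max _ _ _ _).trans ?_)
  simp

/-- The radial part of the partition of unity, a function of the normalised distance. -/
def band (t : ℝ) : ℝ := ramp t - ramp (t / 2)

theorem band_nonneg {t : ℝ} (ht : 0 ≤ t) : 0 ≤ band t := sub_nonneg.2 (ramp_mono (by linarith))

theorem band_le_one (t : ℝ) : band t ≤ 1 := by
  unfold band; linarith [ramp_le_one t, ramp_nonneg (t / 2)]

theorem mem_of_band_ne_zero {t : ℝ} (h : band t ≠ 0) : 1 < t ∧ t < 4 := by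
  constructor
  · by_contra h1
    rw [not_lt] at h1
    refine h ?_
    unfold band
    by_cases ht : 0 ≤ t
    · rw [ramp_of_le h1, ramp_of_le (by linarith), sub_zero]
    · rw [ramp_of_le h1, ramp_of_le (by linarith), sub_zero]
  · by_contra h1
    rw [not_lt] at h1
    refine h ?_
    unfold band
    rw [ramp_of_ge (by linarith), ramp_of_ge (by linarith), sub_self]

theorem abs_band_sub_le (s t : ℝ) : |band s - band t| ≤ 2 * |s - t| := by
  have h1 := abs_ramp_sub_le s t
  have h2 := abs_ramp_sub_le (s / 2) (t / 2)
  have h3 : |s / 2 - t / 2| ≤ |s - t| := by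
    rw [← sub_div, abs_div, abs_two]
    linarith [abs_nonneg (s - t)]
  unfold band
  calc |ramp s - ramp (s / 2) - (ramp t - ramp (t / 2))|
      = |(ramp s - ramp t) - (ramp (s / 2) - ramp (t / 2))| := by ring_nf
    _ ≤ |ramp s - ramp t| + |ramp (s / 2) - ramp (t / 2)| := abs_sub _ _
    _ ≤ _ := by linarith

/-- The tent function. -/
def tent (t : ℝ) : ℝ := max 0 (1 - |t|)

theorem tent_nonneg (t : ℝ) : 0 ≤ tent t := le_max_left _ _

theorem tent_le_one (t : ℝ) : tent t ≤ 1 := max_le zero_le_one (by linarith [abs_nonneg t])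

theorem tent_eq_zero {t : ℝ} (h : 1 ≤ |t|) : tent t = 0 := max_eq_left (by linarith)

theorem abs_tent_sub_le (s t : ℝ) : |tent s - tent t| ≤ |s - t| := by
  unfold tent
  refine (abs_max_sub_max_le_max _ _ _ _).trans ?_
  rw [sub_self, abs_zero, sub_sub_sub_cancel_left, abs_sub_comm s]
  exact max_le (abs_nonneg _) (abs_abs_sub_abs_le _ _)

theorem tent_floor_add (s : ℝ) : tent (s - ⌊s⌋) + tent (s - (⌊s⌋ + 1 : ℤ)) = 1 := by
  have h1 := Int.floor_le s
  have h2 := Int.lt_floor_add_one s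
  unfold tent
  push_cast
  rw [abs_of_nonneg (by linarith), abs_of_nonpos (by linarith), max_eq_right (by linarith),
    max_eq_right (by linarith)]
  ring

theorem tent_eq_zero_of_notMem {s : ℝ} {z : ℤ} (hz : z ∉ ({⌊s⌋, ⌊s⌋ + 1} : Finset ℤ)) :
    tent (s - z) = 0 := by
  simp only [Finset.mem_insert, Finset.mem_singleton, not_or] at hz
  apply tent_eq_zero
  have h1 := Int.floor_le s
  have h2 := Int.lt_floor_add_one s
  rcases lt_or_gt_of_ne hz.1 with h | h
  · have : (z : ℝ) + 1 ≤ ⌊s⌋ := by exact_mod_cast h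
    rw [le_abs]; left; linarith
  · have h3 : ⌊s⌋ + 1 < z := lt_of_le_of_ne (by omega) (Ne.symm hz.2)
    have : (⌊s⌋ : ℝ) + 1 + 1 ≤ z := by exact_mod_cast h3
    rw [le_abs]; right; linarith

theorem abs_prod_sub_prod_le {ι : Type*} (s : Finset ι) (a b : ι → ℝ) (ha : ∀ i, |a i| ≤ 1)
    (hb : ∀ i, |b i| ≤ 1) : |∏ i ∈ s, a i - ∏ i ∈ s, b i| ≤ ∑ i ∈ s, |a i - b i| := by
  classical
  induction s using Finset.induction_on with
  | empty => simp
  | insert i s hi ih =>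
    rw [Finset.prod_insert hi, Finset.prod_insert hi, Finset.sum_insert hi]
    have h1 : |∏ j ∈ s, b j| ≤ 1 := by
      rw [Finset.abs_prod]
      exact Finset.prod_le_one (fun _ _ => abs_nonneg _) fun j _ => hb j
    calc |a i * ∏ j ∈ s, a j - b i * ∏ j ∈ s, b j|
        = |a i * (∏ j ∈ s, a j - ∏ j ∈ s, b j) + (a i - b i) * ∏ j ∈ s, b j| := by ring_nf
      _ ≤ |a i| * |∏ j ∈ s, a j - ∏ j ∈ s, b j| + |a i - b i| * |∏ j ∈ s, b j| := by
          rw [← abs_mul, ← abs_mul]; exact abs_add_le _ _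
      _ ≤ 1 * |∏ j ∈ s, a j - ∏ j ∈ s, b j| + |a i - b i| * 1 := by
          gcongr
          exact ha i
      _ ≤ _ := by linarith

/-- The Whitney partition of unity of `Ω`. -/
def whit (n : ℕ) (Ω : Set (Eucl n)) (i : WIdx n) (y : Eucl n) : ℝ :=
  band (infDist y Ωᶜ / (16 * n * side i)) * ∏ m, tent (y m / side i - i.2 m)

theorem whit_nonneg (i : WIdx n) (y : Eucl n) : 0 ≤ whit n Ω i y := by
  have := side_pos i
  exact mul_nonneg (band_nonneg (div_nonneg infDist_nonneg (by positivity)))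
    (Finset.prod_nonneg fun _ _ => tent_nonneg _)

theorem whit_le_one (i : WIdx n) (y : Eucl n) : whit n Ω i y ≤ 1 :=
  mul_le_one₀ (band_le_one _) (Finset.prod_nonneg fun _ _ => tent_nonneg _)
    (Finset.prod_le_one (fun _ _ => tent_nonneg _) fun _ _ => tent_le_one _)

theorem abs_coord_sub_le (y z : Eucl n) (m : Fin n) : |y m - z m| ≤ ‖y - z‖ := by
  simpa using PiLp.norm_apply_le (y - z) m

theorem abs_whit_sub_le (hn : 1 ≤ n) (i : WIdx n) (y z : Eucl n) :
    |whit n Ω i y - whit n Ω i z| ≤ (n + 2) / side i * ‖y - z‖ := by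
  have hs := side_pos i
  have hn' : (1 : ℝ) ≤ n := by exact_mod_cast hn
  unfold whit
  set p := band (infDist y Ωᶜ / (16 * n * side i))
  set q := band (infDist z Ωᶜ / (16 * n * side i))
  have hp : |p - q| ≤ 2 / side i * ‖y - z‖ := by
    refine (abs_band_sub_le _ _).trans ?_
    rw [← sub_div, abs_div, abs_of_pos (show 0 < 16 * n * side i by positivity)]
    have h1 : |infDist y Ωᶜ - infDist z Ωᶜ| ≤ ‖y - z‖ := by
      rw [← dist_eq_norm, ← Real.dist_eq]
      simpa using (lipschitz_infDist_pt Ωᶜ).dist_le_mul y z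
    calc 2 * (|infDist y Ωᶜ - infDist z Ωᶜ| / (16 * n * side i)) ≤ 2 * (‖y - z‖ / (1 * side i)) := by
          gcongr
          nlinarith
      _ = _ := by ring
  have hq : |q| ≤ 1 := abs_le.2 ⟨by
    have : 0 ≤ q := band_nonneg (div_nonneg infDist_nonneg (by positivity))
    linarith, band_le_one _⟩
  have ht : ∀ t, |tent t| ≤ 1 := fun t => by
    rw [abs_of_nonneg (tent_nonneg t)]; exact tent_le_one t
  have hP : |∏ m, tent (y m / side i - i.2 m)| ≤ 1 := by
    rw [Finset.abs_prod]
    exact Finset.prod_le_one (fun _ _ => abs_nonneg _) fun j _ => ht _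
  have hd : |∏ m, tent (y m / side i - i.2 m) - ∏ m, tent (z m / side i - i.2 m)| ≤
      n / side i * ‖y - z‖ := by
    refine (abs_prod_sub_prod_le _ _ _ (fun _ => ht _) (fun _ => ht _)).trans ?_
    refine (Finset.sum_le_sum (g := fun _ => 1 / side i * ‖y - z‖) fun m _ => ?_).trans_eq ?_
    · refine (abs_tent_sub_le _ _).trans ?_
      rw [sub_sub_sub_cancel_right, ← sub_div, abs_div, abs_of_pos hs, one_div, inv_mul_eq_div]
      gcongr
      exact abs_coord_sub_le _ _ _
    · simp; ring
  set P := ∏ m, tent (y m / side i - i.2 m)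
  set Q := ∏ m, tent (z m / side i - i.2 m)
  calc |p * P - q * Q| = |(p - q) * P + q * (P - Q)| := by ring_nf
    _ ≤ |p - q| * |P| + |q| * |P - Q| := by rw [← abs_mul, ← abs_mul]; exact abs_add_le _ _
    _ ≤ (2 / side i * ‖y - z‖) * 1 + 1 * (n / side i * ‖y - z‖) := by gcongr
    _ = _ := by ring

theorem norm_le_of_coord_le {v : Eucl n} {r : ℝ} (hr : 0 ≤ r) (h : ∀ m, |v m| ≤ r) :
    ‖v‖ ≤ n * r := by
  refine (EuclideanSpace.norm_eq v).trans_le ?_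
  rw [Real.sqrt_le_left (by positivity)]
  calc ∑ m, ‖v m‖ ^ 2 ≤ ∑ _m : Fin n, r ^ 2 := Finset.sum_le_sum fun m _ => by
        have := h m; simp only [Real.norm_eq_abs]; gcongr
    _ = n * r ^ 2 := by simp
    _ ≤ _ := by
        rw [mul_pow]
        gcongr
        rcases Nat.eq_zero_or_pos n with h0 | h0
        · simp [h0]
        · exact le_self_pow₀ (by exact_mod_cast h0) (by norm_num)

theorem whit_ne_zero (hn : 1 ≤ n) {i : WIdx n} {y : Eucl n} (h : whit n Ω i y ≠ 0) :
    ‖y - cen i‖ ≤ n * side i ∧ 16 * n * side i < infDist y Ωᶜ ∧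
      infDist y Ωᶜ < 64 * n * side i := by
  have hs := side_pos i
  have hn' : (1 : ℝ) ≤ n := by exact_mod_cast hn
  obtain ⟨h1, h2⟩ := mul_ne_zero_iff.1 h
  obtain ⟨h3, h4⟩ := mem_of_band_ne_zero h1
  rw [one_lt_div (by positivity)] at h3
  rw [div_lt_iff₀ (by positivity)] at h4
  refine ⟨norm_le_of_coord_le hs.le fun m => ?_, h3, by linarith⟩
  have h5 := Finset.prod_ne_zero_iff.1 h2 m (Finset.mem_univ _)
  have h6 : |y m / side i - i.2 m| < 1 := by
    by_contra h7
    exact h5 (tent_eq_zero (not_lt.1 h7))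
  have h8 : (y - cen i) m = (y m / side i - i.2 m) * side i := by
    simp only [cen, PiLp.sub_apply]
    field_simp
  rw [h8, abs_mul, abs_of_pos hs]
  nlinarith

theorem whit_eq_zero {y : Eucl n} (hy : y ∉ Ω) (i : WIdx n) : whit n Ω i y = 0 := by
  unfold whit
  rw [infDist_zero_of_mem (by exact hy), zero_div]
  simp [band, ramp]

theorem isBump_whit (hn : 1 ≤ n) (i : WIdx n) :
    IsBump n (cen i) (n * side i) 1 ((n + 2) / side i) (whit n Ω i) where
  bound y := by rw [abs_of_nonneg (whit_nonneg i y)]; exact whit_le_one i y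
  lip y z := abs_whit_sub_le hn i y z
  supp y hy := by
    by_contra h
    exact hy.not_ge (whit_ne_zero hn h).1

theorem infDist_compl_pos (ho : IsOpen Ω) (hne : Ωᶜ.Nonempty) {y : Eucl n} (hy : y ∈ Ω) :
    0 < infDist y Ωᶜ :=
  (ho.isClosed_compl.notMem_iff_infDist_pos hne).1 (by simpa using hy)

theorem mem_of_infDist_pos {y : Eucl n} (h : 0 < infDist y Ωᶜ) : y ∈ Ω := by
  by_contra hy
  rw [infDist_zero_of_mem (by exact hy)] at h
  exact lt_irrefl _ h

/-- The Whitney functions form a partition of unity on `Ω`. -/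
theorem hasSum_whit (hn : 1 ≤ n) (ho : IsOpen Ω) (hne : Ωᶜ.Nonempty) {y : Eucl n} (hy : y ∈ Ω) :
    HasSum (fun i => whit n Ω i y) 1 := by
  classical
  have hρ := infDist_compl_pos ho hne hy
  have hn' : (1 : ℝ) ≤ n := by exact_mod_cast hn
  set ρ := infDist y Ωᶜ with hρd
  obtain ⟨j₀, hj₀⟩ := exists_mem_Ico_zpow (show 0 < ρ / (16 * n) by positivity) one_lt_two
  set J : Finset ℤ := {j₀ - 1, j₀} with hJ
  set t : ℤ → Fin n → Finset ℤ := fun j m => {⌊y m / 2 ^ j⌋, ⌊y m / 2 ^ j⌋ + 1} with ht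
  set T : Finset (WIdx n) := (J ×ˢ J.biUnion fun j => Fintype.piFinset (t j)).filter
    fun i => i.2 ∈ Fintype.piFinset (t i.1) with hT
  have hTm : ∀ i : WIdx n, i ∈ T ↔ i.1 ∈ J ∧ i.2 ∈ Fintype.piFinset (t i.1) := by
    intro i
    simp only [hT, Finset.mem_filter, Finset.mem_product, Finset.mem_biUnion]
    exact ⟨fun h => ⟨h.1.1, h.2⟩, fun h => ⟨⟨h.1, i.1, h.1, h.2⟩, h.2⟩⟩
  set τ := ρ / (16 * n) / 2 ^ j₀ with hτ
  have hτ1 : 1 ≤ τ := by rw [hτ, one_le_div (by positivity)]; exact hj₀.1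
  have hτ2 : τ < 2 := by
    rw [hτ, div_lt_iff₀ (by positivity), ← zpow_one_add₀ two_ne_zero, add_comm]; exact hj₀.2
  have hband : ∀ j : ℤ, ρ / (16 * n * 2 ^ j) = τ * 2 ^ (j₀ - j) := by
    intro j
    rw [hτ, zpow_sub₀ two_ne_zero]
    field_simp
  have hz : ∀ i ∉ T, whit n Ω i y = 0 := by
    intro i hi
    rw [hTm, not_and_or] at hi
    unfold whit
    rcases hi with hi | hi
    · have : band (ρ / (16 * n * side i)) = 0 := by
        by_contra hb
        obtain ⟨h1, h2⟩ := mem_of_band_ne_zero hb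
        rw [side, hband] at h1 h2
        refine hi ?_
        have h3 : j₀ - i.1 < 2 := by
          by_contra h4
          have : (2 : ℝ) ^ (2 : ℤ) ≤ 2 ^ (j₀ - i.1) := zpow_le_zpow_right₀ one_le_two (not_lt.1 h4)
          norm_num at this
          nlinarith
        have h4 : -1 < j₀ - i.1 := by
          by_contra h4
          have : (2 : ℝ) ^ (j₀ - i.1) ≤ 2 ^ (-1 : ℤ) := zpow_le_zpow_right₀ one_le_two (not_lt.1 h4)
          have h5 : (0 : ℝ) < 2 ^ (j₀ - i.1) := by positivity
          rw [zpow_neg_one] at this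
          nlinarith
        rw [hJ, Finset.mem_insert, Finset.mem_singleton]
        omega
      rw [this, zero_mul]
    · rw [Fintype.mem_piFinset, not_forall] at hi
      obtain ⟨m, hm⟩ := hi
      rw [Finset.prod_eq_zero (Finset.mem_univ m), mul_zero]
      exact tent_eq_zero_of_notMem hm
  have hsum : ∑ i ∈ T, whit n Ω i y = 1 := by
    have h1 : ∑ i ∈ T, whit n Ω i y =
        ∑ j ∈ J, ∑ z ∈ Fintype.piFinset (t j), whit n Ω (j, z) y :=
      Finset.sum_finset_product' (f := fun j z => whit n Ω (j, z) y) T J _ hTm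
    have h2 : ∀ j, ∑ z ∈ Fintype.piFinset (t j), whit n Ω (j, z) y = band (τ * 2 ^ (j₀ - j)) := by
      intro j
      simp only [whit, side]
      rw [← Finset.mul_sum, ← hρd, hband,
        ← Finset.prod_univ_sum (t j) (fun m z => tent (y m / 2 ^ j - z))]
      rw [Finset.prod_eq_one, mul_one]
      intro m _
      rw [ht]
      beta_reduce
      rw [Finset.sum_pair (by simp)]
      exact tent_floor_add _
    rw [h1, hJ, Finset.sum_pair (by simp), h2, h2, sub_sub_cancel, sub_self, zpow_one, zpow_zero,
      mul_one]
    unfold band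
    rw [ramp_of_ge (by linarith), mul_div_cancel_right₀ _ (two_ne_zero), ramp_of_le (t := τ / 2) (by linarith)]
    ring
  rw [← hsum]
  exact hasSum_sum_of_ne_finset_zero hz

/-- Indices of non-trivial Whitney functions. -/
def Active (n : ℕ) (Ω : Set (Eucl n)) (i : WIdx n) : Prop := ∃ y, whit n Ω i y ≠ 0

theorem whit_eq_zero_of_not_active {i : WIdx n} (h : ¬ Active n Ω i) (y : Eucl n) :
    whit n Ω i y = 0 := by
  by_contra hy; exact h ⟨y, hy⟩

theorem Active.infDist (hn : 1 ≤ n) {i : WIdx n} (h : Active n Ω i) {y : Eucl n}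
    (hy : ‖y - cen i‖ < 7 * n * side i) :
    8 * n * side i < infDist y Ωᶜ ∧ infDist y Ωᶜ < 72 * n * side i := by
  obtain ⟨z, hz⟩ := h
  obtain ⟨h1, h2, h3⟩ := whit_ne_zero hn hz
  have h4 : |Metric.infDist y Ωᶜ - Metric.infDist z Ωᶜ| ≤ ‖y - z‖ := by
    rw [← dist_eq_norm, ← Real.dist_eq]
    simpa using (lipschitz_infDist_pt Ωᶜ).dist_le_mul y z
  have h5 : ‖y - z‖ ≤ ‖y - cen i‖ + ‖z - cen i‖ := by
    rw [norm_sub_rev z]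
    exact norm_sub_le_norm_sub_add_norm_sub _ _ _
  rw [abs_le] at h4
  constructor <;> linarith

theorem Active.mem (hn : 1 ≤ n) {i : WIdx n} (h : Active n Ω i) {y : Eucl n}
    (hy : ‖y - cen i‖ < 7 * n * side i) : y ∈ Ω := by
  have := side_pos i
  refine mem_of_infDist_pos (lt_of_le_of_lt ?_ (h.infDist hn hy).1)
  positivity

/-- Overlap number of the enlarged Whitney balls. -/
def overlap (n : ℕ) : ℕ := 4 * (14 * n + 1) ^ n

theorem exists_finset_active (hn : 1 ≤ n) (y : Eucl n) :
    ∃ S : Finset (WIdx n), S.card ≤ overlap n ∧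
      ∀ i, Active n Ω i → ‖y - cen i‖ < 7 * n * side i → i ∈ S := by
  classical
  by_cases hρ : 0 < infDist y Ωᶜ
  swap
  · refine ⟨∅, by simp, fun i hi h => absurd ?_ hρ⟩
    have := side_pos i
    exact lt_of_le_of_lt (by positivity) (hi.infDist hn h).1
  have hn' : (1 : ℝ) ≤ n := by exact_mod_cast hn
  obtain ⟨j₀, hj₀⟩ := exists_mem_Ico_zpow (show 0 < infDist y Ωᶜ / (72 * n) by positivity) one_lt_two
  set Z : ℤ → Finset (Fin n → ℤ) := fun j => Fintype.piFinset fun m =>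
    Finset.Icc ⌈y m / 2 ^ j - 7 * n⌉ ⌊y m / 2 ^ j + 7 * n⌋ with hZ
  refine ⟨(Finset.Icc (j₀ + 1) (j₀ + 4)).biUnion fun j => (Z j).image fun z => (j, z), ?_, ?_⟩
  · refine (Finset.card_biUnion_le_card_mul _ _ ((14 * n + 1) ^ n) fun j _ => ?_).trans_eq ?_
    · refine Finset.card_image_le.trans ?_
      rw [hZ, Fintype.card_piFinset]
      refine (Finset.prod_le_pow_card _ _ (14 * n + 1) fun m _ => ?_).trans_eq (by simp)
      rw [Int.card_Icc]
      have h1 := Int.le_ceil (y m / 2 ^ j - 7 * n)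
      have h2 := Int.floor_le (y m / 2 ^ j + 7 * n)
      have h3 : (⌊y m / 2 ^ j + 7 * n⌋ : ℝ) ≤ ⌈y m / 2 ^ j - 7 * n⌉ + 14 * n := by linarith
      have h4 : ⌊y m / 2 ^ j + 7 * n⌋ ≤ ⌈y m / 2 ^ j - 7 * n⌉ + 14 * n := by exact_mod_cast h3
      omega
    · simp [overlap]
  · intro i hi h
    obtain ⟨h1, h2⟩ := hi.infDist hn h
    have hs := side_pos i
    simp only [Finset.mem_biUnion, Finset.mem_image]
    refine ⟨i.1, ?_, i.2, ?_, rfl⟩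
    · obtain ⟨h3, h4⟩ := hj₀
      rw [le_div_iff₀ (by positivity)] at h3
      rw [div_lt_iff₀ (by positivity)] at h4
      have h5 : (2 : ℝ) ^ j₀ < 2 ^ i.1 := by
        have h6 : (2 : ℝ) ^ j₀ * (72 * n) < side i * (72 * n) := by linarith
        exact lt_of_mul_lt_mul_right h6 (by positivity)
      have h6 : (2 : ℝ) ^ i.1 < 2 ^ (j₀ + 5) := by
        have h7 : side i * (8 * n) < (2 ^ (j₀ + 1) * 9) * (8 * n) := by linarith
        have h8 : side i < 2 ^ (j₀ + 1) * 9 := lt_of_mul_lt_mul_right h7 (by positivity)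
        refine h8.trans ?_
        rw [show j₀ + 5 = (j₀ + 1) + 4 by ring, zpow_add₀ two_ne_zero (j₀ + 1) 4]
        have : (0 : ℝ) < 2 ^ (j₀ + 1) := by positivity
        gcongr
        norm_num
      rw [zpow_lt_zpow_iff_right₀ one_lt_two] at h5 h6
      rw [Finset.mem_Icc]; omega
    · rw [hZ, Fintype.mem_piFinset]
      intro m
      have h3 := (abs_coord_sub_le y (cen i) m).trans h.le
      have h4 : y m - cen i m = (y m / side i - i.2 m) * side i := by
        simp only [cen]; field_simp
      rw [h4, abs_mul, abs_of_pos hs] at h3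
      have h5 := abs_le.1 (le_of_mul_le_mul_right h3 hs)
      rw [Finset.mem_Icc, Int.ceil_le, Int.le_floor]
      change y m / side i - 7 * n ≤ _ ∧ _ ≤ y m / side i + 7 * n
      constructor <;> linarith

end

section

variable {n : ℕ} {φ f : Eucl n → ℝ} {M : ℝ}

theorem abs_cv_sub_le (hφ : IsKer n φ M) (hf : LocallyIntegrable f volume) {t : ℝ} (ht : 0 < t)
    (x : Eucl n) :
    |cv n φ f t x - f x| ≤ M * ubv n * ⨍ y in closedBall x t, ‖f y - f x‖ := by
  have hu := ubv_pos n
  have hM := hφ.nonneg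
  have hb := dil_bump hφ ht x
  have h1 : Integrable (fun y => f y * dil n φ t (x - y)) := integrable_mul_bump hf hb
  have h2 : Integrable (fun y => f x * dil n φ t (x - y)) :=
    ((hφ.dil_integrable ht).comp_sub_left x).const_mul _
  have hi : IntegrableOn (fun y => f y - f x) (closedBall x t) :=
    (hf.integrableOn_isCompact (isCompact_closedBall x t)).sub
      (integrableOn_const (measure_closedBall_lt_top.ne))
  have e : cv n φ f t x - f x = ∫ y, (f y - f x) * dil n φ t (x - y) := by
    have h3 : ∫ y, f x * dil n φ t (x - y) = f x := by
      rw [integral_const_mul, integral_sub_left_eq_self (fun y => dil n φ t y) volume x,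
        hφ.integral_dil ht, mul_one]
    unfold cv
    conv_lhs => rw [← h3]
    rw [← integral_sub h1 h2]
    congr 1
    ext y
    ring
  have hsupp : ∀ y, y ∉ closedBall x t → (f y - f x) * dil n φ t (x - y) = 0 := fun y hy => by
    have : t < ‖y - x‖ := by simpa [dist_eq_norm] using hy
    rw [hb.supp y this, mul_zero]
  rw [e, ← setIntegral_eq_integral_of_forall_compl_eq_zero hsupp, setAverage_eq, smul_eq_mul,
    ← Real.norm_eq_abs]
  have hv : volume.real (closedBall x t) = t ^ n * ubv n := by
    rw [← volume_real_ball x ht, Measure.real, Measure.real, Measure.addHaar_closedBall _ _ ht.le,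
      Measure.addHaar_ball_of_pos _ _ ht]
  calc ‖∫ y in closedBall x t, (f y - f x) * dil n φ t (x - y)‖
      ≤ ∫ y in closedBall x t, ‖f y - f x‖ * (M * (t ^ n)⁻¹) := by
        refine norm_integral_le_of_norm_le (hi.norm.mul_const _) (Eventually.of_forall fun y => ?_)
        rw [norm_mul]
        gcongr
        exact hφ.dil_bound ht _
    _ = _ := by
        rw [integral_mul_const, hv]
        field_simp

theorem ae_ofReal_abs_le_maxFun (hφ : IsKer n φ M) (hf : LocallyIntegrable f volume) :
    ∀ᵐ x, ENNReal.ofReal |f x| ≤ maxFun n φ f x := by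
  filter_upwards [(Besicovitch.vitaliFamily (volume : Measure (Eucl n))).ae_tendsto_average_norm_sub
    hf] with x hx
  have h1 := (hx.comp (Besicovitch.tendsto_filterAt volume x)).const_mul (M * ubv n)
  rw [mul_zero] at h1
  have h2 : Tendsto (fun t => cv n φ f t x) (𝓝[>] 0) (𝓝 (f x)) := by
    rw [tendsto_iff_norm_sub_tendsto_zero]
    refine squeeze_zero' (Eventually.of_forall fun _ => norm_nonneg _) ?_ h1
    filter_upwards [self_mem_nhdsWithin] with t ht
    exact abs_cv_sub_le hφ hf ht x
  refine le_of_tendsto (ENNReal.tendsto_ofReal h2.abs) ?_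
  filter_upwards [self_mem_nhdsWithin] with t ht
  exact le_maxFun ht x

/-- Measurable locally integrable functions everywhere dominated by their maximal function. -/
structure IsGood (n : ℕ) (φ f : Eucl n → ℝ) : Prop where
  loc : LocallyIntegrable f volume
  meas : Measurable f
  le : ∀ x, ENNReal.ofReal |f x| ≤ maxFun n φ f x

theorem maxFun_congr_ae {g : Eucl n → ℝ} (h : f =ᵐ[volume] g) : maxFun n φ f = maxFun n φ g := by
  ext x
  unfold maxFun
  have : ∀ t, ∫ y, f y * dil n φ t (x - y) = ∫ y, g y * dil n φ t (x - y) := fun t =>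
    integral_congr_ae (h.mono fun y hy => by beta_reduce; rw [hy])
  simp only [this]

theorem exists_isGood (hφ : IsKer n φ M) (hf : LocallyIntegrable f volume) :
    ∃ g, IsGood n φ g ∧ f =ᵐ[volume] g := by
  have hm := hf.aestronglyMeasurable
  set f₁ := hm.mk f with hf₁
  have hf₁m : Measurable f₁ := hm.stronglyMeasurable_mk.measurable
  have h1 : f =ᵐ[volume] f₁ := hm.ae_eq_mk
  set S := {x | ENNReal.ofReal |f₁ x| ≤ maxFun n φ f x} with hS
  have hSm : MeasurableSet S :=
    measurableSet_le (hf₁m.abs.ennreal_ofReal) (measurable_maxFun hφ hf)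
  have h2 : ∀ᵐ x, x ∈ S := by
    filter_upwards [h1, ae_ofReal_abs_le_maxFun hφ hf] with x hx hx'
    change ENNReal.ofReal |f₁ x| ≤ maxFun n φ f x
    rwa [← hx]
  have h3 : f =ᵐ[volume] S.indicator f₁ := by
    filter_upwards [h1, h2] with x hx hx'
    rw [Set.indicator_of_mem hx', hx]
  refine ⟨S.indicator f₁, ⟨hf.congr h3, hf₁m.indicator hSm, fun x => ?_⟩, h3⟩
  rw [← maxFun_congr_ae h3]
  by_cases hx : x ∈ S
  · rw [Set.indicator_of_mem hx]; exact hx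
  · simp [Set.indicator_of_notMem hx]

/-- Bounds for the pairing of `f` with bumps touching the complement of a level set. -/
def LevelBound (n : ℕ) (φ f : Eucl n → ℝ) (C : ℝ) : Prop :=
  ∀ (lam : ℝ) (x₀ y : Eucl n) (r K : ℝ) (Θ : Eucl n → ℝ), 0 < lam → 0 < r → 0 ≤ K →
    y ∉ bigSet n φ f lam → ‖y - x₀‖ < 4 * r → IsBump n x₀ r (K * r) K Θ →
      |∫ x, f x * Θ x| ≤ C * (K * r ^ (n + 1) * lam)

theorem exists_levelBound (hn : 1 ≤ n) (hφ : IsKer n φ M) :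
    ∃ C : ℝ, 0 < C ∧ ∀ f : Eucl n → ℝ, LocallyIntegrable f volume → LevelBound n φ f C := by
  have hu := ubv_pos n
  obtain ⟨C, hC, h⟩ := exists_abs_integral_bump_le hn hφ (B := 4 ^ n * ubv n) (by positivity)
  refine ⟨C, hC, fun f hf lam x₀ y r K Θ hlam hr hK hy hyr hΘ => h f hf x₀ r K lam Θ hr hK hlam hΘ ?_⟩
  by_contra hlt
  refine hy ⟨x₀, 4 * r, by positivity, by simpa [dist_eq_norm] using hyr, ?_⟩
  refine lt_of_le_of_lt (le_of_eq ?_) (not_le.1 hlt)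
  rw [volume_ball_eq _ (by positivity), ← ENNReal.ofReal_mul (by positivity), mul_pow]
  congr 1
  ring

theorem LevelBound.maxFun_le (hφ : IsKer n φ M) {C lam : ℝ} (h : LevelBound n φ f C)
    (hlam : 0 < lam) {y : Eucl n} (hy : y ∉ bigSet n φ f lam) :
    maxFun n φ f y ≤ ENNReal.ofReal (C * M * lam) := by
  have hM := hφ.nonneg
  refine iSup₂_le fun t ht => ENNReal.ofReal_le_ofReal ?_
  refine (h lam y y t _ _ hlam ht (by positivity) hy (by simpa using ht)
    (dil_bump hφ ht y)).trans_eq ?_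
  field_simp

theorem LevelBound.abs_le (hφ : IsKer n φ M) {C lam : ℝ} (hC : 0 < C) (h : LevelBound n φ f C)
    (hf : IsGood n φ f) (hlam : 0 < lam) {y : Eucl n} (hy : y ∉ bigSet n φ f lam) :
    |f y| ≤ C * M * lam := by
  have hM := hφ.nonneg
  have := (hf.le y).trans (h.maxFun_le hφ hlam hy)
  rwa [ENNReal.ofReal_le_ofReal_iff (by positivity)] at this

theorem exists_notMem_near {Ω : Set (Eucl n)} (hn : 1 ≤ n) (hne : Ωᶜ.Nonempty) {i : WIdx n} (h : Active n Ω i) :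
    ∃ y, y ∉ Ω ∧ ‖y - cen i‖ < 4 * (20 * n * side i) := by
  have hs := side_pos i
  have hn' : (1 : ℝ) ≤ n := by exact_mod_cast hn
  have h1 := (h.infDist hn (y := cen i) (by rw [sub_self, norm_zero]; positivity)).2
  obtain ⟨y, hy, hd⟩ := (infDist_lt_iff hne).1 h1
  refine ⟨y, hy, ?_⟩
  rw [← dist_eq_norm, dist_comm]
  nlinarith

theorem LevelBound.abs_integral_bump_le {C lam L : ℝ} (hn : 1 ≤ n)
    (h : LevelBound n φ f C) (hlam : 0 < lam) (hne : (bigSet n φ f lam)ᶜ.Nonempty) {i : WIdx n}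
    (hi : Active n (bigSet n φ f lam) i) {Θ : Eucl n → ℝ} (hL : 1 ≤ L)
    (hΘ : IsBump n (cen i) (n * side i) 1 (L / side i) Θ) :
    |∫ x, f x * Θ x| ≤ C * (L * (20 * n) ^ (n + 1)) * lam * side i ^ n := by
  have hs := side_pos i
  have hn' : (1 : ℝ) ≤ n := by exact_mod_cast hn
  obtain ⟨y, hy, hd⟩ := exists_notMem_near hn hne hi
  refine (h lam (cen i) y (20 * n * side i) (L / side i) Θ hlam (by positivity) (by positivity)
    hy hd (hΘ.mono ?_ ?_ le_rfl)).trans_eq ?_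
  · nlinarith
  · rw [show L / side i * (20 * n * side i) = L * (20 * n) by field_simp]
    nlinarith
  · rw [mul_pow]
    field_simp
    ring

theorem side_lt_of_ne_zero {Ω Ω' : Set (Eucl n)} (hn : 1 ≤ n) (hsub : Ω' ⊆ Ω)
    (hne : Ωᶜ.Nonempty) {i l : WIdx n} {y : Eucl n} (hi : whit n Ω i y ≠ 0) (hl : whit n Ω' l y ≠ 0) :
    side l < 4 * side i := by
  have hn' : (1 : ℝ) ≤ n := by exact_mod_cast hn
  have h1 := (whit_ne_zero hn hi).2.2
  have h2 := (whit_ne_zero hn hl).2.1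
  have h3 : infDist y Ω'ᶜ ≤ infDist y Ωᶜ := infDist_le_infDist_of_subset (Set.compl_subset_compl.2 hsub) hne
  have h4 : side l * (16 * n) < 4 * side i * (16 * n) := by linarith
  exact lt_of_mul_lt_mul_right h4 (by positivity)

theorem isBump_whit_mul {Ω Ω' : Set (Eucl n)} (hn : 1 ≤ n) {i l : WIdx n} (h : side l < 4 * side i) :
    IsBump n (cen l) (n * side l) 1 (5 * (n + 2) / side l)
      (fun x => whit n Ω i x * whit n Ω' l x) where
  bound y := by
    rw [abs_mul, abs_of_nonneg (whit_nonneg i y), abs_of_nonneg (whit_nonneg l y)]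
    exact mul_le_one₀ (whit_le_one i y) (whit_nonneg l y) (whit_le_one l y)
  lip y z := by
    have hs := side_pos i
    have hsl := side_pos l
    have h1 := abs_whit_sub_le (Ω := Ω) hn i y z
    have h2 := abs_whit_sub_le (Ω := Ω') hn l y z
    have h3 : |whit n Ω' l y| ≤ 1 := by rw [abs_of_nonneg (whit_nonneg l y)]; exact whit_le_one l y
    have h4 : |whit n Ω i z| ≤ 1 := by rw [abs_of_nonneg (whit_nonneg i z)]; exact whit_le_one i z
    have h5 : ((n : ℝ) + 2) / side i ≤ 4 * (n + 2) / side l := by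
      rw [div_le_div_iff₀ hs hsl]
      nlinarith [(Nat.cast_nonneg n : (0:ℝ) ≤ n)]
    beta_reduce
    calc |whit n Ω i y * whit n Ω' l y - whit n Ω i z * whit n Ω' l z|
        = |(whit n Ω i y - whit n Ω i z) * whit n Ω' l y +
            whit n Ω i z * (whit n Ω' l y - whit n Ω' l z)| := by ring_nf
      _ ≤ |whit n Ω i y - whit n Ω i z| * |whit n Ω' l y| +
            |whit n Ω i z| * |whit n Ω' l y - whit n Ω' l z| := by
          rw [← abs_mul, ← abs_mul]; exact abs_add_le _ _
      _ ≤ (4 * (n + 2) / side l * ‖y - z‖) * 1 + 1 * ((n + 2) / side l * ‖y - z‖) := by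
          gcongr
          exact h1.trans (by gcongr)
      _ = _ := by ring
  supp y hy := by rw [(isBump_whit hn l).supp y hy, mul_zero]

/-- Size and cancellation data for a pair of consecutive level sets. -/
structure IsLevelPair (n : ℕ) (f : Eucl n → ℝ) (Ω Ω' : Set (Eucl n)) (c : ℝ) : Prop where
  loc : LocallyIntegrable f volume
  meas : Measurable f
  isOpen_left : IsOpen Ω
  isOpen_right : IsOpen Ω'
  subset : Ω' ⊆ Ω
  nonempty : Ωᶜ.Nonempty
  nonneg : 0 ≤ c
  bound : ∀ x ∉ Ω', |f x| ≤ c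
  coeff : ∀ i, |∫ x, f x * whit n Ω i x| ≤ c * side i ^ n
  coeff_mul : ∀ i l, |∫ x, f x * (whit n Ω i x * whit n Ω' l x)| ≤ c * side l ^ n

theorem LevelBound.isLevelPair (hn : 1 ≤ n) (hφ : IsKer n φ M) {C : ℝ} (hC : 0 < C)
    (h : LevelBound n φ f C) (hf : IsGood n φ f) {lam : ℝ} (hlam : 0 < lam)
    (hne : (bigSet n φ f lam)ᶜ.Nonempty) :
    IsLevelPair n f (bigSet n φ f lam) (bigSet n φ f (2 * lam))
      (2 * C * (M + 5 * (n + 2) * (20 * n) ^ (n + 1)) * lam) := by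
  have hM := hφ.nonneg
  have hn' : (1 : ℝ) ≤ n := by exact_mod_cast hn
  have hq := qexp_pos hn
  have hsub : bigSet n φ f (2 * lam) ⊆ bigSet n φ f lam :=
    bigMean_anti _ (ENNReal.ofReal_le_ofReal (Real.rpow_le_rpow hlam.le (by linarith) hq.le))
  have hne' : (bigSet n φ f (2 * lam))ᶜ.Nonempty := hne.mono (Set.compl_subset_compl.2 hsub)
  have hnn : 0 ≤ 2 * C * (M + 5 * (n + 2) * (20 * n) ^ (n + 1)) * lam := by positivity
  refine ⟨hf.loc, hf.meas, isOpen_bigMean _ _, isOpen_bigMean _ _, hsub, hne, hnn, ?_, ?_, ?_⟩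
  · intro x hx
    refine (h.abs_le hφ hC hf (by positivity) hx).trans ?_
    have : 0 ≤ 2 * C * (5 * (n + 2) * (20 * n) ^ (n + 1)) * lam := by positivity
    linarith
  · intro i
    have hs := side_pos i
    by_cases hi : Active n (bigSet n φ f lam) i
    · refine (h.abs_integral_bump_le hn hlam hne hi (by linarith) (isBump_whit hn i)).trans ?_
      refine mul_le_mul_of_nonneg_right ?_ (by positivity)
      have h0 : (0 : ℝ) ≤ 20 * n := by positivity
      have h1 : ((n : ℝ) + 2) * (20 * n) ^ (n + 1) ≤ 5 * (n + 2) * (20 * n) ^ (n + 1) := by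
        gcongr; linarith
      have h2 : 0 ≤ C * (((n : ℝ) + 2) * (20 * n) ^ (n + 1)) := by positivity
      have h3 := mul_le_mul_of_nonneg_left h1 hC.le
      have h4 : 0 ≤ C * M := by positivity
      refine mul_le_mul_of_nonneg_right ?_ hlam.le
      linarith
    · simp only [whit_eq_zero_of_not_active hi, mul_zero, integral_zero, abs_zero]
      positivity
  · intro i l
    have hs := side_pos l
    by_cases hil : ∃ x, whit n (bigSet n φ f lam) i x * whit n (bigSet n φ f (2 * lam)) l x ≠ 0
    · obtain ⟨x, hx⟩ := hil
      obtain ⟨hx1, hx2⟩ := mul_ne_zero_iff.1 hx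
      have hlt := side_lt_of_ne_zero hn hsub hne hx1 hx2
      refine (h.abs_integral_bump_le (L := 5 * (n + 2)) hn (by positivity) hne' ⟨x, hx2⟩ (by linarith)
        (isBump_whit_mul hn hlt)).trans ?_
      refine mul_le_mul_of_nonneg_right ?_ (by positivity)
      have : 0 ≤ C * M * lam := by positivity
      linarith
    · push Not at hil
      simp only [hil, mul_zero, integral_zero, abs_zero]
      positivity

end

section

variable {n : ℕ} {f g ψ : Eucl n → ℝ} {Ω Ω' : Set (Eucl n)} {c R : ℝ}

/-- The normalised indicator of the ball attached to an index. -/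
def whitAvg (n : ℕ) (i : WIdx n) : Eucl n → ℝ := ballAvg n (cen i) (side i)

theorem whitAvg_nonneg (i : WIdx n) (x : Eucl n) : 0 ≤ whitAvg n i x :=
  ballAvg_nonneg _ (side_pos i) x

theorem abs_whitAvg_le (i : WIdx n) (x : Eucl n) : |whitAvg n i x| ≤ (side i ^ n * ubv n)⁻¹ := by
  rw [abs_of_nonneg (whitAvg_nonneg i x)]
  exact ballAvg_le _ (side_pos i) x

theorem norm_sub_lt_of_whitAvg_ne_zero {i : WIdx n} {x : Eucl n} (h : whitAvg n i x ≠ 0) :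
    ‖x - cen i‖ < side i := by
  by_contra hx
  exact h (ballAvg_eq_zero (not_lt.1 hx))

theorem measurable_whit (hn : 1 ≤ n) (i : WIdx n) : Measurable (whit n Ω i) :=
  (isBump_whit hn i).continuous.measurable

/-- The mean of a test function over the ball attached to an index. -/
def whitMean (n : ℕ) (ψ : Eucl n → ℝ) (i : WIdx n) : ℝ := ∫ x, whitAvg n i x * ψ x

theorem integrable_whitAvg_mul (hm : Measurable ψ) (hψ : ∀ x, |ψ x| ≤ R) (i : WIdx n) :
    Integrable (fun x => whitAvg n i x * ψ x) :=
  (integrable_ballAvg (cen i) (side_pos i)).mul_bdd (c := R) hm.aestronglyMeasurable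
    (Eventually.of_forall hψ)

theorem integral_norm_whitAvg_mul_le (hm : Measurable ψ) (hψ : ∀ x, |ψ x| ≤ R) (i : WIdx n) :
    ∫ x, ‖whitAvg n i x * ψ x‖ ≤ R := by
  calc ∫ x, ‖whitAvg n i x * ψ x‖ ≤ ∫ x, whitAvg n i x * R := by
        refine integral_mono (integrable_whitAvg_mul hm hψ i).norm
          ((integrable_ballAvg (cen i) (side_pos i)).mul_const R) fun x => ?_
        beta_reduce
        rw [norm_mul, Real.norm_of_nonneg (whitAvg_nonneg i x)]
        exact mul_le_mul_of_nonneg_left (hψ x) (whitAvg_nonneg i x)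
    _ = R := by
        rw [integral_mul_const]
        unfold whitAvg
        rw [integral_ballAvg (cen i) (side_pos i), one_mul]

theorem abs_whitMean_le (hm : Measurable ψ) (hψ : ∀ x, |ψ x| ≤ R) (i : WIdx n) :
    |whitMean n ψ i| ≤ R :=
  (norm_integral_le_integral_norm _).trans (integral_norm_whitAvg_mul_le hm hψ i)

theorem whitMean_one (i : WIdx n) : whitMean n (fun _ => 1) i = 1 := by
  unfold whitMean whitAvg
  simp only [mul_one]
  exact integral_ballAvg (cen i) (side_pos i)

theorem summable_mul_whit (hn : 1 ≤ n) (ho : IsOpen Ω) (hne : Ωᶜ.Nonempty) {b : WIdx n → ℝ}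
    (hb : ∀ i, |b i| ≤ R) (y : Eucl n) : Summable fun i => b i * whit n Ω i y := by
  by_cases hy : y ∈ Ω
  · refine Summable.of_norm_bounded ((hasSum_whit hn ho hne hy).summable.mul_left R) fun i => ?_
    rw [norm_mul, Real.norm_of_nonneg (whit_nonneg i y)]
    exact mul_le_mul_of_nonneg_right (hb i) (whit_nonneg i y)
  · simp only [whit_eq_zero hy, mul_zero]
    exact summable_zero

theorem tsum_whit_le_one (hn : 1 ≤ n) (ho : IsOpen Ω) (hne : Ωᶜ.Nonempty) (y : Eucl n) :
    ∑' i, whit n Ω i y ≤ 1 := by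
  by_cases hy : y ∈ Ω
  · exact (hasSum_whit hn ho hne hy).tsum_eq.le
  · simp only [whit_eq_zero hy, tsum_zero, zero_le_one]

theorem summable_whit (hn : 1 ≤ n) (ho : IsOpen Ω) (hne : Ωᶜ.Nonempty) (y : Eucl n) :
    Summable fun i => whit n Ω i y := by
  simpa using summable_mul_whit hn ho hne (b := fun _ => 1) (R := 1) (by simp) y

theorem measurable_of_hasSum {ι : Type*} [Countable ι] {F : ι → Eucl n → ℝ} {G : Eucl n → ℝ}
    (hF : ∀ i, Measurable (F i)) (h : ∀ x, HasSum (fun i => F i x) (G x)) : Measurable G :=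
  measurable_of_tendsto_metrizable' atTop
    (fun s : Finset ι => Finset.measurable_sum s fun i _ => hF i)
    (tendsto_pi_nhds.2 fun x => by simpa [HasSum, Finset.sum_apply] using h x)

/-- Integration against the Whitney partition of unity, with bounded coefficient functions. -/
theorem hasSum_integral_mul_whit (hn : 1 ≤ n) (ho : IsOpen Ω) (hne : Ωᶜ.Nonempty)
    (hg : Integrable g) {b : WIdx n → Eucl n → ℝ} (hbm : ∀ i, Measurable (b i))
    (hb : ∀ i y, |b i y| ≤ R) {G : Eucl n → ℝ}
    (hG : ∀ y, HasSum (fun i => b i y * whit n Ω i y) (G y)) :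
    HasSum (fun i => ∫ y, g y * (b i y * whit n Ω i y)) (∫ y, g y * G y) := by
  have hs := fun y => summable_whit (Ω := Ω) hn ho hne y
  refine hasSum_integral_of_dominated_convergence
    (fun i y => ‖g y‖ * R * whit n Ω i y) (fun i => ?_) (fun i => ?_) ?_ ?_ ?_
  · exact hg.aestronglyMeasurable.mul ((hbm i).mul (measurable_whit hn i)).aestronglyMeasurable
  · refine Eventually.of_forall fun y => ?_
    rw [norm_mul, norm_mul, Real.norm_of_nonneg (whit_nonneg i y), mul_assoc]
    have := whit_nonneg (Ω := Ω) i y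
    gcongr
    exact hb i y
  · exact Eventually.of_forall fun y => (hs y).mul_left _
  · simp only [tsum_mul_left]
    refine (hg.norm.mul_const R).mul_bdd (c := 1)
      (measurable_of_hasSum (fun i => measurable_whit hn i)
        (fun y => (hs y).hasSum)).aestronglyMeasurable (Eventually.of_forall fun y => ?_)
    rw [Real.norm_of_nonneg (tsum_nonneg fun i => whit_nonneg i y)]
    exact tsum_whit_le_one hn ho hne y
  · exact Eventually.of_forall fun y => (hG y).mul_left _

theorem summable_abs_integral_mul_whit (hn : 1 ≤ n) (ho : IsOpen Ω) (hne : Ωᶜ.Nonempty)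
    (hg : Integrable g) : Summable fun i => |∫ y, g y * whit n Ω i y| := by
  have h := (hasSum_integral_mul_whit hn ho hne hg.norm (b := fun _ _ => 1) (R := 1)
    (fun _ => measurable_const) (by simp)
    (fun y => by simpa using (summable_whit hn ho hne y).hasSum)).summable
  refine Summable.of_nonneg_of_le (fun i => abs_nonneg _) (fun i => ?_) h
  refine (norm_integral_le_integral_norm fun y => g y * whit n Ω i y).trans_eq
    (integral_congr_ae (Eventually.of_forall fun y => ?_))
  simp [abs_of_nonneg (whit_nonneg i y)]

/-- Replacing a function on `Ω` by its Whitney averages. -/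
def whitExt (n : ℕ) (Ω : Set (Eucl n)) (ψ : Eucl n → ℝ) (y : Eucl n) : ℝ :=
  Ωᶜ.indicator ψ y + ∑' i, whitMean n ψ i * whit n Ω i y

theorem whitExt_of_notMem {y : Eucl n} (hy : y ∉ Ω) : whitExt n Ω ψ y = ψ y := by
  simp [whitExt, whit_eq_zero hy, Set.indicator_of_mem (show y ∈ Ωᶜ from hy)]

theorem whitExt_of_mem {y : Eucl n} (hy : y ∈ Ω) :
    whitExt n Ω ψ y = ∑' i, whitMean n ψ i * whit n Ω i y := by
  simp [whitExt, Set.indicator_of_notMem (show y ∉ Ωᶜ by simpa using hy)]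

theorem whitExt_one (hn : 1 ≤ n) (ho : IsOpen Ω) (hne : Ωᶜ.Nonempty) (y : Eucl n) :
    whitExt n Ω (fun _ => 1) y = 1 := by
  by_cases hy : y ∈ Ω
  · simp only [whitExt_of_mem hy, whitMean_one, one_mul]
    exact (hasSum_whit hn ho hne hy).tsum_eq
  · rw [whitExt_of_notMem hy]

theorem measurable_whitExt (hn : 1 ≤ n) (ho : IsOpen Ω) (hne : Ωᶜ.Nonempty) (hm : Measurable ψ)
    (hψ : ∀ x, |ψ x| ≤ R) : Measurable (whitExt n Ω ψ) :=
  (hm.indicator ho.measurableSet.compl).add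
    (measurable_of_hasSum (fun i => (measurable_whit hn i).const_mul _)
      fun y => (summable_mul_whit hn ho hne (abs_whitMean_le hm hψ) y).hasSum)

theorem abs_whitExt_le (hn : 1 ≤ n) (ho : IsOpen Ω) (hne : Ωᶜ.Nonempty) (hm : Measurable ψ)
    (hψ : ∀ x, |ψ x| ≤ R) (y : Eucl n) : |whitExt n Ω ψ y| ≤ R := by
  by_cases hy : y ∈ Ω
  · rw [whitExt_of_mem hy, ← Real.norm_eq_abs]
    have h := (hasSum_whit hn ho hne hy).mul_left R
    rw [mul_one] at h
    refine tsum_of_norm_bounded h fun i => ?_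
    rw [norm_mul, Real.norm_of_nonneg (whit_nonneg i y)]
    exact mul_le_mul_of_nonneg_right (abs_whitMean_le hm hψ i) (whit_nonneg i y)
  · rw [whitExt_of_notMem hy]
    exact hψ y

/-- The atom attached to a Whitney index and a pair of consecutive level sets. -/
def whitAtom (n : ℕ) (f : Eucl n → ℝ) (Ω Ω' : Set (Eucl n)) (i : WIdx n) (x : Eucl n) : ℝ :=
  Ω'ᶜ.indicator (fun y => f y * whit n Ω i y) x - (∫ y, f y * whit n Ω i y) * whitAvg n i x +
    ∑' l, (∫ y, f y * (whit n Ω i y * whit n Ω' l y)) * whitAvg n l x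

theorem whitAtom_of_not_active {i : WIdx n} (h : ¬Active n Ω i) (x : Eucl n) :
    whitAtom n f Ω Ω' i x = 0 := by
  simp [whitAtom, whit_eq_zero_of_not_active h]

theorem exists_ne_zero_of_coeff {i l : WIdx n}
    (h : ∫ y, f y * (whit n Ω i y * whit n Ω' l y) ≠ 0) :
    ∃ y, whit n Ω i y ≠ 0 ∧ whit n Ω' l y ≠ 0 := by
  by_contra hc
  push Not at hc
  refine h ?_
  have : ∀ y, f y * (whit n Ω i y * whit n Ω' l y) = 0 := fun y => by
    by_cases hy : whit n Ω i y = 0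
    · simp [hy]
    · simp [hc y hy]
  simp [this]

theorem exists_finset_coeff (hn : 1 ≤ n) (i : WIdx n) (x : Eucl n) :
    ∃ S : Finset (WIdx n), S.card ≤ overlap n ∧ ∀ l ∉ S,
      (∫ y, f y * (whit n Ω i y * whit n Ω' l y)) * whitAvg n l x = 0 := by
  obtain ⟨S, hS, h⟩ := exists_finset_active (Ω := Ω') hn x
  refine ⟨S, hS, fun l hl => ?_⟩
  by_contra hne
  obtain ⟨h1, h2⟩ := mul_ne_zero_iff.1 hne
  obtain ⟨y, -, hy⟩ := exists_ne_zero_of_coeff h1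
  refine hl (h l ⟨y, hy⟩ ((norm_sub_lt_of_whitAvg_ne_zero h2).trans_le ?_))
  have hs := side_pos l
  have hn' : (1 : ℝ) ≤ n := by exact_mod_cast hn
  nlinarith

theorem summable_coeff (hn : 1 ≤ n) (i : WIdx n) (x : Eucl n) :
    Summable fun l => (∫ y, f y * (whit n Ω i y * whit n Ω' l y)) * whitAvg n l x := by
  obtain ⟨S, -, h⟩ := exists_finset_coeff (f := f) (Ω := Ω) (Ω' := Ω') hn i x
  exact summable_of_ne_finset_zero (s := S) h

theorem IsLevelPair.nonempty_right (h : IsLevelPair n f Ω Ω' c) : Ω'ᶜ.Nonempty :=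
  h.nonempty.mono (Set.compl_subset_compl.2 h.subset)

theorem IsLevelPair.integrable_mul_whit (hn : 1 ≤ n) (h : IsLevelPair n f Ω Ω' c) (i : WIdx n) :
    Integrable fun y => f y * whit n Ω i y :=
  integrable_mul_bump h.loc (isBump_whit hn i)

/-- The size constant of the atoms. -/
def atomConst (n : ℕ) : ℝ := 1 + (ubv n)⁻¹ + overlap n * (ubv n)⁻¹

theorem atomConst_nonneg (n : ℕ) : 0 ≤ atomConst n := by
  have := ubv_pos n
  unfold atomConst
  positivity

theorem measurable_whitAtom (hn : 1 ≤ n) (h : IsLevelPair n f Ω Ω' c) (i : WIdx n) :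
    Measurable (whitAtom n f Ω Ω' i) := by
  refine Measurable.add (((h.meas.mul (measurable_whit hn i)).indicator
    h.isOpen_right.measurableSet.compl).sub ((measurable_ballAvg n _ _).const_mul _)) ?_
  exact measurable_of_hasSum (fun l => (measurable_ballAvg n _ _).const_mul _)
    fun x => (summable_coeff hn i x).hasSum

theorem abs_coeff_whitAvg_le {a : ℝ} (i : WIdx n) (x : Eucl n) (ha : |a| ≤ c * side i ^ n) :
    |a * whitAvg n i x| ≤ c * (ubv n)⁻¹ := by
  have hu := ubv_pos n
  have hs := side_pos i
  rw [abs_mul]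
  calc |a| * |whitAvg n i x| ≤ c * side i ^ n * (side i ^ n * ubv n)⁻¹ := by
        gcongr
        · exact (abs_nonneg _).trans ha
        · exact abs_whitAvg_le i x
    _ = _ := by field_simp

theorem abs_whitAtom_le (hn : 1 ≤ n) (h : IsLevelPair n f Ω Ω' c) (i : WIdx n) (x : Eucl n) :
    |whitAtom n f Ω Ω' i x| ≤ atomConst n * c := by
  have hu := ubv_pos n
  have hc := h.nonneg
  obtain ⟨S, hS, hz⟩ := exists_finset_coeff (f := f) (Ω := Ω) (Ω' := Ω') hn i x
  have h1 : |Ω'ᶜ.indicator (fun y => f y * whit n Ω i y) x| ≤ c := by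
    by_cases hx : x ∈ Ω'
    · rwa [Set.indicator_of_notMem (by simpa using hx), abs_zero]
    · rw [Set.indicator_of_mem (by exact hx), abs_mul, abs_of_nonneg (whit_nonneg i x)]
      exact (mul_le_of_le_one_right (abs_nonneg _) (whit_le_one i x)).trans (h.bound x hx)
  have h2 := abs_coeff_whitAvg_le i x (h.coeff i)
  have h3 : |∑' l, (∫ y, f y * (whit n Ω i y * whit n Ω' l y)) * whitAvg n l x| ≤
      overlap n * (c * (ubv n)⁻¹) := by
    rw [tsum_eq_sum hz]
    refine (Finset.abs_sum_le_sum_abs _ _).trans ((Finset.sum_le_card_nsmul _ _ _ fun l _ =>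
      abs_coeff_whitAvg_le l x (h.coeff_mul i l)).trans ?_)
    rw [nsmul_eq_mul]
    gcongr
  unfold whitAtom
  refine (abs_add_le _ _).trans ((add_le_add ((abs_sub _ _).trans (add_le_add h1 h2)) h3).trans_eq ?_)
  unfold atomConst
  ring

theorem whitAtom_eq_zero (hn : 2 ≤ n) (h : IsLevelPair n f Ω Ω' c) {i : WIdx n} {x : Eucl n}
    (hx : 7 * n * side i ≤ ‖x - cen i‖) : whitAtom n f Ω Ω' i x = 0 := by
  have hs := side_pos i
  have hn' : (2 : ℝ) ≤ n := by exact_mod_cast hn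
  have hn1 : 1 ≤ n := by linarith
  have h1 : whit n Ω i x = 0 := by
    by_contra h0
    have := (whit_ne_zero hn1 h0).1
    nlinarith
  have h2 : whitAvg n i x = 0 := by
    by_contra h0
    have := norm_sub_lt_of_whitAvg_ne_zero h0
    nlinarith
  have h3 : ∀ l, (∫ y, f y * (whit n Ω i y * whit n Ω' l y)) * whitAvg n l x = 0 := fun l => by
    by_contra h0
    obtain ⟨h4, h5⟩ := mul_ne_zero_iff.1 h0
    obtain ⟨y, hy1, hy2⟩ := exists_ne_zero_of_coeff h4
    have h6 := side_lt_of_ne_zero hn1 h.subset h.nonempty hy1 hy2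
    have h7 := (whit_ne_zero hn1 hy1).1
    have h8 := (whit_ne_zero hn1 hy2).1
    have h9 := norm_sub_lt_of_whitAvg_ne_zero h5
    have h10 : ‖x - cen i‖ ≤ ‖x - cen l‖ + ‖y - cen l‖ + ‖y - cen i‖ := by
      have : x - cen i = (x - cen l) - (y - cen l) + (y - cen i) := by abel
      rw [this]
      exact (norm_add_le _ _).trans (add_le_add_left (norm_sub_le _ _) _)
    have h11 : n * side l ≤ n * (4 * side i) := by gcongr
    nlinarith
  unfold whitAtom
  simp only [h3, tsum_zero, h2, mul_zero, sub_zero, add_zero]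
  by_cases hx' : x ∈ Ω'ᶜ
  · rw [Set.indicator_of_mem hx', h1, mul_zero]
  · rw [Set.indicator_of_notMem hx']

/-- Pairing of an atom with a bounded function. -/
theorem integral_whitAtom_mul (hn : 2 ≤ n) (h : IsLevelPair n f Ω Ω' c) (hm : Measurable ψ)
    (hψ : ∀ x, |ψ x| ≤ R) (i : WIdx n) :
    ∫ x, whitAtom n f Ω Ω' i x * ψ x =
      ∫ y, f y * whit n Ω i y * (whitExt n Ω' ψ y - whitMean n ψ i) := by
  have hn1 : 1 ≤ n := by linarith
  have hne := h.nonempty_right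
  have hg := h.integrable_mul_whit hn1 i
  set a : WIdx n → ℝ := fun l => ∫ y, f y * (whit n Ω i y * whit n Ω' l y) with ha
  have ha' : ∀ l, a l = ∫ y, f y * whit n Ω i y * whit n Ω' l y := fun l => by
    simp only [ha, mul_assoc]
  have hasum : Summable fun l => |a l| := by
    simp only [ha']
    exact summable_abs_integral_mul_whit hn1 h.isOpen_right hne hg
  have i1 : Integrable fun x => Ω'ᶜ.indicator (fun y => f y * whit n Ω i y) x * ψ x :=
    (hg.indicator h.isOpen_right.measurableSet.compl).mul_bdd (c := R) hm.aestronglyMeasurable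
      (Eventually.of_forall hψ)
  have i2 : Integrable fun x => (∫ y, f y * whit n Ω i y) * (whitAvg n i x * ψ x) :=
    (integrable_whitAvg_mul hm hψ i).const_mul _
  have i0 : Integrable fun x => whitAtom n f Ω Ω' i x * ψ x :=
    (integrable_bdd_supp (measurable_whitAtom hn1 h i) (abs_whitAtom_le hn1 h i)
      (fun x hx => whitAtom_eq_zero hn h hx)).mul_bdd (c := R) hm.aestronglyMeasurable
      (Eventually.of_forall hψ)
  have e0 : ∀ x, (∑' l, a l * whitAvg n l x) * ψ x = whitAtom n f Ω Ω' i x * ψ x -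
      Ω'ᶜ.indicator (fun y => f y * whit n Ω i y) x * ψ x +
      (∫ y, f y * whit n Ω i y) * (whitAvg n i x * ψ x) := fun x => by
    unfold whitAtom
    ring
  have i3 : Integrable fun x => (∑' l, a l * whitAvg n l x) * ψ x := by
    simp only [e0]
    exact (i0.sub i1).add i2
  have s3 : HasSum (fun l => a l * whitMean n ψ l) (∫ x, (∑' l, a l * whitAvg n l x) * ψ x) := by
    have h1 := hasSum_integral_of_summable_integral_norm (μ := volume)
      (F := fun l x => a l * (whitAvg n l x * ψ x))
      (fun l => (integrable_whitAvg_mul hm hψ l).const_mul _) ?_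
    · simp only [integral_const_mul] at h1
      simp only [← tsum_mul_right, mul_assoc]
      exact h1
    · refine Summable.of_nonneg_of_le (fun l => integral_nonneg fun x => norm_nonneg _)
        (fun l => ?_) (hasum.mul_right R)
      simp only [norm_mul (a l), integral_const_mul]
      exact mul_le_mul_of_nonneg_left (integral_norm_whitAvg_mul_le hm hψ l) (norm_nonneg _)
  have s4 : HasSum (fun l => a l * whitMean n ψ l)
      (∫ y, f y * whit n Ω i y * ∑' l, whitMean n ψ l * whit n Ω' l y) := by
    have h1 := hasSum_integral_mul_whit hn1 h.isOpen_right hne hg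
      (b := fun l _ => whitMean n ψ l) (R := R) (fun _ => measurable_const)
      (fun l _ => abs_whitMean_le hm hψ l)
      (fun y => (summable_mul_whit hn1 h.isOpen_right hne (abs_whitMean_le hm hψ) y).hasSum)
    convert h1 using 2 with l
    rw [ha', ← integral_mul_const]
    congr 1
    ext y
    ring
  have i4 : Integrable fun y => f y * whit n Ω i y * whitExt n Ω' ψ y :=
    hg.mul_bdd (c := R) (measurable_whitExt hn1 h.isOpen_right hne hm hψ).aestronglyMeasurable
      (Eventually.of_forall (abs_whitExt_le hn1 h.isOpen_right hne hm hψ))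
  have e5 : ∀ y, f y * whit n Ω i y * ∑' l, whitMean n ψ l * whit n Ω' l y =
      f y * whit n Ω i y * whitExt n Ω' ψ y -
        Ω'ᶜ.indicator (fun y => f y * whit n Ω i y) y * ψ y := fun y => by
    unfold whitExt
    by_cases hy : y ∈ Ω'ᶜ
    · simp only [Set.indicator_of_mem hy]; ring
    · simp only [Set.indicator_of_notMem hy]; ring
  have e6 := s3.unique s4
  simp only [e5, e0] at e6
  rw [integral_add (f := fun x => whitAtom n f Ω Ω' i x * ψ x -
      Ω'ᶜ.indicator (fun y => f y * whit n Ω i y) x * ψ x) (i0.sub i1) i2, integral_sub i0 i1,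
    integral_sub i4 i1, integral_const_mul] at e6
  simp only [mul_sub]
  rw [integral_sub i4 (hg.mul_const _), integral_mul_const]
  change _ - _ + _ * whitMean n ψ i = _ at e6
  linarith

theorem IsLevelPair.isHAtom (hn : 2 ≤ n) (h : IsLevelPair n f Ω Ω' c) (i : WIdx n) :
    IsHAtom n (cen i) (7 * n * side i) (atomConst n * c) (whitAtom n f Ω Ω' i) where
  meas := measurable_whitAtom (by linarith) h i
  bound := abs_whitAtom_le (by linarith) h i
  supp _ hx := whitAtom_eq_zero hn h hx
  mean := by
    have := integral_whitAtom_mul hn h (ψ := fun _ => 1) (R := 1) measurable_const (by simp) i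
    simpa [whitExt_one (by linarith : 1 ≤ n) h.isOpen_right h.nonempty_right, whitMean_one]
      using this

end

section

variable {n : ℕ} {f ψ : Eucl n → ℝ} {Ω Ω' : Set (Eucl n)} {c R : ℝ}

/-- A radius outside of which the Whitney averages of a test function vanish. -/
def whitRad (n : ℕ) (Ω : Set (Eucl n)) (R : ℝ) : ℝ := 2 * R + infDist 0 Ωᶜ

theorem whitRad_mono (hsub : Ω' ⊆ Ω) (hne : Ωᶜ.Nonempty) : whitRad n Ω' R ≤ whitRad n Ω R := by
  have : infDist 0 Ω'ᶜ ≤ infDist 0 Ωᶜ :=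
    infDist_le_infDist_of_subset (Set.compl_subset_compl.2 hsub) hne
  unfold whitRad
  linarith

theorem norm_lt_whitRad (hn : 1 ≤ n) (hψ : IsTest n R ψ) {i : WIdx n}
    {y : Eucl n} (hy : whit n Ω i y ≠ 0) (hb : whitMean n ψ i ≠ 0) : ‖y‖ < whitRad n Ω R := by
  have hs := side_pos i
  have hn' : (1 : ℝ) ≤ n := by exact_mod_cast hn
  obtain ⟨z, hz⟩ : ∃ z, whitAvg n i z * ψ z ≠ 0 := by
    by_contra h
    push Not at h
    exact hb (by simp [whitMean, h])
  obtain ⟨hz1, hz2⟩ := mul_ne_zero_iff.1 hz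
  have h1 := norm_sub_lt_of_whitAvg_ne_zero hz1
  have h2 : ‖z‖ < R := by
    by_contra h
    exact hz2 (hψ.supp z (not_lt.1 h))
  have h3 := (Active.infDist hn ⟨y, hy⟩ (h1.trans_le (by nlinarith : side i ≤ 7 * n * side i))).1
  have h4 : infDist z Ωᶜ ≤ infDist 0 Ωᶜ + ‖z‖ := by
    simpa using infDist_le_infDist_add_dist (s := Ωᶜ) (x := z) (y := 0)
  have h5 := (whit_ne_zero hn hy).1
  have h6 : ‖y‖ ≤ ‖y - cen i‖ + ‖z - cen i‖ + ‖z‖ := by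
    have : y = (y - cen i) - (z - cen i) + z := by abel
    conv_lhs => rw [this]
    exact (norm_add_le _ _).trans (add_le_add_left (norm_sub_le _ _) _)
  unfold whitRad
  nlinarith

theorem whitExt_eq_zero (hn : 1 ≤ n) (hψ : IsTest n R ψ) {y : Eucl n}
    (hy : whitRad n Ω R ≤ ‖y‖) : whitExt n Ω ψ y = 0 := by
  have hR := hψ.pos
  have h1 : ψ y = 0 := hψ.supp y (by
    have : 0 ≤ infDist 0 Ωᶜ := infDist_nonneg
    unfold whitRad at hy
    linarith)
  have h2 : ∀ i, whitMean n ψ i * whit n Ω i y = 0 := fun i => by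
    by_contra h
    obtain ⟨h3, h4⟩ := mul_ne_zero_iff.1 h
    exact absurd (norm_lt_whitRad hn hψ h4 h3) (not_lt.2 hy)
  unfold whitExt
  simp only [h2, tsum_zero, add_zero]
  exact Set.indicator_apply_eq_zero.2 fun _ => h1

theorem integrable_ball_indicator (hf : LocallyIntegrable f volume) (r : ℝ) :
    Integrable ((ball (0 : Eucl n) r).indicator f) :=
  (integrable_indicator_iff measurableSet_ball).2
    ((hf.integrableOn_isCompact (isCompact_closedBall 0 r)).mono_set ball_subset_closedBall)

theorem integrable_mul_of_bdd_supp {G : Eucl n → ℝ} {r B : ℝ} (hf : LocallyIntegrable f volume)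
    (hG : Measurable G) (hB : ∀ y, |G y| ≤ B) (hs : ∀ y, r ≤ ‖y‖ → G y = 0) :
    Integrable fun y => f y * G y := by
  refine ((integrable_ball_indicator hf r).mul_bdd (c := B) hG.aestronglyMeasurable
    (Eventually.of_forall hB)).congr (Eventually.of_forall fun y => ?_)
  beta_reduce
  by_cases hy : y ∈ ball 0 r
  · rw [Set.indicator_of_mem hy]
  · rw [hs y (by simpa using hy), mul_zero, mul_zero]

theorem hasSum_integral_whitAtom (hn : 2 ≤ n) (h : IsLevelPair n f Ω Ω' c) (hψ : IsTest n R ψ) :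
    HasSum (fun i => ∫ x, whitAtom n f Ω Ω' i x * ψ x)
      ((∫ y, f y * whitExt n Ω' ψ y) - ∫ y, f y * whitExt n Ω ψ y) := by
  have hn1 : 1 ≤ n := by linarith
  have hm := hψ.continuous.measurable
  have hne' := h.nonempty_right
  have hE := measurable_whitExt hn1 h.isOpen_left h.nonempty hm hψ.bound
  have hE' := measurable_whitExt hn1 h.isOpen_right hne' hm hψ.bound
  have bE := abs_whitExt_le hn1 h.isOpen_left h.nonempty hm hψ.bound
  have bE' := abs_whitExt_le hn1 h.isOpen_right hne' hm hψ.bound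
  set r := whitRad n Ω R with hr
  have sE : ∀ y, r ≤ ‖y‖ → whitExt n Ω ψ y = 0 := fun y hy => whitExt_eq_zero hn1 hψ hy
  have sE' : ∀ y, r ≤ ‖y‖ → whitExt n Ω' ψ y = 0 := fun y hy =>
    whitExt_eq_zero hn1 hψ ((whitRad_mono h.subset h.nonempty).trans hy)
  rw [← integral_sub (integrable_mul_of_bdd_supp h.loc hE' bE' sE')
    (integrable_mul_of_bdd_supp h.loc hE bE sE)]
  have key := hasSum_integral_mul_whit hn1 h.isOpen_left h.nonempty
    (integrable_ball_indicator h.loc r)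
    (b := fun i y => whitExt n Ω' ψ y - whitMean n ψ i) (R := R + R)
    (fun i => hE'.sub_const _)
    (fun i y => (abs_sub _ _).trans (add_le_add (bE' y) (abs_whitMean_le hm hψ.bound i)))
    (G := fun y => whitExt n Ω' ψ y - whitExt n Ω ψ y) (fun y => ?_)
  · convert key using 2 with i y
    · rw [integral_whitAtom_mul hn h hm hψ.bound]
      refine integral_congr_ae (Eventually.of_forall fun y => ?_)
      beta_reduce
      by_cases hy : y ∈ ball (0 : Eucl n) r
      · rw [Set.indicator_of_mem hy]; ring
      · rw [Set.indicator_of_notMem hy, zero_mul]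
        have hy' : r ≤ ‖y‖ := by simpa using hy
        rw [sE' y hy']
        by_cases hw : whit n Ω i y = 0
        · rw [hw]; ring
        · have : whitMean n ψ i = 0 := by
            by_contra hb
            exact absurd (norm_lt_whitRad hn1 hψ hw hb) (not_lt.2 hy')
          rw [this]; ring
    · ext y
      by_cases hy : y ∈ ball (0 : Eucl n) r
      · rw [Set.indicator_of_mem hy]; ring
      · have hy' : r ≤ ‖y‖ := by simpa using hy
        rw [sE y hy', sE' y hy']; ring
  · by_cases hy : y ∈ Ω
    · have h1 := (hasSum_whit hn1 h.isOpen_left h.nonempty hy).mul_left (whitExt n Ω' ψ y)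
      have h2 := (summable_mul_whit hn1 h.isOpen_left h.nonempty
        (abs_whitMean_le hm hψ.bound) y).hasSum
      rw [← whitExt_of_mem hy] at h2
      have h3 := h1.sub h2
      simpa only [mul_one, sub_mul] using h3
    · have hy' : y ∉ Ω' := fun h' => hy (h.subset h')
      simp only [whit_eq_zero hy, mul_zero, whitExt_of_notMem hy, whitExt_of_notMem hy', sub_self]
      exact hasSum_zero

/-- The pairing of `f` with the averaged test function is small when the level is small. -/
theorem abs_integral_whitExt_le (hn : 1 ≤ n) (h : IsLevelPair n f Ω Ω' c) (hψ : IsTest n R ψ) :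
    |∫ y, f y * whitExt n Ω ψ y| ≤ c * ((1 + overlap n * (ubv n)⁻¹) * ∫ y, |ψ y|) := by
  have hu := ubv_pos n
  have hc := h.nonneg
  have hm := hψ.continuous.measurable
  have hne := h.nonempty
  have hE := measurable_whitExt hn h.isOpen_left h.nonempty hm hψ.bound
  have bE := abs_whitExt_le hn h.isOpen_left h.nonempty hm hψ.bound
  set r := whitRad n Ω R with hr
  have sE : ∀ y, r ≤ ‖y‖ → whitExt n Ω ψ y = 0 := fun y hy => whitExt_eq_zero hn hψ hy
  have hψi : Integrable ψ := by
    simpa using integrable_mul_of_bdd_supp (f := fun _ => 1) (locallyIntegrable_const 1) hm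
      hψ.bound hψ.supp
  set T := fun y => ∑' i, whitMean n ψ i * whit n Ω i y with hT
  have hTs : ∀ y, HasSum (fun i => whitMean n ψ i * whit n Ω i y) (T y) := fun y =>
    (summable_mul_whit hn h.isOpen_left hne (abs_whitMean_le hm hψ.bound) y).hasSum
  have i1 : Integrable fun y => f y * Ωᶜ.indicator ψ y :=
    integrable_mul_of_bdd_supp h.loc (hm.indicator h.isOpen_left.measurableSet.compl)
      (B := R) (r := R) (fun y => (norm_indicator_le_norm_self ψ y).trans (hψ.bound y))
      (fun y hy => Set.indicator_apply_eq_zero.2 fun _ => hψ.supp y hy)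
  have e : ∀ y, f y * T y = f y * whitExt n Ω ψ y - f y * Ωᶜ.indicator ψ y := fun y => by
    simp only [whitExt, hT]; ring
  have i2 : Integrable fun y => f y * T y := by
    simp only [e]
    exact (integrable_mul_of_bdd_supp h.loc hE bE sE).sub i1
  have b1 : |∫ y, f y * Ωᶜ.indicator ψ y| ≤ c * ∫ y, |ψ y| := by
    rw [← integral_const_mul, ← Real.norm_eq_abs]
    refine norm_integral_le_of_norm_le (hψi.abs.const_mul c) (Eventually.of_forall fun y => ?_)
    rw [norm_mul]
    by_cases hy : y ∈ Ω
    · rw [Set.indicator_of_notMem (by simpa using hy), norm_zero, mul_zero]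
      positivity
    · rw [Set.indicator_of_mem (by exact hy)]
      exact mul_le_mul_of_nonneg_right (h.bound y fun hy' => hy (h.subset hy')) (norm_nonneg _)
  have s2 : HasSum (fun i => (∫ y, f y * whit n Ω i y) * whitMean n ψ i) (∫ y, f y * T y) := by
    have key := hasSum_integral_mul_whit hn h.isOpen_left hne (integrable_ball_indicator h.loc r)
      (b := fun i _ => whitMean n ψ i) (fun _ => measurable_const)
      (fun i _ => abs_whitMean_le hm hψ.bound i) hTs
    have e1 : ∀ i y, (ball 0 r).indicator f y * (whitMean n ψ i * whit n Ω i y) =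
        f y * whit n Ω i y * whitMean n ψ i := fun i y => by
      by_cases hy : y ∈ ball (0 : Eucl n) r
      · rw [Set.indicator_of_mem hy]; ring
      · rw [Set.indicator_of_notMem hy, zero_mul]
        by_contra h0
        obtain ⟨h1, h2⟩ := mul_ne_zero_iff.1 (Ne.symm h0)
        exact hy (by simpa using norm_lt_whitRad hn hψ (right_ne_zero_of_mul h1) h2)
    have e2 : ∀ y, (ball 0 r).indicator f y * T y = f y * T y := fun y => by
      rw [hT, ← tsum_mul_left, ← tsum_mul_left]
      simp only [e1]
      congr 1
      ext i
      ring
    simp only [e1, e2, integral_mul_const] at key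
    exact key
  have b2 : |∫ y, f y * T y| ≤ c * (overlap n * (ubv n)⁻¹ * ∫ y, |ψ y|) := by
    refine le_of_tendsto (s2.abs) (Eventually.of_forall fun s => ?_)
    classical
    have h1 : ∀ i ∈ s, |(∫ y, f y * whit n Ω i y) * whitMean n ψ i| ≤
        ∫ y, c * ((if Active n Ω i then side i ^ n * whitAvg n i y else 0) * |ψ y|) := fun i _ => by
      by_cases hi : Active n Ω i
      · simp only [hi, if_true, mul_assoc, integral_const_mul]
        rw [abs_mul, ← mul_assoc]
        refine mul_le_mul (h.coeff i) ?_ (abs_nonneg _) (by have := side_pos i; positivity)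
        refine (norm_integral_le_integral_norm fun x => whitAvg n i x * ψ x).trans_eq ?_
        simp only [norm_mul, Real.norm_of_nonneg (whitAvg_nonneg i _), Real.norm_eq_abs]
      · simp [hi, whit_eq_zero_of_not_active hi]
    refine (Finset.abs_sum_le_sum_abs _ _).trans ((Finset.sum_le_sum h1).trans ?_)
    have h2 : ∀ i ∈ s, Integrable fun y =>
        c * ((if Active n Ω i then side i ^ n * whitAvg n i y else 0) * |ψ y|) := fun i _ => by
      by_cases hi : Active n Ω i
      · simp only [hi, if_true, mul_assoc]
        exact ((integrable_whitAvg_mul hm.abs (fun x => by simpa using hψ.bound x)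
          i).const_mul _).const_mul _
      · simp [hi]
    rw [← integral_finsetSum _ h2, ← integral_const_mul, ← integral_const_mul]
    refine integral_mono (integrable_finsetSum _ h2) ((hψi.abs.const_mul _).const_mul _)
      fun y => ?_
    beta_reduce
    rw [← Finset.mul_sum, ← Finset.sum_mul]
    refine mul_le_mul_of_nonneg_left (mul_le_mul_of_nonneg_right ?_ (abs_nonneg _)) hc
    obtain ⟨S, hS, hA⟩ := exists_finset_active (Ω := Ω) hn y
    have h3 : ∀ i, (if Active n Ω i then side i ^ n * whitAvg n i y else 0) ≤
        if i ∈ S then (ubv n)⁻¹ else 0 := fun i => by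
      have hs := side_pos i
      have hn' : (1 : ℝ) ≤ n := by exact_mod_cast hn
      split_ifs with h4 h5 h5
      · calc side i ^ n * whitAvg n i y ≤ side i ^ n * (side i ^ n * ubv n)⁻¹ := by
              gcongr
              exact (le_abs_self _).trans (abs_whitAvg_le i y)
          _ = _ := by field_simp
      · have : whitAvg n i y = 0 := by
          by_contra h6
          exact h5 (hA i h4 ((norm_sub_lt_of_whitAvg_ne_zero h6).trans_le (by nlinarith)))
        rw [this, mul_zero]
      · positivity
      · exact le_rfl
    refine (Finset.sum_le_sum fun i _ => h3 i).trans ?_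
    rw [Finset.sum_ite_mem, Finset.sum_const, nsmul_eq_mul]
    gcongr
    exact_mod_cast (Finset.card_le_card Finset.inter_subset_right).trans hS
  have e3 : ∫ y, f y * whitExt n Ω ψ y = (∫ y, f y * Ωᶜ.indicator ψ y) + ∫ y, f y * T y := by
    rw [← integral_add i1 i2]
    refine integral_congr_ae (Eventually.of_forall fun y => ?_)
    beta_reduce
    rw [e]; ring
  rw [e3]
  refine (abs_add_le _ _).trans ((add_le_add b1 b2).trans_eq ?_)
  ring

theorem tendsto_integral_whitExt (hn : 1 ≤ n) (hf : LocallyIntegrable f volume)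
    (hψ : IsTest n R ψ) {U : ℕ → Set (Eucl n)} (ho : ∀ k, IsOpen (U k))
    (hne : (U 0)ᶜ.Nonempty) (hsub : ∀ k, U k ⊆ U 0)
    (hv : ∀ r, Tendsto (fun k => volume (U k ∩ ball 0 r)) atTop (𝓝 0)) :
    Tendsto (fun k => ∫ y, f y * whitExt n (U k) ψ y) atTop (𝓝 (∫ y, f y * ψ y)) := by
  have hm := hψ.continuous.measurable
  have hnek : ∀ k, (U k)ᶜ.Nonempty := fun k => hne.mono (Set.compl_subset_compl.2 (hsub k))
  set r := max R (whitRad n (U 0) R) with hr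
  have i0 : Integrable fun y => f y * ψ y := integrable_mul_of_bdd_supp hf hm hψ.bound hψ.supp
  have ik : ∀ k, Integrable fun y => f y * whitExt n (U k) ψ y := fun k =>
    integrable_mul_of_bdd_supp hf (measurable_whitExt hn (ho k) (hnek k) hm hψ.bound)
      (abs_whitExt_le hn (ho k) (hnek k) hm hψ.bound) fun y hy => whitExt_eq_zero hn hψ hy
  have ib : Integrable fun y => 2 * R * |(ball 0 r).indicator f y| :=
    (integrable_ball_indicator hf r).abs.const_mul _
  have hfin : ∫⁻ y, ENNReal.ofReal (2 * R * |(ball 0 r).indicator f y|) ≠ ⊤ :=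
    ib.lintegral_lt_top.ne
  have h0 := tendsto_setLIntegral_zero hfin (hv r)
  have h1 := (ENNReal.tendsto_toReal ENNReal.zero_ne_top).comp h0
  rw [ENNReal.toReal_zero] at h1
  rw [tendsto_iff_norm_sub_tendsto_zero]
  refine squeeze_zero (fun _ => norm_nonneg _) (fun k => ?_) h1
  have hR := hψ.pos
  rw [← integral_sub (ik k) i0, Function.comp_apply,
    ← integral_eq_lintegral_of_nonneg_ae (Eventually.of_forall fun y => by positivity)
      ib.aestronglyMeasurable.restrict,
    ← integral_indicator ((ho k).measurableSet.inter measurableSet_ball)]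
  refine norm_integral_le_of_norm_le
    (ib.indicator ((ho k).measurableSet.inter measurableSet_ball)) (Eventually.of_forall fun y => ?_)
  rw [← mul_sub, norm_mul]
  by_cases hy : y ∈ U k
  · by_cases hy' : y ∈ ball 0 r
    · rw [Set.indicator_of_mem (Set.mem_inter hy hy'), Set.indicator_of_mem hy', mul_comm]
      refine mul_le_mul_of_nonneg_right ?_ (abs_nonneg _)
      refine (abs_sub _ _).trans ((add_le_add
        (abs_whitExt_le hn (ho k) (hnek k) hm hψ.bound y) (hψ.bound y)).trans_eq (by ring))
    · have hy2 : r ≤ ‖y‖ := by simpa using hy'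
      rw [whitExt_eq_zero hn hψ ((whitRad_mono (hsub k) hne).trans ((le_max_right _ _).trans hy2)),
        hψ.supp y ((le_max_left _ _).trans hy2), sub_zero, norm_zero, mul_zero]
      exact Set.indicator_nonneg (fun _ _ => by positivity) _
  · rw [whitExt_of_notMem hy, sub_self, norm_zero, mul_zero]
    exact Set.indicator_nonneg (fun _ _ => by positivity) _

end

section

variable {n : ℕ} {Ω E : Set (Eucl n)} {a D r : ℝ}

/-- The weighted measure of a level set at height `a`. -/
def LevelMass (n : ℕ) (Ω : Set (Eucl n)) (a D : ℝ) : Prop :=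
  ENNReal.ofReal a * ∫⁻ x in Ω, logWt n (log (exp 1 + a)) x ≤ ENNReal.ofReal D

theorem LevelMass.volume_le (h : LevelMass n Ω a D) (ha : 0 < a) (hE : MeasurableSet E)
    (hsub : E ⊆ Ω) (hr : 0 ≤ r) (hEr : ∀ x ∈ E, ‖x‖ ≤ r) :
    ENNReal.ofReal a * volume E ≤ ENNReal.ofReal (D * (log (exp 1 + r) + log (exp 1 + a))) := by
  set L := log (exp 1 + r) + log (exp 1 + a) with hL
  have h1 := one_le_log_exp_add hr
  have h2 := one_le_log_exp_add ha.le
  have hL0 : 0 < L := by linarith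
  have h3 : volume E ≤ ENNReal.ofReal L * ∫⁻ x in Ω, logWt n (log (exp 1 + a)) x := by
    calc volume E = ENNReal.ofReal L * ∫⁻ _x in E, ENNReal.ofReal (1 / L) := by
          rw [setLIntegral_const, ← mul_assoc, ← ENNReal.ofReal_mul hL0.le,
            mul_one_div_cancel hL0.ne', ENNReal.ofReal_one, one_mul]
      _ ≤ ENNReal.ofReal L * ∫⁻ x in E, logWt n (log (exp 1 + a)) x := by
          refine mul_le_mul_right (setLIntegral_mono' hE fun x hx => ?_) _
          refine ENNReal.ofReal_le_ofReal (one_div_le_one_div_of_le ?_ ?_)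
          · linarith [one_le_log_exp_add (norm_nonneg x)]
          · linarith [log_exp_add_mono (norm_nonneg x) (hEr x hx)]
      _ ≤ _ := mul_le_mul_right (lintegral_mono_set hsub) _
  calc ENNReal.ofReal a * volume E
      ≤ ENNReal.ofReal a * (ENNReal.ofReal L * ∫⁻ x in Ω, logWt n (log (exp 1 + a)) x) :=
        mul_le_mul_right h3 _
    _ = ENNReal.ofReal L * (ENNReal.ofReal a * ∫⁻ x in Ω, logWt n (log (exp 1 + a)) x) := by ring
    _ ≤ ENNReal.ofReal L * ENNReal.ofReal D := mul_le_mul_right h _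
    _ = _ := by rw [← ENNReal.ofReal_mul hL0.le, mul_comm]

theorem LevelMass.ball_le (h : LevelMass n Ω a D) (ha : 0 < a) (hD : 0 ≤ D) {x : Eucl n}
    (hr : 0 < r) (hsub : ball x r ⊆ Ω) :
    a * (r ^ n * ubv n) ≤ D * (log (exp 1 + (‖x‖ + r)) + log (exp 1 + a)) := by
  have h0 := norm_nonneg x
  have h1 := one_le_log_exp_add (t := ‖x‖ + r) (by linarith)
  have h2 := one_le_log_exp_add ha.le
  have := h.volume_le ha measurableSet_ball hsub (r := ‖x‖ + r) (by linarith) fun y hy => by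
    have h3 : ‖y - x‖ < r := by simpa [dist_eq_norm] using hy
    linarith [norm_le_norm_add_norm_sub x y, norm_sub_rev x y]
  rwa [volume_ball_eq x hr, ← ENNReal.ofReal_mul ha.le, ENNReal.ofReal_le_ofReal_iff
    (mul_nonneg hD (by linarith))] at this

theorem log_exp_add_le {t : ℝ} (ht : 0 ≤ t) : log (exp 1 + t) ≤ 2 + t := by
  have h1 := Real.log_le_sub_one_of_pos (x := exp 1 + t) (by positivity)
  have h2 := Real.exp_one_lt_d9
  linarith

theorem LevelMass.compl_nonempty (hn : 1 ≤ n) (h : LevelMass n Ω a D) (ha : 0 < a) (hD : 0 ≤ D) :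
    Ωᶜ.Nonempty := by
  by_contra hc
  rw [Set.not_nonempty_iff_eq_empty, Set.compl_empty_iff] at hc
  have hu := ubv_pos n
  set s := log (exp 1 + a) with hs
  have hs1 : 1 ≤ s := one_le_log_exp_add ha.le
  set T := max 1 ((D * (6 + s) + 1) / (a * ubv n)) with hT
  have hT1 : 1 ≤ T := le_max_left 1 _
  have hT2 : D * (6 + s) + 1 ≤ a * ubv n * T := by
    have hau : 0 < a * ubv n := mul_pos ha hu
    rw [mul_comm (a * ubv n), ← div_le_iff₀ hau]
    exact le_max_right 1 _
  have h1 := h.ball_le ha hD (x := 0) (r := T ^ 2) (by positivity) (by rw [hc]; exact Set.subset_univ _)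
  rw [norm_zero, zero_add] at h1
  have h2 := log_exp_add_le_two_mul_sqrt (R := T ^ 2) (by positivity)
  rw [Real.sqrt_sq (by linarith)] at h2
  have h3 := log_exp_add_le (t := T) (by linarith)
  have h4 : T ^ 2 ≤ (T ^ 2) ^ n := le_self_pow₀ (by nlinarith) (by omega)
  have h5 : a * ubv n * T ^ 2 ≤ D * (4 + 2 * T + s) := by
    calc a * ubv n * T ^ 2 ≤ a * ubv n * (T ^ 2) ^ n := by gcongr
      _ = a * ((T ^ 2) ^ n * ubv n) := by ring
      _ ≤ _ := h1
      _ ≤ _ := by gcongr; linarith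
  have h6 : D * (4 + 2 * T + s) ≤ D * ((6 + s) * T) := by gcongr; nlinarith
  nlinarith

theorem LevelMass.volume_inter_ball_le (h : LevelMass n Ω a D) (ho : IsOpen Ω) (ha : 0 < a)
    (hr : 0 ≤ r) :
    volume (Ω ∩ ball 0 r) ≤ ENNReal.ofReal (D * (log (exp 1 + r) + log (exp 1 + a)) / a) := by
  have h1 := h.volume_le ha (ho.measurableSet.inter measurableSet_ball)
    Set.inter_subset_left hr (E := Ω ∩ ball 0 r) fun x hx => by
      have := hx.2
      rw [mem_ball_zero_iff] at this
      exact this.le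
  rw [ENNReal.ofReal_div_of_pos ha, ENNReal.le_div_iff_mul_le
    (Or.inl (by simpa using ha)) (Or.inl ENNReal.ofReal_ne_top), mul_comm]
  exact h1

theorem log_exp_add_two_pow_le (k : ℕ) : log (exp 1 + 2 ^ k) ≤ 2 + k := by
  have h1 := Real.exp_one_lt_d9
  have h2 := Real.add_one_le_exp 1
  rw [Real.log_le_iff_le_exp (by positivity), Real.exp_add]
  have h3 : (2 : ℝ) ^ k ≤ exp k := by
    rw [← Real.exp_one_pow]
    gcongr
    linarith
  have h4 : 1 ≤ exp (k : ℝ) := Real.one_le_exp (Nat.cast_nonneg k)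
  have h5 : exp 2 = exp 1 * exp 1 := by rw [← Real.exp_add]; norm_num
  rw [h5]
  nlinarith [mul_le_mul h2 h2 (by norm_num) (by positivity)]

theorem tendsto_volume_inter_ball {U : ℕ → Set (Eucl n)}
    (h : ∀ k : ℕ, LevelMass n (U k) (2 ^ k) D) (ho : ∀ k, IsOpen (U k)) (hD : 0 ≤ D) (r : ℝ) :
    Tendsto (fun k => volume (U k ∩ ball 0 r)) atTop (𝓝 0) := by
  set r' := max r 0 with hr'
  set q := log (exp 1 + r') with hq
  have h1 : Tendsto (fun k : ℕ => D * (q + 2) * ((k : ℝ) ^ 0 / 2 ^ k) + D * ((k : ℝ) ^ 1 / 2 ^ k))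
      atTop (𝓝 (D * (q + 2) * 0 + D * 0)) :=
    ((tendsto_pow_const_div_const_pow_of_one_lt 0 (one_lt_two)).const_mul _).add
      ((tendsto_pow_const_div_const_pow_of_one_lt 1 (one_lt_two)).const_mul _)
  have h2 := ENNReal.tendsto_ofReal h1
  rw [mul_zero, mul_zero, add_zero, ENNReal.ofReal_zero] at h2
  refine tendsto_of_tendsto_of_tendsto_of_le_of_le tendsto_const_nhds h2 (fun _ => zero_le)
    fun k => ?_
  refine (measure_mono (Set.inter_subset_inter_right _ (ball_subset_ball (le_max_left r 0)))).trans
    (((h k).volume_inter_ball_le (ho k) (by positivity) (le_max_right r 0)).trans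
      (ENNReal.ofReal_le_ofReal ?_))
  have h3 := log_exp_add_two_pow_le k
  rw [pow_zero, pow_one, mul_one_div, mul_div_assoc' D, ← add_div]
  gcongr
  nlinarith

/-- The constant comparing the logarithms attached to a level and to its Whitney balls. -/
def logConst (n : ℕ) (D : ℝ) : ℝ := 2 * log (exp 1 + D / ubv n) + 2 * n + 1

theorem logConst_pos (n : ℕ) (hD : 0 ≤ D) : 0 < logConst n D := by
  have hu := ubv_pos n
  have := one_le_log_exp_add (t := D / ubv n) (by positivity)
  unfold logConst
  linarith [Nat.cast_nonneg (α := ℝ) n]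

theorem log_exp_add_le_lamBall {x : Eucl n} {t : ℝ} (hr : 0 < r) (ht : 0 ≤ t) (hy : t ≤ ‖x‖ + r) :
    log (exp 1 + t) ≤ lamBall n x r := by
  have h0 := norm_nonneg x
  have he := Real.add_one_le_exp 1
  have h2 : log (exp 1 + t) ≤ 1 + log (1 + ‖x‖ + r) := by
    calc log (exp 1 + t) ≤ log (exp 1 * (1 + ‖x‖ + r)) :=
          Real.log_le_log (by positivity) (by nlinarith)
      _ = _ := by rw [Real.log_mul (Real.exp_pos 1).ne' (by linarith), Real.log_exp]
  unfold lamBall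
  linarith [le_max_left 0 (-log r)]

theorem LevelMass.log_le (h : LevelMass n Ω a D) (ha : 0 < a) (hD : 0 ≤ D) {x : Eucl n}
    (hr : 0 < r) (hsub : ball x r ⊆ Ω) :
    log (exp 1 + a) ≤ logConst n D * lamBall n x r := by
  have hu := ubv_pos n
  have h0 := norm_nonneg x
  set s := log (exp 1 + a) with hs
  set Λ := lamBall n x r with hΛ
  have hs1 : 1 ≤ s := one_le_log_exp_add ha.le
  have hΛ1 : 1 ≤ Λ := one_le_lamBall x hr
  have h1 := h.ball_le ha hD hr hsub
  have h2 : log (exp 1 + (‖x‖ + r)) ≤ Λ := log_exp_add_le_lamBall hr (by linarith) le_rfl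
  have h3 : -log r ≤ Λ := by
    rw [hΛ]
    unfold lamBall
    have : 0 ≤ log (1 + ‖x‖ + r) := log_nonneg (by linarith)
    linarith [le_max_right 0 (-log r)]
  have h4 : 1 ≤ r ^ n * exp (n * Λ) := by
    have : 1 ≤ r * exp Λ := by
      calc (1 : ℝ) = r * exp (-log r) := by rw [Real.exp_neg, Real.exp_log hr, mul_inv_cancel₀ hr.ne']
        _ ≤ _ := by gcongr
    rw [Real.exp_nat_mul, ← mul_pow]
    exact one_le_pow₀ this
  have h5 : a ≤ D / ubv n * (Λ + s) * exp (n * Λ) := by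
    calc a ≤ a * (r ^ n * exp (n * Λ)) := le_mul_of_one_le_right ha.le h4
      _ = (a * (r ^ n * ubv n)) / ubv n * exp (n * Λ) := by field_simp
      _ ≤ (D * (Λ + s)) / ubv n * exp (n * Λ) := by
          have h11 := h1.trans (mul_le_mul_of_nonneg_left (add_le_add_left h2 s) hD)
          exact mul_le_mul_of_nonneg_right (div_le_div_of_nonneg_right h11 hu.le) (Real.exp_pos _).le
      _ = _ := by ring
  have h6 : exp 1 + a ≤ (exp 1 + D / ubv n) * (Λ + s) * exp (n * Λ) := by
    have : 1 ≤ (Λ + s) * exp (n * Λ) := by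
      have := Real.one_le_exp (x := n * Λ) (by positivity)
      nlinarith
    have := Real.exp_pos 1
    nlinarith
  have h7 : s ≤ log (exp 1 + D / ubv n) + log (Λ + s) + n * Λ := by
    have hp : 0 < exp 1 + D / ubv n := by positivity
    have hp2 : 0 < Λ + s := by linarith
    have := Real.log_le_log (by positivity) h6
    rwa [Real.log_mul (by positivity) (by positivity), Real.log_mul (by positivity) (by positivity),
      Real.log_exp] at this
  have h8 : log (Λ + s) ≤ (Λ + s) / 2 := by
    have h9 := Real.log_le_sub_one_of_pos (x := (Λ + s) / 2) (by linarith)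
    rw [Real.log_div (by linarith) (by norm_num)] at h9
    linarith [Real.log_two_lt_d9]
  have h10 := one_le_log_exp_add (t := D / ubv n) (by positivity)
  unfold logConst
  nlinarith

theorem LevelMass.cost_le (hn : 1 ≤ n) (h : LevelMass n Ω a D) (ha : 0 < a) (hD : 0 ≤ D)
    {i : WIdx n} (hi : Active n Ω i) :
    ENNReal.ofReal (side i ^ n / lamBall n (cen i) (7 * n * side i)) ≤
      ENNReal.ofReal ((1 + logConst n D) / ubv n) *
        ∫⁻ y in ball (cen i) (side i), logWt n (log (exp 1 + a)) y := by
  have hu := ubv_pos n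
  have hs := side_pos i
  have hn' : (1 : ℝ) ≤ n := by exact_mod_cast hn
  have hr : 0 < 7 * n * side i := by positivity
  have hK := logConst_pos n hD
  set Λ := lamBall n (cen i) (7 * n * side i) with hΛ
  have hΛ1 : 1 ≤ Λ := one_le_lamBall _ hr
  have h1 : log (exp 1 + a) ≤ logConst n D * Λ := h.log_le ha hD hr fun y hy =>
    hi.mem hn (by simpa [dist_eq_norm] using hy)
  have h2 : ∀ y ∈ ball (cen i) (side i), ENNReal.ofReal (1 / ((1 + logConst n D) * Λ)) ≤
      logWt n (log (exp 1 + a)) y := fun y hy => by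
    have hy' : ‖y - cen i‖ < side i := by simpa [dist_eq_norm] using hy
    have h3 : log (exp 1 + ‖y‖) ≤ Λ := log_exp_add_le_lamBall hr (norm_nonneg y) (by
      have h4 := norm_le_norm_add_norm_sub (cen i) y
      rw [norm_sub_rev] at h4
      nlinarith)
    refine ENNReal.ofReal_le_ofReal (one_div_le_one_div_of_le ?_ (by linarith))
    linarith [one_le_log_exp_add (norm_nonneg y), one_le_log_exp_add ha.le]
  calc ENNReal.ofReal (side i ^ n / Λ)
      = ENNReal.ofReal ((1 + logConst n D) / ubv n) *
        ∫⁻ _y in ball (cen i) (side i), ENNReal.ofReal (1 / ((1 + logConst n D) * Λ)) := by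
        rw [setLIntegral_const, volume_ball_eq _ hs, ← ENNReal.ofReal_mul (by positivity),
          ← ENNReal.ofReal_mul (by positivity)]
        congr 1
        field_simp
    _ ≤ _ := mul_le_mul_right (setLIntegral_mono' measurableSet_ball h2) _

open Classical in
theorem tsum_ball_lintegral_le (hn : 1 ≤ n) (w : Eucl n → ℝ≥0∞) (hw : Measurable w) :
    ∑' i, (if Active n Ω i then ∫⁻ y in ball (cen i) (side i), w y else 0) ≤
      overlap n * ∫⁻ y in Ω, w y := by
  have hn' : (1 : ℝ) ≤ n := by exact_mod_cast hn
  have e1 : ∀ i, (if Active n Ω i then ∫⁻ y in ball (cen i) (side i), w y else 0) =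
      ∫⁻ y in Ω, (if Active n Ω i then (ball (cen i) (side i)).indicator w y else 0) := fun i => by
    have hs := side_pos i
    by_cases hi : Active n Ω i
    · simp only [hi, if_true]
      rw [lintegral_indicator measurableSet_ball, Measure.restrict_restrict measurableSet_ball,
        Set.inter_eq_left.2 fun y hy => hi.mem hn (by
          have : ‖y - cen i‖ < side i := by simpa [dist_eq_norm] using hy
          nlinarith)]
    · simp [hi]
  simp only [e1]
  rw [← lintegral_tsum, ← lintegral_const_mul' _ _ (ENNReal.natCast_ne_top _)]
  · refine lintegral_mono fun y => ?_
    obtain ⟨S, hS, hA⟩ := exists_finset_active (Ω := Ω) hn y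
    have h0 : ∀ i ∉ S, (if Active n Ω i then (ball (cen i) (side i)).indicator w y else 0) = 0 := by
      intro i hi
      split_ifs with h
      · refine Set.indicator_of_notMem (fun hy => hi (hA i h ?_)) _
        have hs := side_pos i
        have : ‖y - cen i‖ < side i := by simpa [dist_eq_norm] using hy
        nlinarith
      · rfl
    rw [tsum_eq_sum h0]
    refine (Finset.sum_le_card_nsmul S _ (w y) fun i _ => ?_).trans ?_
    · split_ifs
      · exact Set.indicator_le_self _ _ _
      · exact zero_le
    · rw [nsmul_eq_mul]
      gcongr
  · intro i
    split_ifs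
    · exact (hw.indicator measurableSet_ball).aemeasurable
    · exact aemeasurable_const

open Classical in
theorem LevelMass.tsum_cost_le (hn : 1 ≤ n) (h : LevelMass n Ω a D) (ha : 0 < a) (hD : 0 ≤ D) :
    ∑' i, ENNReal.ofReal
        (if Active n Ω i then side i ^ n / lamBall n (cen i) (7 * n * side i) else 0) ≤
      ENNReal.ofReal ((1 + logConst n D) / ubv n * overlap n) *
        ∫⁻ y in Ω, logWt n (log (exp 1 + a)) y := by
  have hu := ubv_pos n
  have hK := logConst_pos n hD
  calc _ ≤ ∑' i, ENNReal.ofReal ((1 + logConst n D) / ubv n) * (if Active n Ω i then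
        ∫⁻ y in ball (cen i) (side i), logWt n (log (exp 1 + a)) y else 0) := by
        refine ENNReal.tsum_le_tsum fun i => ?_
        by_cases hi : Active n Ω i
        · simp only [hi, if_true]
          exact h.cost_le hn ha hD hi
        · simp [hi]
    _ ≤ ENNReal.ofReal ((1 + logConst n D) / ubv n) *
        (overlap n * ∫⁻ y in Ω, logWt n (log (exp 1 + a)) y) := by
        rw [ENNReal.tsum_mul_left]
        exact mul_le_mul_right (tsum_ball_lintegral_le hn _ (measurable_logWt n _)) _
    _ = _ := by
        rw [← mul_assoc, ENNReal.ofReal_mul (by positivity), ENNReal.ofReal_natCast]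

end

section

variable {n : ℕ} {φ f ψ : Eucl n → ℝ} {U : ℤ → Set (Eucl n)} {M c D R : ℝ}

/-- A family of level sets at the dyadic heights with finite total weighted measure. -/
structure IsLevelSystem (n : ℕ) (f : Eucl n → ℝ) (U : ℤ → Set (Eucl n)) (c D : ℝ) : Prop where
  pair : ∀ k : ℤ, IsLevelPair n f (U k) (U (k + 1)) (c * 2 ^ k)
  mass : ∑' k : ℤ, ENNReal.ofReal (2 ^ k) * ∫⁻ x in U k, logWt n (log (exp 1 + 2 ^ k)) x ≤
    ENNReal.ofReal D
  nonneg : 0 ≤ D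

theorem IsLevelSystem.levelMass (h : IsLevelSystem n f U c D) (k : ℤ) :
    LevelMass n (U k) (2 ^ k) D :=
  (ENNReal.le_tsum k).trans h.mass

theorem IsLevelSystem.antitone (h : IsLevelSystem n f U c D) : Antitone U :=
  antitone_int_of_succ_le fun k => (h.pair k).subset

theorem exists_isLevelSystem (hn : 1 ≤ n) (hφ : IsKer n φ M) :
    ∃ c D : ℝ, 0 ≤ c ∧ 0 ≤ D ∧ ∀ f, IsGood n φ f → ∫⁻ x, thetaE n x (maxFun n φ f x) ≤ 1 →
      ∃ U, IsLevelSystem n f U c D := by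
  obtain ⟨D, hD, hmass⟩ := exists_tsum_bigSet_le hn hφ
  obtain ⟨C, hC, hL⟩ := exists_levelBound hn hφ
  have hM := hφ.nonneg
  refine ⟨2 * C * (M + 5 * (n + 2) * (20 * n) ^ (n + 1)), D, by positivity, hD.le,
    fun f hf h1 => ⟨fun k => bigSet n φ f (2 ^ k), ?_⟩⟩
  have hm : ∑' k : ℤ, ENNReal.ofReal (2 ^ k) *
      ∫⁻ x in bigSet n φ f (2 ^ k), logWt n (log (exp 1 + 2 ^ k)) x ≤ ENNReal.ofReal D :=
    (hmass f hf.loc).trans (mul_le_of_le_one_right zero_le h1)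
  refine ⟨fun k => ?_, hm, hD.le⟩
  have hk : (0 : ℝ) < 2 ^ k := by positivity
  have hne : (bigSet n φ f (2 ^ k))ᶜ.Nonempty :=
    LevelMass.compl_nonempty hn ((ENNReal.le_tsum k).trans hm) hk hD.le
  have := (hL f hf.loc).isLevelPair hn hφ hC hf hk hne
  rwa [show (2 : ℝ) * 2 ^ k = 2 ^ (k + 1) by rw [zpow_add_one₀ two_ne_zero, mul_comm]] at this

theorem IsLevelSystem.tendsto_integral_whitExt_atTop (hn : 1 ≤ n) (h : IsLevelSystem n f U c D)
    (hψ : IsTest n R ψ) :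
    Tendsto (fun k : ℕ => ∫ y, f y * whitExt n (U k) ψ y) atTop (𝓝 (∫ y, f y * ψ y)) := by
  have ho : ∀ k : ℕ, IsOpen (U k) := fun k => (h.pair k).isOpen_left
  refine tendsto_integral_whitExt hn (h.pair 0).loc hψ (U := fun k : ℕ => U k) ho
    (h.pair 0).nonempty (fun k => h.antitone (by simp)) fun r => ?_
  exact tendsto_volume_inter_ball (D := D) (U := fun k : ℕ => U k)
    (fun k => by simpa using h.levelMass k) ho h.nonneg r

theorem IsLevelSystem.tendsto_integral_whitExt_atBot (hn : 1 ≤ n) (h : IsLevelSystem n f U c D)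
    (hψ : IsTest n R ψ) :
    Tendsto (fun k : ℕ => ∫ y, f y * whitExt n (U (-k)) ψ y) atTop (𝓝 0) := by
  set B := (1 + overlap n * (ubv n)⁻¹) * ∫ y, |ψ y| with hB
  have h1 : Tendsto (fun k : ℕ => c * B * (1 / 2 : ℝ) ^ k) atTop (𝓝 (c * B * 0)) :=
    (tendsto_pow_atTop_nhds_zero_of_lt_one (by norm_num) (by norm_num)).const_mul _
  rw [mul_zero] at h1
  refine squeeze_zero_norm (fun k => ?_) h1
  refine (abs_integral_whitExt_le hn (h.pair (-k)) hψ).trans_eq ?_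
  rw [zpow_neg, zpow_natCast, one_div, inv_pow]
  ring

theorem hasSum_sub_of_tendsto {a : ℤ → ℝ} {G : ℤ → ℝ} {g s : ℝ} (ha : HasSum a s)
    (h : ∀ k, a k = G (k + 1) - G k) (hT : Tendsto (fun k : ℕ => G k) atTop (𝓝 g))
    (hB : Tendsto (fun k : ℕ => G (-k)) atTop (𝓝 0)) : s = g := by
  have h1 := ha.nat_add_neg_add_one.tendsto_sum_nat
  have h2 : ∀ N : ℕ, ∑ i ∈ Finset.range N, (a i + a (-(i + 1))) = G N - G (-N) := fun N => by
    induction N with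
    | zero => simp
    | succ m ih =>
      have e : (-((m : ℤ) + 1)) + 1 = -m := by ring
      rw [Finset.sum_range_succ, ih, h, h, e]
      push_cast
      ring
  simp only [h2] at h1
  exact tendsto_nhds_unique h1 (by simpa using hT.sub hB)

open Classical in
/-- The relative cost of the atom attached to an index. -/
def whitCost (n : ℕ) (Ω : Set (Eucl n)) (i : WIdx n) : ℝ :=
  if Active n Ω i then side i ^ n / lamBall n (cen i) (7 * n * side i) else 0

theorem whitCost_nonneg (hn : 1 ≤ n) (Ω : Set (Eucl n)) (i : WIdx n) : 0 ≤ whitCost n Ω i := by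
  have hs := side_pos i
  have hn' : (1 : ℝ) ≤ n := by exact_mod_cast hn
  have := one_le_lamBall (n := n) (cen i) (r := 7 * n * side i) (by positivity)
  unfold whitCost
  split_ifs
  · positivity
  · exact le_rfl

theorem exists_blocks_of_isLevelSystem (hn : 2 ≤ n) (hφ : IsKer n φ M) (hc : 0 ≤ c) (hD : 0 ≤ D) :
    ∃ C : ℝ, 0 < C ∧ ∀ f U, IsLevelSystem n f U c D →
      ∃ (κ : ℤ × WIdx n × Bool → ℝ) (F : ℤ × WIdx n × Bool → Eucl n → ℝ),
        (∀ j, 0 ≤ κ j) ∧ (∀ j, IsBlock n φ (κ j) (F j)) ∧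
        ∑' j, ENNReal.ofReal (κ j) ≤ ENNReal.ofReal C ∧
        ∀ R ψ, IsTest n R ψ → HasSum (fun j => ∫ x, F j x * ψ x) (∫ x, f x * ψ x) := by
  have hn1 : 1 ≤ n := by linarith
  have hn' : (1 : ℝ) ≤ n := by exact_mod_cast hn1
  have hu := ubv_pos n
  have hA := atomConst_nonneg n
  have hlc := logConst_pos n hD
  obtain ⟨Cb, hCb, hblk⟩ := exists_blocks_of_atom hn hφ
  set K := Cb * (atomConst n * c * (7 * n) ^ n) with hK
  set L := (1 + logConst n D) / ubv n * overlap n with hL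
  have hK0 : 0 ≤ K := by positivity
  have hL0 : 0 ≤ L := by positivity
  refine ⟨2 * (K * L * D) + 1, by positivity, fun f U hU => ?_⟩
  have key : ∀ (k : ℤ) (i : WIdx n), ∃ F : Bool → Eucl n → ℝ,
      (∀ x, whitAtom n f (U k) (U (k + 1)) i x = F true x + F false x) ∧
        ∀ b, IsBlock n φ (K * 2 ^ k * whitCost n (U k) i) (F b) := fun k i => by
    have hs := side_pos i
    have hr : 0 < 7 * n * side i := by positivity
    by_cases hi : Active n (U k) i
    · obtain ⟨F, hF, hb⟩ := hblk _ _ _ _ hr ((hU.pair k).isHAtom hn i)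
      refine ⟨F, hF, fun b => ?_⟩
      convert hb b using 1
      simp only [whitCost, hi, if_true, hK]
      ring
    · obtain ⟨F, hF, hb⟩ := hblk (cen i) _ 0 _ hr (isHAtom_zero (cen i) _ le_rfl)
      refine ⟨F, fun x => by rw [whitAtom_of_not_active hi, ← hF x], fun b => ?_⟩
      simpa [whitCost, hi] using hb b
  choose F hF hb using key
  clear_value K L
  have hκ0 : ∀ (k : ℤ) (i : WIdx n), 0 ≤ K * 2 ^ k * whitCost n (U k) i := fun k i =>
    mul_nonneg (by positivity) (whitCost_nonneg hn1 _ i)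
  have hsum : ∑' j : ℤ × WIdx n × Bool, ENNReal.ofReal (K * 2 ^ j.1 * whitCost n (U j.1) j.2.1) ≤
      ENNReal.ofReal (2 * (K * L * D) + 1) := by
    calc _ = ∑' k : ℤ, 2 * (ENNReal.ofReal K * (ENNReal.ofReal (2 ^ k) *
          ∑' i, ENNReal.ofReal (whitCost n (U k) i))) := by
          rw [ENNReal.tsum_prod (f := fun k (p : WIdx n × Bool) =>
            ENNReal.ofReal (K * 2 ^ k * whitCost n (U k) p.1))]
          refine tsum_congr fun k => ?_
          rw [ENNReal.tsum_prod (f := fun i (_ : Bool) =>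
            ENNReal.ofReal (K * 2 ^ k * whitCost n (U k) i)), ← ENNReal.tsum_mul_left, ← ENNReal.tsum_mul_left,
            ← ENNReal.tsum_mul_left]
          refine tsum_congr fun i => ?_
          rw [tsum_bool, ← two_mul, ENNReal.ofReal_mul (by positivity), ENNReal.ofReal_mul hK0,
            mul_assoc]
      _ ≤ ∑' k : ℤ, 2 * (ENNReal.ofReal K * (ENNReal.ofReal (2 ^ k) *
          (ENNReal.ofReal L * ∫⁻ x in U k, logWt n (log (exp 1 + 2 ^ k)) x))) := by
          refine ENNReal.tsum_le_tsum fun k => ?_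
          gcongr
          rw [hL]
          exact (hU.levelMass k).tsum_cost_le hn1 (by positivity) hD
      _ = 2 * (ENNReal.ofReal K * (ENNReal.ofReal L * ∑' k : ℤ, ENNReal.ofReal (2 ^ k) *
          ∫⁻ x in U k, logWt n (log (exp 1 + 2 ^ k)) x)) := by
          simp only [← ENNReal.tsum_mul_left]
          refine tsum_congr fun k => ?_
          ring
      _ ≤ 2 * (ENNReal.ofReal K * (ENNReal.ofReal L * ENNReal.ofReal D)) := by
          gcongr
          exact hU.mass
      _ = ENNReal.ofReal (2 * (K * L * D)) := by
          rw [ENNReal.ofReal_mul zero_le_two, ENNReal.ofReal_mul (by positivity),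
            ENNReal.ofReal_mul hK0, ENNReal.ofReal_ofNat, mul_assoc (ENNReal.ofReal K)]
      _ ≤ _ := ENNReal.ofReal_le_ofReal (by linarith)
  refine ⟨fun j => K * 2 ^ j.1 * whitCost n (U j.1) j.2.1, fun j => F j.1 j.2.1 j.2.2,
    fun j => hκ0 _ _, fun j => hb _ _ _, hsum, fun R ψ hψ => ?_⟩
  have hκs : Summable fun j : ℤ × WIdx n × Bool => K * 2 ^ j.1 * whitCost n (U j.1) j.2.1 := by
    have := ENNReal.summable_toReal (hsum.trans_lt ENNReal.ofReal_lt_top).ne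
    refine this.congr fun j => ENNReal.toReal_ofReal (hκ0 _ _)
  have hs : Summable fun j : ℤ × WIdx n × Bool => ∫ x, F j.1 j.2.1 j.2.2 x * ψ x :=
    Summable.of_norm_bounded (hκs.mul_left (testConst n R)) fun j => (hb _ _ _).test R ψ hψ
  set G : ℤ → ℝ := fun k => ∫ y, f y * whitExt n (U k) ψ y with hG
  have hmul : ∀ k i b, Integrable fun x => F k i b x * ψ x := fun k i b =>
    (hb k i b).int.mul_bdd (c := R) hψ.continuous.aestronglyMeasurable
      (Eventually.of_forall hψ.bound)
  have hbool : ∀ k i, HasSum (fun b => ∫ x, F k i b x * ψ x)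
      (∫ x, whitAtom n f (U k) (U (k + 1)) i x * ψ x) := fun k i => by
    have : ∫ x, whitAtom n f (U k) (U (k + 1)) i x * ψ x =
        (∫ x, F k i true x * ψ x) + ∫ x, F k i false x * ψ x := by
      rw [← integral_add (hmul k i true) (hmul k i false)]
      simp only [hF, add_mul]
    rw [this, ← Fintype.sum_bool fun b => ∫ x, F k i b x * ψ x]
    exact hasSum_fintype _
  have hlevel : ∀ k, HasSum (fun p : WIdx n × Bool => ∫ x, F k p.1 p.2 x * ψ x)
      (G (k + 1) - G k) := fun k => by
    have h1 : Summable fun p : WIdx n × Bool => ∫ x, F k p.1 p.2 x * ψ x :=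
      hs.comp_injective (i := fun p => (k, p)) (Prod.mk_right_injective k)
    have h2 := h1.hasSum.prod_fiberwise fun i => hbool k i
    rw [← h2.unique (hasSum_integral_whitAtom hn (hU.pair k) hψ)]
    exact h1.hasSum
  have h3 := hs.hasSum.prod_fiberwise fun k => hlevel k
  rw [← hasSum_sub_of_tendsto h3 (fun _ => rfl) (hU.tendsto_integral_whitExt_atTop hn1 hψ)
    (hU.tendsto_integral_whitExt_atBot hn1 hψ)]
  exact hs.hasSum

end

section

variable {n : ℕ} {φ f ψ : Eucl n → ℝ} {M : ℝ}

theorem maxFun_const_mul (n : ℕ) (φ f : Eucl n → ℝ) {a : ℝ} (ha : 0 ≤ a) (x : Eucl n) :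
    maxFun n φ (fun y => a * f y) x = ENNReal.ofReal a * maxFun n φ f x := by
  unfold maxFun
  simp only [mul_assoc, integral_const_mul, abs_mul, abs_of_nonneg ha, ENNReal.ofReal_mul ha,
    ENNReal.mul_iSup]

theorem H1Norm_const_mul (n : ℕ) (φ f : Eucl n → ℝ) {a : ℝ} (ha : 0 ≤ a) :
    H1Norm n φ (fun y => a * f y) = ENNReal.ofReal a * H1Norm n φ f := by
  unfold H1Norm
  simp only [maxFun_const_mul n φ f ha]
  exact lintegral_const_mul' _ _ ENNReal.ofReal_ne_top

theorem IsGood.const_mul (h : IsGood n φ f) {a : ℝ} (ha : 0 ≤ a) :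
    IsGood n φ (fun y => a * f y) where
  loc := h.loc.smul a
  meas := h.meas.const_mul a
  le x := by
    rw [maxFun_const_mul n φ f ha, abs_mul, abs_of_nonneg ha, ENNReal.ofReal_mul ha]
    gcongr
    exact h.le x

/-- A sequence of pairs factorizing `f` weakly with total cost at most `κ`. -/
structure IsWeakFactorization (n : ℕ) (φ f : Eucl n → ℝ) (u v : ℕ → Eucl n → ℝ) (κ : ℝ≥0∞) :
    Prop where
  loc_left : ∀ k, LocallyIntegrable (u k) volume
  loc_right : ∀ k, LocallyIntegrable (v k) volume
  left : ∀ k, H1Norm n φ (u k) < ⊤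
  right : ∀ k, BMOplus n (v k) < ⊤
  int : ∀ k, Integrable (fun x => u k x * v k x) volume
  sum : ∀ R ψ, IsTest n R ψ → HasSum (fun k => ∫ x, u k x * v k x * ψ x) (∫ x, f x * ψ x)
  cost : ∑' k, H1Norm n φ (u k) * BMOplus n (v k) ≤ κ

theorem exists_isWeakFactorization_of_le (hn : 2 ≤ n) (hφ : IsKer n φ M) :
    ∃ C : ℝ, 0 < C ∧ ∀ (f : Eucl n → ℝ) (lam : ℝ), LocallyIntegrable f volume → 0 < lam →
      ∫⁻ x, thetaE n x (maxFun n φ f x / ENNReal.ofReal lam) ≤ 1 →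
      (∃ u v, IsWeakFactorization n φ f u v (ENNReal.ofReal (C * lam))) ∧
        ∀ R ψ, IsTest n R ψ → |∫ x, f x * ψ x| ≤ testConst n R * (C * lam) := by
  obtain ⟨c, D, hc, hD, hsys⟩ := exists_isLevelSystem (by linarith) hφ
  obtain ⟨C, hC, hblocks⟩ := exists_blocks_of_isLevelSystem hn hφ hc hD
  refine ⟨C, hC, fun f lam hf hlam hle => ?_⟩
  obtain ⟨g, hg, hfg⟩ := exists_isGood hφ hf
  have hmax : ∀ x, maxFun n φ (fun y => lam⁻¹ * g y) x = maxFun n φ f x / ENNReal.ofReal lam :=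
    fun x => by
      rw [maxFun_const_mul n φ g (by positivity), maxFun_congr_ae hfg, div_eq_mul_inv, mul_comm,
        ENNReal.ofReal_inv_of_pos hlam]
  obtain ⟨U, hU⟩ := hsys _ (hg.const_mul (a := lam⁻¹) (by positivity)) (by simpa only [hmax])
  obtain ⟨κ, F, hκ, hF, hsum, hdist⟩ := hblocks _ U hU
  have hfψ : ∀ ψ : Eucl n → ℝ, ∫ x, f x * ψ x = lam * ∫ x, lam⁻¹ * g x * ψ x := fun ψ => by
    rw [← integral_const_mul]
    refine integral_congr_ae (hfg.mono fun x hx => ?_)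
    beta_reduce
    rw [hx, mul_assoc, mul_inv_cancel_left₀ hlam.ne']
  constructor
  · choose u v hu hv hu1 hv1 huv hcost using fun j => (hF j).fac
    obtain ⟨e⟩ : Nonempty (ℕ ≃ ℤ × WIdx n × Bool) := nonempty_equiv_of_countable
    have hprod : ∀ j x, lam * u j x * v j x = lam * F j x := fun j x => by rw [mul_assoc, huv]
    refine ⟨fun k x => lam * u (e k) x, fun k => v (e k), fun k => (hu _).smul lam,
      fun k => hv _, fun k => ?_, fun k => hv1 _, fun k => ?_, fun R ψ hψ => ?_, ?_⟩
    · rw [H1Norm_const_mul n φ _ hlam.le]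
      exact ENNReal.mul_lt_top ENNReal.ofReal_lt_top (hu1 _)
    · simp only [hprod]
      exact (hF _).int.const_mul lam
    · simp only [hprod, hfψ, mul_assoc, integral_const_mul]
      simpa only [mul_assoc, integral_const_mul, Function.comp_def] using
        (e.hasSum_iff.2 (hdist R ψ hψ)).mul_left lam
    · calc _ ≤ ∑' k, ENNReal.ofReal lam * ENNReal.ofReal (κ (e k)) := by
            refine ENNReal.tsum_le_tsum fun k => ?_
            rw [H1Norm_const_mul n φ _ hlam.le, mul_assoc]
            gcongr
            exact hcost _
        _ = ENNReal.ofReal lam * ∑' j, ENNReal.ofReal (κ j) := by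
            rw [ENNReal.tsum_mul_left, e.tsum_eq fun j => ENNReal.ofReal (κ j)]
        _ ≤ ENNReal.ofReal lam * ENNReal.ofReal C := by gcongr
        _ = _ := by rw [← ENNReal.ofReal_mul hlam.le, mul_comm]
  · intro R ψ hψ
    have hT := testConst_nonneg n hψ.pos
    have hne : ∑' j, ENNReal.ofReal (κ j) ≠ ⊤ := (hsum.trans_lt ENNReal.ofReal_lt_top).ne
    have hκs : Summable κ :=
      (ENNReal.summable_toReal hne).congr fun j => ENNReal.toReal_ofReal (hκ j)
    have hκC : ∑' j, κ j ≤ C := by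
      rwa [← ENNReal.ofReal_tsum_of_nonneg hκ hκs, ENNReal.ofReal_le_ofReal_iff hC.le] at hsum
    have h1 : |∫ x, lam⁻¹ * g x * ψ x| ≤ testConst n R * ∑' j, κ j := by
      rw [← (hdist R ψ hψ).tsum_eq]
      exact tsum_of_norm_bounded (f := fun j => ∫ x, F j x * ψ x) (hκs.hasSum.mul_left _) fun j => (hF j).test R ψ hψ
    rw [hfψ, abs_mul, abs_of_pos hlam]
    calc lam * |∫ x, lam⁻¹ * g x * ψ x| ≤ lam * (testConst n R * C) := by
          gcongr
          exact h1.trans (by gcongr)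
      _ = _ := by ring

theorem exists_isWeakFactorization (hn : 2 ≤ n) (hφ : IsKer n φ M) :
    ∃ C : ℝ, 0 < C ∧ ∀ f : Eucl n → ℝ, LocallyIntegrable f volume → HlogNorm n φ f < ⊤ →
      ∃ u v, IsWeakFactorization n φ f u v (ENNReal.ofReal C * HlogNorm n φ f) := by
  obtain ⟨C, hC, h⟩ := exists_isWeakFactorization_of_le hn hφ
  refine ⟨2 * C, by positivity, fun f hf hfin => ?_⟩
  have hlt : ∀ b, HlogNorm n φ f < b → b < ⊤ → ∃ lam : ℝ, 0 < lam ∧ ENNReal.ofReal lam < b ∧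
      ∫⁻ x, thetaE n x (maxFun n φ f x / ENNReal.ofReal lam) ≤ 1 := fun b hb hbt => by
    obtain ⟨l, ⟨hl0, hl⟩, hlb⟩ := sInf_lt_iff.1 hb
    have hlt := (hlb.trans hbt).ne
    exact ⟨l.toReal, ENNReal.toReal_pos hl0 hlt, by rwa [ENNReal.ofReal_toReal hlt],
      by rwa [ENNReal.ofReal_toReal hlt]⟩
  by_cases h0 : HlogNorm n φ f = 0
  · have hzero : ∀ R ψ, IsTest n R ψ → ∫ x, f x * ψ x = 0 := fun R ψ hψ => by
      have hT := testConst_nonneg n hψ.pos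
      rw [← abs_nonpos_iff]
      refine le_of_forall_pos_le_add fun ε hε => ?_
      have hb : 0 < ε / (testConst n R * C + 1) := by positivity
      obtain ⟨lam, hl, hlb, hle⟩ := hlt (ENNReal.ofReal (ε / (testConst n R * C + 1)))
        (by rw [h0]; simpa using hb) ENNReal.ofReal_lt_top
      rw [ENNReal.ofReal_lt_ofReal_iff hb, lt_div_iff₀ (by positivity)] at hlb
      have := (h f lam hf hl hle).2 R ψ hψ
      nlinarith
    have hH : H1Norm n φ (fun _ => 0) = 0 := by simp [H1Norm, maxFun]
    have hB : BMOplus n (fun _ => 0) = 0 := by simp [BMOplus, setAvg]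
    refine ⟨fun _ _ => 0, fun _ _ => 0, fun _ => locallyIntegrable_const 0,
      fun _ => locallyIntegrable_const 0, fun _ => by simp [hH], fun _ => by simp [hB],
      fun _ => by simp, fun R ψ hψ => ?_, by simp [hH]⟩
    rw [hzero R ψ hψ]
    simp
  · obtain ⟨lam, hl, hlb, hle⟩ := hlt (2 * HlogNorm n φ f)
      (by simpa [two_mul] using ENNReal.lt_add_right hfin.ne h0)
      (ENNReal.mul_lt_top (by simp) hfin)
    obtain ⟨u, v, huv⟩ := (h f lam hf hl hle).1
    refine ⟨u, v, { huv with cost := huv.cost.trans ?_ }⟩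
    calc ENNReal.ofReal (C * lam) = ENNReal.ofReal C * ENNReal.ofReal lam :=
          ENNReal.ofReal_mul hC.le
      _ ≤ ENNReal.ofReal C * (2 * HlogNorm n φ f) := by gcongr
      _ = _ := by
          rw [ENNReal.ofReal_mul zero_le_two, ENNReal.ofReal_ofNat]
          ring

end

/-- **Weak factorization of `H^{log}(ℝⁿ)`** (Theorem 1.1):
any `f ∈ H^{log}` is a distributional sum `Σ_k u_k v_k` with `u_k ∈ H¹`, `v_k ∈ BMO⁺`
and `Σ_k ‖u_k‖_{H¹} ‖v_k‖_{BMO⁺} ≲ ‖f‖_{H^{log}}`. -/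
theorem weak_factorization_Hlog
    (n : ℕ) (hn : 2 ≤ n) (φ₀ : Eucl n → ℝ)
    (hφ_smooth : ContDiff ℝ (⊤ : ℕ∞) φ₀)
    (hφ_supp : Function.support φ₀ ⊆ Metric.closedBall 0 1)
    (hφ_int : ∫ x, φ₀ x = 1) :
    ∃ C : ℝ, 0 < C ∧
      ∀ f : Eucl n → ℝ, LocallyIntegrable f volume → HlogNorm n φ₀ f < ⊤ →
        ∃ u v : ℕ → Eucl n → ℝ,
          (∀ k, LocallyIntegrable (u k) volume) ∧
          (∀ k, LocallyIntegrable (v k) volume) ∧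
          (∀ k, H1Norm n φ₀ (u k) < ⊤) ∧
          (∀ k, BMOplus n (v k) < ⊤) ∧
          (∀ k, Integrable (fun x => u k x * v k x) volume) ∧
          (∀ ψ : Eucl n → ℝ, ContDiff ℝ (⊤ : ℕ∞) ψ → HasCompactSupport ψ →
            Tendsto (fun N => ∑ k ∈ Finset.range (N + 1), ∫ x, u k x * v k x * ψ x)
              atTop (𝓝 (∫ x, f x * ψ x))) ∧
          ∑' k, H1Norm n φ₀ (u k) * BMOplus n (v k) ≤ ENNReal.ofReal C * HlogNorm n φ₀ f := by
  obtain ⟨M, hM⟩ := exists_isKer n φ₀ hφ_smooth hφ_supp hφ_int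
  obtain ⟨C, hC, h⟩ := exists_isWeakFactorization hn hM
  refine ⟨C, hC, fun f hf hfin => ?_⟩
  obtain ⟨u, v, huv⟩ := h f hf hfin
  refine ⟨u, v, huv.loc_left, huv.loc_right, huv.left, huv.right, huv.int, fun ψ hψ hc => ?_,
    huv.cost⟩
  obtain ⟨R, hR⟩ := exists_isTest hψ hc
  exact (tendsto_add_atTop_iff_nat 1).2 (huv.sum R ψ hR).tendsto_sum_nat
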